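/- arXiv:0805.2618 — 2 statements merged into one kernel-verified Lean document; each statement's English description precedes it below -/
import Mathlib

section
/- Let α ∈ (1,2) and σ(h) = h^{α/2}, and let u_h be the threshold dynamics iterates started from an open set Ω₀ with Γ₀ = ∂Ω₀ = ∂(ℝ^N ∖ closure(Ω₀)). Then ū := limsup* u_h is a viscosity subsolution, and u̲ := liminf_* u_h is a viscosity supersolution, of the weighted mean curvature equation u_t = C_α tr((I − D̂u ⊗ D̂u) D²u) on ℝ^N × (0,∞). -/
open MeasureTheory Filter Metric Set
open scoped Topology RealInnerProductSpace ENNReal NNReal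

noncomputable section

abbrev Euc (n : ℕ) : Type := EuclideanSpace ℝ (Fin n)

/-- `sign`: `1` if positive, `-1` otherwise. -/
def thSign (s : ℝ) : ℝ := if 0 < s then 1 else -1

/-- `1^+ - 1^-`: `1` if `0 ≤ s`, `-1` otherwise. -/
def sgnGe (s : ℝ) : ℝ := if 0 ≤ s then 1 else -1

/-- `1_+ - 1_-`: `1` if `0 < s`, `-1` otherwise. -/
def sgnGt (s : ℝ) : ℝ := if 0 < s then 1 else -1

/-- indicator of `[0,∞)`. -/
def indPlus (s : ℝ) : ℝ := if 0 ≤ s then 1 else 0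

/-- The embedding `ℝ^{n-1} → ℝ^n`, `y' ↦ (0, y')`. -/
def pad (d : ℕ) (y' : Euc (d+1)) : Euc (d+2) :=
  (EuclideanSpace.equiv (Fin (d+2)) ℝ).symm
    (Fin.cons 0 (EuclideanSpace.equiv (Fin (d+1)) ℝ y'))

/-- the surface area of the unit sphere of `ℝ^m`. -/
def sphereArea (m : ℕ) : ℝ := 2 * Real.pi ^ ((m : ℝ)/2) / Real.Gamma ((m : ℝ)/2)

/-- the initial datum `1_{Ω₀} - 1_{(closure Ω₀)ᶜ}`. -/
def isSgnInitial (n : ℕ) (Ω₀ : Set (Euc n)) (v : Euc n → ℝ) : Prop :=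
  ∀ x, v x = Ω₀.indicator (fun _ => (1:ℝ)) x - ((closure Ω₀)ᶜ).indicator (fun _ => (1:ℝ)) x

/-- `U h k` is the threshold dynamics iterate at time step `k` with parameter `h`:
`u_h(⬝, (k+1)h) = sign (p(⬝, σ(h)) * u_h(⬝, kh))`. -/
def IsThresholdDynamics (n : ℕ) (p : Euc n → ℝ → ℝ) (σ : ℝ → ℝ) (Ω₀ : Set (Euc n))
    (U : ℝ → ℕ → Euc n → ℝ) : Prop :=
  ∀ h : ℝ, 0 < h → isSgnInitial n Ω₀ (U h 0) ∧
    ∀ (k : ℕ) (x : Euc n), U h (k+1) x = thSign (∫ y, p (x - y) (σ h) * U h k y)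

/-- `limsup* U (x,t)`, the upper half-relaxed limit as `h → 0⁺`, `y → x`, `kh → t`. -/
def limsupStar (n : ℕ) (U : ℝ → ℕ → Euc n → ℝ) (x : Euc n) (t : ℝ) : ℝ :=
  sInf {S : ℝ | ∃ ε : ℝ, 0 < ε ∧ S = sSup {v : ℝ | ∃ (h : ℝ) (k : ℕ) (y : Euc n),
    0 < h ∧ h < ε ∧ dist y x < ε ∧ |(k : ℝ) * h - t| < ε ∧ v = U h k y}}

/-- `liminf_* U (x,t)`, the lower half-relaxed limit as `h → 0⁺`, `y → x`, `kh → t`. -/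
def liminfStar (n : ℕ) (U : ℝ → ℕ → Euc n → ℝ) (x : Euc n) (t : ℝ) : ℝ :=
  sSup {S : ℝ | ∃ ε : ℝ, 0 < ε ∧ S = sInf {v : ℝ | ∃ (h : ℝ) (k : ℕ) (y : Euc n),
    0 < h ∧ h < ε ∧ dist y x < ε ∧ |(k : ℝ) * h - t| < ε ∧ v = U h k y}}

/-- a `C²` test function on `ℝ^n × (0,∞)`. -/
def IsC2Test (n : ℕ) (φ : Euc n → ℝ → ℝ) : Prop :=
  ContDiffOn ℝ 2 (fun q : Euc n × ℝ => φ q.1 q.2) (Set.univ ×ˢ Set.Ioi 0)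

/-- the spatial gradient `∇φ(x,t)`. -/
def spaceGrad (n : ℕ) (φ : Euc n → ℝ → ℝ) (x : Euc n) (t : ℝ) : Euc n :=
  gradient (fun y => φ y t) x

/-- the time derivative `φ_t(x,t)`. -/
def timeDeriv (n : ℕ) (φ : Euc n → ℝ → ℝ) (x : Euc n) (t : ℝ) : ℝ :=
  deriv (fun s => φ x s) t

/-- the spatial Hessian `D²φ(x,t)`. -/
def spaceHess (n : ℕ) (φ : Euc n → ℝ → ℝ) (x : Euc n) (t : ℝ) : Euc n →L[ℝ] Euc n :=
  fderiv ℝ (fun y => spaceGrad n φ y t) x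

/-- local boundedness of a space-time function. -/
def LocBounded (n : ℕ) (w : Euc n → ℝ → ℝ) : Prop :=
  ∀ K : Set (Euc n × ℝ), IsCompact K → ∃ M, ∀ q ∈ K, |w q.1 q.2| ≤ M

/-- `C tr((I - p̂ ⊗ p̂) D²φ)(x,t)` with `p̂ = ∇φ/|∇φ|`. -/
def mcfRHS (n : ℕ) (C : ℝ) (φ : Euc n → ℝ → ℝ) (x : Euc n) (t : ℝ) : ℝ :=
  C * (LinearMap.trace ℝ (Euc n) (spaceHess n φ x t : Euc n →ₗ[ℝ] Euc n) -
    @inner ℝ _ _ (spaceHess n φ x t (‖spaceGrad n φ x t‖⁻¹ • spaceGrad n φ x t))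
      (‖spaceGrad n φ x t‖⁻¹ • spaceGrad n φ x t))

/-- viscosity subsolution of `w_t = C tr((I - D̂w ⊗ D̂w) D²w)`. -/
def IsMCFSubsolution (n : ℕ) (C : ℝ) (w : Euc n → ℝ → ℝ) : Prop :=
  UpperSemicontinuousOn (fun q : Euc n × ℝ => w q.1 q.2) (Set.univ ×ˢ Set.Ioi 0) ∧
  LocBounded n w ∧
  ∀ φ : Euc n → ℝ → ℝ, IsC2Test n φ → ∀ (x : Euc n) (t : ℝ), 0 < t →
    (∀ y s, 0 < s → w y s - φ y s ≤ w x t - φ x t) →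
    (spaceGrad n φ x t ≠ 0 → timeDeriv n φ x t ≤ mcfRHS n C φ x t) ∧
    (spaceGrad n φ x t = 0 → spaceHess n φ x t = 0 → timeDeriv n φ x t ≤ 0)

/-- viscosity supersolution of `w_t = C tr((I - D̂w ⊗ D̂w) D²w)`. -/
def IsMCFSupersolution (n : ℕ) (C : ℝ) (w : Euc n → ℝ → ℝ) : Prop :=
  LowerSemicontinuousOn (fun q : Euc n × ℝ => w q.1 q.2) (Set.univ ×ˢ Set.Ioi 0) ∧
  LocBounded n w ∧
  ∀ φ : Euc n → ℝ → ℝ, IsC2Test n φ → ∀ (x : Euc n) (t : ℝ), 0 < t →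
    (∀ y s, 0 < s → w x t - φ x t ≤ w y s - φ y s) →
    (spaceGrad n φ x t ≠ 0 → mcfRHS n C φ x t ≤ timeDeriv n φ x t) ∧
    (spaceGrad n φ x t = 0 → spaceHess n φ x t = 0 → 0 ≤ timeDeriv n φ x t)

/-- the nonlocal operator `Ī_A[v]` (at a fixed time). -/
def Ibar (n : ℕ) (α : ℝ) (A : Set (Euc n)) (v : Euc n → ℝ) (x : Euc n) : ℝ :=
  ∫ y in A, sgnGe (v (x + y) - v x) * ‖y‖ ^ (-((n : ℝ) + α))

/-- the nonlocal operator `I̲_A[v]` (at a fixed time). -/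
def Iunder (n : ℕ) (α : ℝ) (A : Set (Euc n)) (v : Euc n → ℝ) (x : Euc n) : ℝ :=
  ∫ y in A, sgnGt (v (x + y) - v x) * ‖y‖ ^ (-((n : ℝ) + α))

/-- viscosity subsolution of the nonlocal equation `w_t = C |Dw| Ī[w]`. -/
def IsNLSubsolution (n : ℕ) (α C : ℝ) (w : Euc n → ℝ → ℝ) : Prop :=
  UpperSemicontinuousOn (fun q : Euc n × ℝ => w q.1 q.2) (Set.univ ×ˢ Set.Ioi 0) ∧
  LocBounded n w ∧
  ∀ φ : Euc n → ℝ → ℝ, IsC2Test n φ → ∀ (x : Euc n) (t : ℝ), 0 < t →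
    (∀ y s, 0 < s → w y s - φ y s ≤ w x t - φ x t) →
    ∀ δ : ℝ, 0 < δ →
      timeDeriv n φ x t ≤ C * ‖spaceGrad n φ x t‖ *
        (Ibar n α (Metric.ball 0 δ) (fun y => φ y t) x +
          Ibar n α (Metric.ball 0 δ)ᶜ (fun y => w y t) x)

/-- viscosity supersolution of the nonlocal equation `w_t = C |Dw| Ī[w]`. -/
def IsNLSupersolution (n : ℕ) (α C : ℝ) (w : Euc n → ℝ → ℝ) : Prop :=
  LowerSemicontinuousOn (fun q : Euc n × ℝ => w q.1 q.2) (Set.univ ×ˢ Set.Ioi 0) ∧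
  LocBounded n w ∧
  ∀ φ : Euc n → ℝ → ℝ, IsC2Test n φ → ∀ (x : Euc n) (t : ℝ), 0 < t →
    (∀ y s, 0 < s → w x t - φ x t ≤ w y s - φ y s) →
    ∀ δ : ℝ, 0 < δ →
      C * ‖spaceGrad n φ x t‖ *
        (Iunder n α (Metric.ball 0 δ) (fun y => φ y t) x +
          Ibar n α (Metric.ball 0 δ)ᶜ (fun y => w y t) x) ≤ timeDeriv n φ x t

/-- A kernel `P` of fractional order `α`: positive, bounded, continuous, radially symmetric,
of total mass one, with decay `P(x) ≤ C₀(1+|x|^{N+α})⁻¹` and such that, with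
`p(x,t) = t^{-N/α}P(t^{-1/α}x)`, `t⁻¹ p(⬝,t) → c_α |⬝|^{-(N+α)}` as `t → 0⁺`, locally
uniformly away from the origin and in `L¹` outside every ball around the origin. -/
structure FracKernel (n : ℕ) (α : ℝ) where
  P : Euc n → ℝ
  cα : ℝ
  cα_pos : 0 < cα
  P_pos : ∀ x, 0 < P x
  P_bdd : ∃ M, ∀ x, P x ≤ M
  P_cont : Continuous P
  P_radial : ∀ x y : Euc n, ‖x‖ = ‖y‖ → P x = P y
  P_int : ∫ x, P x = 1
  P_decay : ∃ C₀ : ℝ, 0 < C₀ ∧ ∀ x, P x ≤ C₀ * (1 + ‖x‖ ^ ((n : ℝ) + α))⁻¹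
  loc_unif : ∀ K : Set (Euc n), IsCompact K → (0 : Euc n) ∉ K →
    TendstoUniformlyOn
      (fun (t : ℝ) (x : Euc n) => t⁻¹ * (t ^ (-(n : ℝ)/α) * P ((t ^ (-α⁻¹ : ℝ)) • x)))
      (fun x => cα * ‖x‖ ^ (-((n : ℝ) + α))) (nhdsWithin 0 (Set.Ioi 0)) K
  L1_conv : ∀ r : ℝ, 0 < r →
    Tendsto (fun t : ℝ => ∫ x in {x : Euc n | r ≤ ‖x‖},
        |t⁻¹ * (t ^ (-(n : ℝ)/α) * P ((t ^ (-α⁻¹ : ℝ)) • x)) - cα * ‖x‖ ^ (-((n : ℝ) + α))|)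
      (nhdsWithin 0 (Set.Ioi 0)) (nhds 0)

/-- the scaled kernel `p(x,t) = t^{-N/α} P(t^{-1/α} x)`. -/
def FracKernel.p {n : ℕ} {α : ℝ} (K : FracKernel n α) (x : Euc n) (t : ℝ) : ℝ :=
  t ^ (-(n : ℝ)/α) * K.P ((t ^ (-α⁻¹ : ℝ)) • x)

/-- the constant `C_α = c_α (2∫_{ℝ^{N-1}} P(0,y') dy')⁻¹`. -/
def fracC (d : ℕ) (α : ℝ) (K : FracKernel (d+2) α) : ℝ :=
  K.cα * (2 * ∫ y' : Euc (d+1), K.P (pad d y'))⁻¹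

/-- the constant `C_α = (∫_{ℝ^{N-1}} (y'_1)² P(0,y') dy') (2∫_{ℝ^{N-1}} P(0,y') dy')⁻¹`. -/
def mcfC (d : ℕ) (α : ℝ) (K : FracKernel (d+2) α) : ℝ :=
  (∫ y' : Euc (d+1), (y' 0)^2 * K.P (pad d y')) *
    (2 * ∫ y' : Euc (d+1), K.P (pad d y'))⁻¹

/-- the Poisson kernel `p(x,t) = c_N t (t² + |x|²)^{-(N+1)/2}`. -/
def poissonp (n : ℕ) (x : Euc n) (t : ℝ) : ℝ :=
  (Real.Gamma (((n : ℝ) + 1)/2) * Real.pi ^ (-(((n : ℝ) + 1)/2))) * t *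
    (t^2 + ‖x‖^2) ^ (-(((n : ℝ) + 1)/2))

/-- the constant `C₁ = ω_{N-1} (2 ∫_{ℝ^{N-1}} (1+|y'|²)^{-(N+1)/2} dy')⁻¹`. -/
def poissonC1 (d : ℕ) : ℝ :=
  sphereArea (d+1) *
    (2 * ∫ y' : Euc (d+1), ((1 : ℝ) + ‖y'‖^2) ^ (-(((d : ℝ) + 3)/2)))⁻¹

/-- the no-interior condition for the evolving front. -/
def NoInterior (n : ℕ) (u : Euc n → ℝ → ℝ) : Prop :=
  (⋃ t ∈ Set.Ioi (0:ℝ), (fun x => (x, t)) '' {x : Euc n | u x t = 0}) =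
      frontier {q : Euc n × ℝ | 0 < q.2 ∧ 0 < u q.1 q.2} ∩ {q : Euc n × ℝ | 0 < q.2} ∧
  (⋃ t ∈ Set.Ioi (0:ℝ), (fun x => (x, t)) '' {x : Euc n | u x t = 0}) =
      frontier {q : Euc n × ℝ | 0 < q.2 ∧ u q.1 q.2 < 0} ∩ {q : Euc n × ℝ | 0 < q.2}

/-- the upper semicontinuous envelope in the space variable. -/
def uscEnvSpace (n : ℕ) (v : Euc n → ℝ) (x : Euc n) : ℝ :=
  sInf {S : ℝ | ∃ ε : ℝ, 0 < ε ∧ S = sSup {w : ℝ | ∃ y : Euc n, dist y x < ε ∧ w = v y}}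

/-- the upper semicontinuous envelope on `ℝ^n × [0,∞)`. -/
def uscEnvST (n : ℕ) (w : Euc n → ℝ → ℝ) (x : Euc n) (t : ℝ) : ℝ :=
  sInf {S : ℝ | ∃ ε : ℝ, 0 < ε ∧ S = sSup {v : ℝ | ∃ (y : Euc n) (s : ℝ),
    0 ≤ s ∧ dist y x < ε ∧ |s - t| < ε ∧ v = w y s}}

/-- the lower semicontinuous envelope on `ℝ^n × [0,∞)`. -/
def lscEnvST (n : ℕ) (w : Euc n → ℝ → ℝ) (x : Euc n) (t : ℝ) : ℝ :=
  sSup {S : ℝ | ∃ ε : ℝ, 0 < ε ∧ S = sInf {v : ℝ | ∃ (y : Euc n) (s : ℝ),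
    0 ≤ s ∧ dist y x < ε ∧ |s - t| < ε ∧ v = w y s}}

def cwEquiv (d : ℕ) : (ℝ × Euc (d+1)) ≃ᵐ Euc (d+2) :=
  ((MeasurableEquiv.refl ℝ).prodCongr (MeasurableEquiv.toLp 2 (Fin (d+1) → ℝ)).symm).trans
    ((MeasurableEquiv.piFinSuccAbove (fun _ : Fin (d+2) => ℝ) 0).symm.trans
      (MeasurableEquiv.toLp 2 (Fin (d+2) → ℝ)))

def cw {d : ℕ} (s : ℝ) (w : Euc (d+1)) : Euc (d+2) := cwEquiv d (s, w)

lemma cw_zero {d : ℕ} (s : ℝ) (w : Euc (d+1)) : (cw s w) 0 = s := rfl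

lemma cw_succ {d : ℕ} (s : ℝ) (w : Euc (d+1)) (i : Fin (d+1)) : (cw s w) i.succ = w i := by
  simp [cw, cwEquiv]; rfl

lemma pad_eq {d : ℕ} (w : Euc (d+1)) : pad d w = cw 0 w := by
  ext i
  refine Fin.cases ?_ (fun j => ?_) i
  · rfl
  · rw [cw_succ]; rfl

lemma cw_mp (d : ℕ) : MeasurePreserving (cwEquiv d) := by
  unfold cwEquiv
  refine MeasurePreserving.trans (μb := (volume : Measure (ℝ × (Fin (d+1) → ℝ)))) ?_ (MeasurePreserving.trans (μb := (volume : Measure (Fin (d+2) → ℝ))) ?_ ?_)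
  · exact (MeasurePreserving.id volume).prod
      (EuclideanSpace.volume_preserving_symm_measurableEquiv_toLp (Fin (d+1)))
  · exact (volume_preserving_piFinSuccAbove (fun _ : Fin (d+2) => ℝ) 0).symm _
  · exact (EuclideanSpace.volume_preserving_symm_measurableEquiv_toLp (Fin (d+2))).symm _

lemma inner_cw {d : ℕ} (s s' : ℝ) (w w' : Euc (d+1)) :
    ⟪cw s w, cw s' w'⟫ = s * s' + ⟪w, w'⟫ := by
  simp only [PiLp.inner_apply, Fin.sum_univ_succ (n := d+1), cw_zero, cw_succ]
  simp [mul_comm]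

lemma norm_cw_sq {d : ℕ} (s : ℝ) (w : Euc (d+1)) : ‖cw s w‖^2 = s^2 + ‖w‖^2 := by
  rw [← real_inner_self_eq_norm_sq, inner_cw, real_inner_self_eq_norm_sq]; ring

lemma norm_le_norm_cw {d : ℕ} (s : ℝ) (w : Euc (d+1)) : ‖w‖ ≤ ‖cw s w‖ := by
  apply le_of_sq_le_sq _ (norm_nonneg _)
  rw [norm_cw_sq]; nlinarith [sq_nonneg s]

lemma abs_le_norm_cw {d : ℕ} (s : ℝ) (w : Euc (d+1)) : |s| ≤ ‖cw s w‖ := by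
  apply abs_le_of_sq_le_sq _ (norm_nonneg _)
  rw [norm_cw_sq]; nlinarith [sq_nonneg ‖w‖]

lemma cw_surj {d : ℕ} (v : Euc (d+2)) : ∃ b : Euc (d+1), v = cw (v 0) b := by
  refine ⟨((cwEquiv d).symm v).2, ?_⟩
  have h : cwEquiv d ((cwEquiv d).symm v) = v := by simp
  have h2 : v 0 = ((cwEquiv d).symm v).1 := by
    conv_lhs => rw [← h]
    exact cw_zero _ _
  rw [h2]; exact h.symm

lemma cw_cont {d : ℕ} : Continuous (fun p : ℝ × Euc (d+1) => cw p.1 p.2) := by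
  refine (PiLp.continuous_toLp 2 (fun _ : Fin (d+2) => ℝ)).comp ?_
  refine continuous_pi (fun i => ?_)
  refine Fin.cases ?_ (fun j => ?_) i
  · exact continuous_fst
  · have : ∀ p : ℝ × Euc (d+1), (cw p.1 p.2) j.succ = p.2 j := fun p => cw_succ _ _ _
    refine Continuous.congr (f := fun p : ℝ × Euc (d+1) => p.2 j) (by fun_prop) ?_
    intro p; exact (this p).symm

lemma change_var {d : ℕ} (F : Euc (d+2) → ℝ) (hF : Integrable F) (l : ℝ) (hl : 0 < l)
    (b : Euc (d+1))
    (hG : Integrable (fun p : ℝ × Euc (d+1) => F (cw (l * p.1 - ⟪b, p.2⟫) p.2))) :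
    ∫ w, F w = l * ∫ p : ℝ × Euc (d+1), F (cw (l * p.1 - ⟪b, p.2⟫) p.2) := by
  have h1 := (cw_mp d).integral_comp (cwEquiv d).measurableEmbedding F
  have hF' : Integrable (fun p : ℝ × Euc (d+1) => F (cwEquiv d p)) :=
    ((cw_mp d).integrable_comp_emb (cwEquiv d).measurableEmbedding).2 hF
  rw [← h1]
  erw [integral_prod_symm _ hF', integral_prod_symm _ hG]
  rw [← integral_const_mul]
  congr 1; ext w
  have h2 : ∫ x, F (cw (l * x - ⟪b, w⟫) w) = |l⁻¹| • ∫ x, F (cw (x - ⟪b, w⟫) w) :=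
    Measure.integral_comp_mul_left (fun x => F (cw (x - ⟪b, w⟫) w)) l
  have h3 : ∫ x, F (cw (x - ⟪b, w⟫) w) = ∫ x, F (cw x w) :=
    integral_sub_right_eq_self (fun x => F (cw x w)) _
  simp only
  rw [h2, h3, abs_of_pos (inv_pos.2 hl), smul_eq_mul, ← mul_assoc, mul_inv_cancel₀ hl.ne', one_mul]
  rfl

lemma one_add_bd {x r : ℝ} (hx : 0 ≤ x) (hr : 0 ≤ r) :
    (1 + x ^ r)⁻¹ ≤ 2 ^ r * (1 + x) ^ (-r) := by
  have h1 : (1 + x) ^ r ≤ 2 ^ r * (1 + x ^ r) := by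
    rcases le_total x 1 with h | h
    · have : (1 + x) ^ r ≤ 2 ^ r := Real.rpow_le_rpow (by linarith) (by linarith) hr
      have h2 : 0 ≤ x ^ r := Real.rpow_nonneg hx _
      have h3 : (0:ℝ) < 2 ^ r := by positivity
      nlinarith
    · have : (1 + x) ^ r ≤ (2 * x) ^ r := Real.rpow_le_rpow (by linarith) (by linarith) hr
      rw [Real.mul_rpow (by norm_num) hx] at this
      have h3 : (0:ℝ) < 2 ^ r := by positivity
      nlinarith
  have h4 : 0 < (1 + x) ^ r := by positivity
  have h5 : 0 < 1 + x ^ r := by positivity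
  rw [Real.rpow_neg (by linarith), ← div_eq_mul_inv, inv_eq_one_div, div_le_div_iff₀ h5 h4]
  linarith

lemma K_decay {d : ℕ} {α : ℝ} (hα : α ∈ Set.Ioo (1:ℝ) 2) (K : FracKernel (d+2) α) :
    ∃ D : ℝ, 0 < D ∧ ∀ w, K.P w ≤ D * (1 + ‖w‖) ^ (-((d:ℝ) + 2 + α)) := by
  obtain ⟨C, hC, h⟩ := K.P_decay
  refine ⟨C * 2 ^ ((d:ℝ) + 2 + α), by positivity, fun w => (h w).trans ?_⟩
  have := one_add_bd (norm_nonneg w) (r := (d:ℝ) + 2 + α) (by have := hα.1; positivity)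
  push_cast
  rw [mul_assoc]
  gcongr

lemma K_int {d : ℕ} {α : ℝ} (K : FracKernel (d+2) α) : Integrable K.P := by
  by_contra h
  have := K.P_int
  rw [integral_undef h] at this
  norm_num at this

lemma pow_rpow_bd {x r s : ℝ} (k : ℕ) (hx : 0 ≤ x) (hs : s = k - r) :
    (1 + x) ^ k * (1 + x) ^ (-r) = (1 + x) ^ s := by
  rw [← Real.rpow_natCast, ← Real.rpow_add (by linarith), hs]; ring_nf

lemma K_int_norm {d : ℕ} {α : ℝ} (hα : α ∈ Set.Ioo (1:ℝ) 2) (K : FracKernel (d+2) α) :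
    Integrable (fun w => ‖w‖ * K.P w) := by
  obtain ⟨D, hD, h⟩ := K_decay hα K
  have hi : Integrable (fun w : Euc (d+2) => D * (1 + ‖w‖) ^ (-((d:ℝ) + 1 + α))) := by
    refine (integrable_one_add_norm ?_).const_mul D
    simp; linarith [hα.1]
  refine hi.mono' ?_ ?_
  · exact (continuous_norm.mul K.P_cont).aestronglyMeasurable
  · refine Eventually.of_forall (fun w => ?_)
    rw [Real.norm_of_nonneg (mul_nonneg (norm_nonneg _) (K.P_pos _).le)]
    rw [← pow_rpow_bd 1 (norm_nonneg w) (r := (d:ℝ) + 2 + α) (by push_cast; ring)]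
    calc ‖w‖ * K.P w ≤ (1 + ‖w‖) * (D * (1 + ‖w‖) ^ (-((d:ℝ) + 2 + α))) := by
          gcongr
          · exact (K.P_pos _).le
          · linarith
          · exact h w
      _ = _ := by ring

/-- dominating function on the hyperplane -/
lemma dom_int {d : ℕ} {α : ℝ} (hα : α ∈ Set.Ioo (1:ℝ) 2) :
    Integrable (fun w : Euc (d+1) => (1 + ‖w‖)^2 * (1 + ‖w‖) ^ (-((d:ℝ) + 2 + α))) := by
  have hi : Integrable (fun w : Euc (d+1) => (1 + ‖w‖) ^ (-((d:ℝ) + α))) := by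
    refine (integrable_one_add_norm ?_)
    simp; linarith [hα.1]
  refine hi.congr (Eventually.of_forall (fun w => ?_))
  exact (pow_rpow_bd 2 (norm_nonneg w) (by push_cast; ring)).symm

lemma pad_cont {d : ℕ} : Continuous (pad d) := by
  have : pad d = fun w => cw 0 w := funext pad_eq
  rw [this]
  exact cw_cont.comp (by fun_prop : Continuous (fun w : Euc (d+1) => ((0:ℝ), w)))

lemma norm_pad {d : ℕ} (w : Euc (d+1)) : ‖pad d w‖ = ‖w‖ := by
  have := norm_cw_sq 0 w
  rw [← pad_eq] at this
  exact (sq_eq_sq₀ (norm_nonneg _) (norm_nonneg _)).1 (by linarith)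

/-- integrability of quadratic growth functions against the slice of `P`. -/
lemma slice_int {d : ℕ} {α : ℝ} (hα : α ∈ Set.Ioo (1:ℝ) 2) (K : FracKernel (d+2) α)
    (g : Euc (d+1) → ℝ) (hg : Continuous g) (C : ℝ) (hC : ∀ w, |g w| ≤ C * (1 + ‖w‖)^2) :
    Integrable (fun w => g w * K.P (pad d w)) := by
  obtain ⟨D, hD, h⟩ := K_decay hα K
  refine ((dom_int (d := d) hα).const_mul (C * D)).mono' ?_ ?_
  · exact (hg.mul (K.P_cont.comp pad_cont)).aestronglyMeasurable
  · refine Eventually.of_forall (fun w => ?_)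
    rw [norm_mul, Real.norm_eq_abs, Real.norm_of_nonneg (K.P_pos _).le]
    have h1 := h (pad d w)
    rw [norm_pad] at h1
    calc |g w| * K.P (pad d w) ≤ (C * (1 + ‖w‖)^2) * (D * (1 + ‖w‖) ^ (-((d:ℝ) + 2 + α))) :=
          mul_le_mul (hC w) h1 (K.P_pos _).le ((abs_nonneg _).trans (hC w))
      _ = _ := by ring

def ind (p : Prop) : ℝ := open Classical in if p then 1 else 0

lemma ind_true {p : Prop} (h : p) : ind p = 1 := by simp [ind, h]
lemma ind_false {p : Prop} (h : ¬ p) : ind p = 0 := by simp [ind, h]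

lemma abs_ind_sub_le (p q : Prop) : |ind p - ind q| ≤ 1 := by
  unfold ind; split_ifs <;> simp

lemma meas_ind {X : Type*} [MeasurableSpace X] {p : X → Prop} (h : MeasurableSet {x | p x}) :
    Measurable (fun x => ind (p x)) := by
  classical
  have : (fun x => ind (p x)) = fun x => if x ∈ {x | p x} then (1:ℝ) else 0 := by
    funext x; unfold ind; simp
  rw [this]
  exact Measurable.ite h measurable_const measurable_const

lemma int_ind_diff (g : ℝ) : ∫ τ : ℝ, (ind (g ≤ τ) - ind (0 < τ)) = - g := by
  rcases lt_or_ge 0 g with h | h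
  · have : (fun τ : ℝ => ind (g ≤ τ) - ind (0 < τ)) = (Ioo 0 g).indicator (fun _ => (-1:ℝ)) := by
      funext τ
      unfold ind indicator
      simp only [mem_Ioo]
      split_ifs <;> first | (exfalso; grind) | norm_num
    rw [this, integral_indicator measurableSet_Ioo]
    simp [h.le]
  · have : (fun τ : ℝ => ind (g ≤ τ) - ind (0 < τ)) = (Icc g 0).indicator (fun _ => (1:ℝ)) := by
      funext τ
      unfold ind indicator
      simp only [mem_Icc]
      split_ifs <;> first | (exfalso; grind) | norm_num
    rw [this, integral_indicator measurableSet_Icc]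
    simp [h]

lemma graph_null {d : ℕ} (g : Euc (d+1) → ℝ) (hg : Continuous g) :
    ∀ᵐ p : ℝ × Euc (d+1), p.1 ≠ g p.2 := by
  rw [ae_iff]
  have hm : MeasurableSet {p : ℝ × Euc (d+1) | ¬ p.1 ≠ g p.2} := by
    simp only [ne_eq, not_not]
    exact measurableSet_eq_fun measurable_fst (hg.measurable.comp measurable_snd)
  change (volume.prod volume) _ = 0
  rw [Measure.prod_apply_symm hm]
  simp

def bnd (D B r : ℝ) {d : ℕ} (p : ℝ × Euc (d+1)) : ℝ :=
  (Icc (-(B * (1 + ‖p.2‖)^2)) (B * (1 + ‖p.2‖)^2)).indicator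
    (fun _ => D * (1 + ‖p.2‖) ^ (-r)) p.1

lemma bnd_int {d : ℕ} {α : ℝ} (hα : α ∈ Set.Ioo (1:ℝ) 2) (D B : ℝ) (hD : 0 < D) (hB : 0 ≤ B) :
    Integrable (bnd (d := d) D B ((d:ℝ) + 2 + α)) := by
  have hm : Measurable (bnd (d := d) D B ((d:ℝ) + 2 + α)) := by
    have : bnd (d := d) D B ((d:ℝ) + 2 + α) = fun p => ({p : ℝ × Euc (d+1) |
        -(B * (1 + ‖p.2‖)^2) ≤ p.1 ∧ p.1 ≤ B * (1 + ‖p.2‖)^2}).indicator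
          (fun p => D * (1 + ‖p.2‖) ^ (-((d:ℝ) + 2 + α))) p := by
      funext p; simp only [bnd, indicator, mem_Icc, mem_ofPred_eq]
    rw [this]
    refine Measurable.indicator (by fun_prop) ?_
    exact (measurableSet_le (f := fun p : ℝ × Euc (d+1) => -(B * (1 + ‖p.2‖)^2))
        (g := fun p => p.1) (by fun_prop) (by fun_prop)).inter
      (measurableSet_le (f := fun p : ℝ × Euc (d+1) => p.1)
        (g := fun p => B * (1 + ‖p.2‖)^2) (by fun_prop) (by fun_prop))
  refine (integrable_prod_iff' hm.aestronglyMeasurable).2 ⟨?_, ?_⟩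
  · refine Eventually.of_forall (fun w => ?_)
    exact IntegrableOn.integrable_indicator (f := fun _ : ℝ => D * (1 + ‖w‖) ^ (-((d:ℝ) + 2 + α)))
      (s := Icc (-(B * (1 + ‖w‖)^2)) (B * (1 + ‖w‖)^2))
      continuousOn_const.integrableOn_Icc measurableSet_Icc
  · refine ((dom_int (d := d) hα).const_mul (2 * B * D)).congr (Eventually.of_forall (fun w => ?_))
    have h1 : ∀ x : ℝ, ‖bnd D B ((d:ℝ) + 2 + α) (x, w)‖ = bnd D B ((d:ℝ) + 2 + α) (x, w) := by
      intro x
      refine Real.norm_of_nonneg (indicator_nonneg ?_ _)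
      intro _ _; positivity
    simp only [h1]
    simp only [bnd]
    rw [integral_indicator measurableSet_Icc]
    have : 0 ≤ B * (1 + ‖w‖)^2 := by positivity
    simp only [integral_const, MeasurableSet.univ, measureReal_restrict_apply, univ_inter, Real.volume_real_Icc, smul_eq_mul]
    rw [max_eq_left (by linarith)]
    ring

section core
variable {d : ℕ} {α : ℝ}

def coreG (K : FracKernel (d+2) α) (Q : Euc (d+2) → ℝ) (a ρ : ℝ) (q : ℝ × Euc (d+1))
    (w : Euc (d+2)) : ℝ :=
  K.P w * (ind (‖w‖ ≤ ρ / q.1) *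
    (ind (q.1 * (a - Q w) ≤ ⟪cw 1 q.2, w⟫) - ind (0 < ⟪cw 1 q.2, w⟫)))

def coreW (q p : ℝ × Euc (d+1)) : Euc (d+2) := cw (q.1 * p.1 - ⟪q.2, p.2⟫) p.2

lemma inner_coreW (q p : ℝ × Euc (d+1)) : ⟪cw 1 q.2, coreW q p⟫ = q.1 * p.1 := by
  rw [coreW, inner_cw]; ring

lemma coreG_meas (K : FracKernel (d+2) α) (Q : Euc (d+2) → ℝ) (hQ : Continuous Q) (a ρ : ℝ)
    (q : ℝ × Euc (d+1)) : Measurable (coreG K Q a ρ q) := by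
  refine K.P_cont.measurable.mul ((meas_ind ?_).mul ((meas_ind ?_).sub (meas_ind ?_)))
  · exact measurableSet_le (by fun_prop) (by fun_prop)
  · exact measurableSet_le (by fun_prop) (by fun_prop)
  · exact measurableSet_lt (by fun_prop) (by fun_prop)

lemma coreG_int (K : FracKernel (d+2) α) (Q : Euc (d+2) → ℝ) (hQ : Continuous Q) (a ρ : ℝ)
    (q : ℝ × Euc (d+1)) : Integrable (coreG K Q a ρ q) := by
  refine (K_int K).mono' (coreG_meas K Q hQ a ρ q).aestronglyMeasurable
    (Eventually.of_forall fun w => ?_)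
  unfold coreG
  rw [norm_mul, Real.norm_of_nonneg (K.P_pos _).le]
  have h1 : ‖ind (‖w‖ ≤ ρ / q.1) *
    (ind (q.1 * (a - Q w) ≤ ⟪cw 1 q.2, w⟫) - ind (0 < ⟪cw 1 q.2, w⟫))‖ ≤ 1 := by
    rw [norm_mul]
    have := abs_ind_sub_le (q.1 * (a - Q w) ≤ ⟪cw 1 q.2, w⟫) (0 < ⟪cw 1 q.2, w⟫)
    have h2 : ‖ind (‖w‖ ≤ ρ / q.1)‖ ≤ 1 := by unfold ind; split_ifs <;> simp
    exact mul_le_one₀ h2 (norm_nonneg _) this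
  exact mul_le_of_le_one_right (K.P_pos _).le h1

lemma coreW_cont : Continuous (fun x : (ℝ × Euc (d+1)) × (ℝ × Euc (d+1)) => coreW x.1 x.2) := by
  unfold coreW
  exact cw_cont.comp (by fun_prop : Continuous (fun x : (ℝ × Euc (d+1)) × (ℝ × Euc (d+1)) =>
    (x.1.1 * x.2.1 - ⟪x.1.2, x.2.2⟫, x.2.2)))

lemma coreG_bound (K : FracKernel (d+2) α) (Q : Euc (d+2) → ℝ) (C : ℝ) (hC : 0 < C)
    (hQ : ∀ w, |Q w| ≤ C * ‖w‖^2) (a ρ : ℝ) (hρ : 0 < ρ) (hρC : 8 * C * ρ ≤ 1)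
    (D r : ℝ) (hr : 0 ≤ r) (hD : 0 < D) (hPD : ∀ w, K.P w ≤ D * (1 + ‖w‖) ^ (-r))
    (q : ℝ × Euc (d+1)) (hq1 : 0 < q.1) (hq2 : ‖q.2‖ ≤ 1) (p : ℝ × Euc (d+1)) :
    ‖coreG K Q a ρ q (coreW q p)‖ ≤ bnd D (2 * |a| + 6 * C) r p := by
  have hbn : 0 ≤ bnd D (2 * |a| + 6 * C) r p := by
    refine indicator_nonneg ?_ _
    intro _ _; positivity
  by_cases h0 : coreG K Q a ρ q (coreW q p) = 0
  · rw [h0, norm_zero]; exact hbn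
  unfold coreG at h0 ⊢
  have hc1 : ‖coreW q p‖ ≤ ρ / q.1 := by
    by_contra h; exact h0 (by rw [ind_false h]; ring)
  rw [inner_coreW] at h0 ⊢
  set W := coreW q p with hW
  have hτ : |p.1| ≤ |a| + C * ‖W‖^2 := by
    by_contra hlt
    push Not at hlt
    apply h0
    have h5 := hQ W
    have h6 := abs_le.1 h5
    have h7 := neg_abs_le a
    have h8 := le_abs_self a
    rcases le_total 0 p.1 with h | h
    · rw [abs_of_nonneg h] at hlt
      have hp : 0 < p.1 := by nlinarith [abs_nonneg a, sq_nonneg ‖W‖]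
      rw [ind_true (p := q.1 * (a - Q W) ≤ q.1 * p.1)
        (mul_le_mul_of_nonneg_left (by linarith) hq1.le),
        ind_true (p := 0 < q.1 * p.1) (by positivity)]
      ring
    · rw [abs_of_nonpos h] at hlt
      rw [ind_false (p := q.1 * (a - Q W) ≤ q.1 * p.1), ind_false (p := 0 < q.1 * p.1)]
      · ring
      · nlinarith
      · intro h9
        have := le_of_mul_le_mul_left h9 hq1
        linarith
  have hin : |⟪q.2, p.2⟫| ≤ ‖p.2‖ :=
    (abs_real_inner_le_norm _ _).trans (by nlinarith [norm_nonneg p.2])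
  have hw2 : ‖p.2‖ ≤ ‖W‖ := norm_le_norm_cw _ _
  have hw1 : |q.1 * p.1 - ⟪q.2, p.2⟫| ≤ ‖W‖ := abs_le_norm_cw _ _
  have hWsq : ‖W‖^2 = (q.1 * p.1 - ⟪q.2, p.2⟫)^2 + ‖p.2‖^2 := norm_cw_sq _ _
  have hlt : q.1 * |p.1| ≤ 2 * ‖W‖ := by
    have : q.1 * |p.1| = |q.1 * p.1| := by rw [abs_mul, abs_of_pos hq1]
    rw [this]
    have h3 : q.1 * p.1 = (q.1 * p.1 - ⟪q.2, p.2⟫) + ⟪q.2, p.2⟫ := by ring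
    rw [h3]
    have := abs_add_le (q.1 * p.1 - ⟪q.2, p.2⟫) ⟪q.2, p.2⟫
    linarith
  have hlt2 : q.1 * (q.1 * |p.1|) ≤ 2 * ρ := by
    have h3 : q.1 * ‖W‖ ≤ ρ := by
      have := mul_le_mul_of_nonneg_left hc1 hq1.le
      rwa [mul_div_cancel₀ _ hq1.ne'] at this
    nlinarith
  have hsq : (q.1 * p.1 - ⟪q.2, p.2⟫)^2 ≤ 2 * (q.1 * |p.1|)^2 + 2 * ‖p.2‖^2 := by
    have h1 : (q.1 * |p.1|)^2 = (q.1 * p.1)^2 := by rw [mul_pow, mul_pow, sq_abs]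
    have h2 : ⟪q.2, p.2⟫^2 ≤ ‖p.2‖^2 := sq_le_sq' (by linarith [(abs_le.1 hin).1]) (abs_le.1 hin).2
    rw [h1]
    nlinarith [sq_nonneg (q.1 * p.1 + ⟪q.2, p.2⟫)]
  have hsq2 : (q.1 * |p.1|)^2 ≤ 2 * ρ * |p.1| := by
    have : (q.1 * |p.1|)^2 = q.1 * (q.1 * |p.1|) * |p.1| := by ring
    rw [this]
    exact mul_le_mul_of_nonneg_right hlt2 (abs_nonneg _)
  have hfin : |p.1| ≤ (2 * |a| + 6 * C) * (1 + ‖p.2‖)^2 := by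
    have h1 : C * ‖W‖^2 ≤ C * (4 * ρ * |p.1| + 3 * ‖p.2‖^2) := by
      apply mul_le_mul_of_nonneg_left _ hC.le; linarith
    have h2 : C * (4 * ρ * |p.1|) ≤ |p.1| / 2 := by
      nlinarith [abs_nonneg p.1]
    have h3 : |p.1| ≤ 2 * |a| + 6 * C * ‖p.2‖^2 := by nlinarith
    have h4 := norm_nonneg p.2
    have h5 := abs_nonneg a
    nlinarith [mul_nonneg h5 h4, mul_nonneg h5 (sq_nonneg ‖p.2‖), mul_nonneg hC.le h4]
  have hb : bnd D (2 * |a| + 6 * C) r p = D * (1 + ‖p.2‖) ^ (-r) := by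
    unfold bnd
    rw [indicator_of_mem]
    exact abs_le.1 hfin |> fun h => ⟨h.1, h.2⟩
  rw [hb, ind_true hc1, one_mul, norm_mul, Real.norm_of_nonneg (K.P_pos _).le]
  have h9 := abs_ind_sub_le (q.1 * (a - Q W) ≤ q.1 * p.1) (0 < q.1 * p.1)
  calc K.P W * ‖ind (q.1 * (a - Q W) ≤ q.1 * p.1) - ind (0 < q.1 * p.1)‖ ≤ K.P W :=
        mul_le_of_le_one_right (K.P_pos _).le h9
    _ ≤ D * (1 + ‖W‖) ^ (-r) := hPD W
    _ ≤ D * (1 + ‖p.2‖) ^ (-r) := by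
        apply mul_le_mul_of_nonneg_left _ hD.le
        exact Real.rpow_le_rpow_of_nonpos (by positivity) (by linarith) (by linarith)
end core

lemma ind_nonneg (p : Prop) : 0 ≤ ind p := by unfold ind; split_ifs <;> norm_num
lemma ind_le_one (p : Prop) : ind p ≤ 1 := by unfold ind; split_ifs <;> norm_num
lemma norm_ind_le (p : Prop) : ‖ind p‖ ≤ 1 := by
  rw [Real.norm_of_nonneg (ind_nonneg p)]; exact ind_le_one p

lemma int_add3 {X : Type*} [MeasurableSpace X] {μ : Measure X} {f g k : X → ℝ}
    (hf : Integrable f μ) (hg : Integrable g μ) (hk : Integrable k μ) :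
    ∫ x, (f x + g x + k x) ∂μ = (∫ x, f x ∂μ) + (∫ x, g x ∂μ) + ∫ x, k x ∂μ := by
  rw [integral_add (f := fun x => f x + g x) (hf.add hg) hk, integral_add hf hg]

section core2
variable {d : ℕ} {α : ℝ}

lemma core_tendsto (hα : α ∈ Set.Ioo (1:ℝ) 2) (K : FracKernel (d+2) α) (Q : Euc (d+2) → ℝ)
    (hQc : Continuous Q) (C : ℝ) (hC : 0 < C)
    (hQ : ∀ w, |Q w| ≤ C * ‖w‖^2) (a ρ : ℝ) (hρ : 0 < ρ) (hρC : 8 * C * ρ ≤ 1) :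
    Tendsto (fun q : ℝ × Euc (d+1) => ∫ p, coreG K Q a ρ q (coreW q p))
      (𝓝[>] (0:ℝ) ×ˢ 𝓝 (0 : Euc (d+1)))
      (𝓝 (-∫ w, K.P (pad d w) * (a - Q (pad d w)))) := by
  obtain ⟨D, hD, hPD⟩ := K_decay hα K
  set f : ℝ × Euc (d+1) → ℝ := fun p =>
    K.P (pad d p.2) * (ind (a - Q (pad d p.2) ≤ p.1) - ind (0 < p.1)) with hf
  have hev1 : ∀ᶠ q : ℝ × Euc (d+1) in 𝓝[>] (0:ℝ) ×ˢ 𝓝 (0 : Euc (d+1)), 0 < q.1 :=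
    tendsto_fst.eventually (eventually_mem_nhdsWithin)
  have hev2 : ∀ᶠ q : ℝ × Euc (d+1) in 𝓝[>] (0:ℝ) ×ˢ 𝓝 (0 : Euc (d+1)), ‖q.2‖ ≤ 1 := by
    refine tendsto_snd.eventually (p := fun b => ‖b‖ ≤ 1) ?_
    filter_upwards [Metric.ball_mem_nhds (0 : Euc (d+1)) one_pos] with b hb
    rw [mem_ball_zero_iff] at hb; exact hb.le
  have hbd : ∀ᶠ q : ℝ × Euc (d+1) in 𝓝[>] (0:ℝ) ×ˢ 𝓝 (0 : Euc (d+1)), ∀ p,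
      ‖coreG K Q a ρ q (coreW q p)‖ ≤ bnd D (2 * |a| + 6 * C) ((d:ℝ) + 2 + α) p := by
    filter_upwards [hev1, hev2] with q h1 h2 p
    exact coreG_bound K Q C hC hQ a ρ hρ hρC D _ (by have := hα.1; positivity) hD hPD q h1 h2 p
  have hbi := bnd_int (d := d) hα D (2 * |a| + 6 * C) hD (by positivity)
  have hae : ∀ᵐ p : ℝ × Euc (d+1), Tendsto (fun q => coreG K Q a ρ q (coreW q p))
      (𝓝[>] (0:ℝ) ×ˢ 𝓝 (0 : Euc (d+1))) (𝓝 (f p)) := by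
    have hg : Continuous (fun w : Euc (d+1) => a - Q (pad d w)) := by
      have := hQc.comp (pad_cont (d := d)); exact continuous_const.sub this
    filter_upwards [graph_null _ hg] with p hp
    have hq0 : Tendsto (fun q : ℝ × Euc (d+1) => q) (𝓝[>] (0:ℝ) ×ˢ 𝓝 (0 : Euc (d+1)))
        (𝓝 (0, 0)) := by
      rw [nhds_prod_eq]
      exact Filter.prod_mono_left _ nhdsWithin_le_nhds
    have hW : Tendsto (fun q : ℝ × Euc (d+1) => coreW q p)
        (𝓝[>] (0:ℝ) ×ˢ 𝓝 (0 : Euc (d+1))) (𝓝 (pad d p.2)) := by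
      have h1 : Continuous (fun q : ℝ × Euc (d+1) => coreW q p) :=
        coreW_cont.comp (by fun_prop : Continuous (fun q : ℝ × Euc (d+1) => (q, p)))
      have h2 := (h1.tendsto (0, 0)).comp hq0
      have h3 : coreW ((0:ℝ), (0 : Euc (d+1))) p = pad d p.2 := by
        rw [pad_eq]; simp [coreW]
      rw [h3] at h2
      exact h2
    have hbig : ∀ᶠ q : ℝ × Euc (d+1) in 𝓝[>] (0:ℝ) ×ˢ 𝓝 (0 : Euc (d+1)),
        ‖coreW q p‖ ≤ ρ / q.1 := by
      have h1 : ∀ᶠ q : ℝ × Euc (d+1) in 𝓝[>] (0:ℝ) ×ˢ 𝓝 (0 : Euc (d+1)),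
          ‖coreW q p‖ < ‖pad d p.2‖ + 1 := hW.norm.eventually (gt_mem_nhds (by linarith))
      have h2 : ∀ᶠ q : ℝ × Euc (d+1) in 𝓝[>] (0:ℝ) ×ˢ 𝓝 (0 : Euc (d+1)),
          ‖pad d p.2‖ + 1 ≤ ρ / q.1 := by
        have h3 : Tendsto (fun l : ℝ => ρ / l) (𝓝[>] 0) atTop := by
          simp only [div_eq_mul_inv]
          exact tendsto_inv_nhdsGT_zero.const_mul_atTop hρ
        exact (h3.comp tendsto_fst).eventually (eventually_ge_atTop _)
      filter_upwards [h1, h2] with q h1 h2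
      linarith
    have hQW := (hQc.tendsto _).comp hW
    have hPW := (K.P_cont.tendsto _).comp hW
    have hind : ∀ᶠ q : ℝ × Euc (d+1) in 𝓝[>] (0:ℝ) ×ˢ 𝓝 (0 : Euc (d+1)),
        ind (q.1 * (a - Q (coreW q p)) ≤ ⟪cw 1 q.2, coreW q p⟫)
          = ind (a - Q (pad d p.2) ≤ p.1) := by
      rcases lt_or_gt_of_ne hp with h | h
      · have : ∀ᶠ q : ℝ × Euc (d+1) in 𝓝[>] (0:ℝ) ×ˢ 𝓝 (0 : Euc (d+1)),
            Q (coreW q p) < a - p.1 := hQW.eventually (gt_mem_nhds (by linarith))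
        filter_upwards [this, hev1] with q h1 h2
        rw [inner_coreW, ind_false (p := a - Q (pad d p.2) ≤ p.1) (by linarith), ind_false]
        intro h3
        have := le_of_mul_le_mul_left h3 h2
        linarith
      · have : ∀ᶠ q : ℝ × Euc (d+1) in 𝓝[>] (0:ℝ) ×ˢ 𝓝 (0 : Euc (d+1)),
            a - p.1 < Q (coreW q p) := hQW.eventually (lt_mem_nhds (by linarith))
        filter_upwards [this, hev1] with q h1 h2
        rw [inner_coreW, ind_true (p := a - Q (pad d p.2) ≤ p.1) h.le, ind_true]
        exact mul_le_mul_of_nonneg_left (by linarith) h2.le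
    have hlim : Tendsto (fun q : ℝ × Euc (d+1) => K.P (coreW q p) *
        (ind (a - Q (pad d p.2) ≤ p.1) - ind (0 < p.1)))
        (𝓝[>] (0:ℝ) ×ˢ 𝓝 (0 : Euc (d+1))) (𝓝 (f p)) := hPW.mul_const _
    refine hlim.congr' ?_
    filter_upwards [hbig, hind, hev1] with q h1 h2 h3
    unfold coreG
    rw [h2, ind_true h1, inner_coreW, one_mul]
    congr 3
    exact propext ⟨fun h => mul_pos h3 h, fun h => pos_of_mul_pos_right h h3.le⟩
  have hmain := tendsto_integral_filter_of_dominated_convergence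
    (μ := (volume : Measure (ℝ × Euc (d+1))))
    (bnd D (2 * |a| + 6 * C) ((d:ℝ) + 2 + α)) (l := 𝓝[>] (0:ℝ) ×ˢ 𝓝 (0 : Euc (d+1)))
    (F := fun q p => coreG K Q a ρ q (coreW q p)) (f := f)
    (Eventually.of_forall fun q => ((coreG_meas K Q hQc a ρ q).comp
      (coreW_cont.comp (by fun_prop : Continuous (fun p : ℝ × Euc (d+1) => (q, p)))).measurable).aestronglyMeasurable)
    (hbd.mono fun q h => Eventually.of_forall h) hbi hae
  have hfm : Measurable f := by
    have hgm : Measurable (fun p : ℝ × Euc (d+1) => Q (pad d p.2)) :=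
      (hQc.comp (pad_cont.comp continuous_snd)).measurable
    refine ((K.P_cont.comp (pad_cont.comp continuous_snd)).measurable).mul
      ((meas_ind ?_).sub (meas_ind ?_))
    · exact measurableSet_le (measurable_const.sub hgm) measurable_fst
    · exact measurableSet_lt measurable_const measurable_fst
  have hfb : Integrable f := by
    refine hbi.mono' hfm.aestronglyMeasurable ?_
    filter_upwards [hae] with p hp
    exact le_of_tendsto hp.norm (hbd.mono fun q h => h p)
  have hval : ∫ p, f p = -∫ w, K.P (pad d w) * (a - Q (pad d w)) := by
    erw [integral_prod_symm _ hfb]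
    rw [← integral_neg]
    congr 1; ext w
    simp only [hf]
    rw [integral_const_mul, int_ind_diff]; ring
  rw [hval] at hmain
  exact hmain

lemma ind_P_int (K : FracKernel (d+2) α) {p : Euc (d+2) → Prop} (hp : MeasurableSet {x | p x}) :
    Integrable (fun w => ind (p w) * K.P w) := by
  refine (K_int K).mono' ((meas_ind hp).mul K.P_cont.measurable).aestronglyMeasurable
    (Eventually.of_forall fun w => ?_)
  rw [norm_mul, Real.norm_of_nonneg (K.P_pos _).le]
  exact mul_le_of_le_one_left (K.P_pos _).le (norm_ind_le _)

lemma tail_tendsto (hα : α ∈ Set.Ioo (1:ℝ) 2) (K : FracKernel (d+2) α) (ρ : ℝ) (hρ : 0 < ρ) :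
    Tendsto (fun l : ℝ => ∫ w, ind (ρ / l < ‖w‖) * (‖w‖ * K.P w)) (𝓝[>] 0) (𝓝 0) := by
  have h := tendsto_integral_filter_of_dominated_convergence (μ := (volume : Measure (Euc (d+2))))
    (fun w => ‖w‖ * K.P w) (l := 𝓝[>] (0:ℝ))
    (F := fun l w => ind (ρ / l < ‖w‖) * (‖w‖ * K.P w)) (f := fun _ => 0) ?_ ?_
    (K_int_norm hα K) ?_
  · simpa using h
  · refine Eventually.of_forall fun l => Measurable.aestronglyMeasurable ?_
    exact (meas_ind (measurableSet_lt (by fun_prop) (by fun_prop))).mul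
      (continuous_norm.mul K.P_cont).measurable
  · refine Eventually.of_forall fun l => Eventually.of_forall fun w => ?_
    have : 0 ≤ ‖w‖ * K.P w := mul_nonneg (norm_nonneg _) (K.P_pos _).le
    rw [norm_mul, Real.norm_of_nonneg this]
    exact mul_le_of_le_one_left this (norm_ind_le _)
  · refine Eventually.of_forall fun w => ?_
    have h3 : Tendsto (fun l : ℝ => ρ / l) (𝓝[>] 0) atTop := by
      simp only [div_eq_mul_inv]
      exact tendsto_inv_nhdsGT_zero.const_mul_atTop hρ
    refine tendsto_const_nhds.congr' ?_
    filter_upwards [h3.eventually (eventually_ge_atTop ‖w‖)] with l hl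
    rw [ind_false (by linarith), zero_mul]

lemma K_even (K : FracKernel (d+2) α) (w : Euc (d+2)) : K.P (-w) = K.P w :=
  K.P_radial _ _ (norm_neg w)

/-- half-space minus slab -/
lemma half_slab (K : FracKernel (d+2) α) (v : Euc (d+2)) (η : ℝ) (hη : 0 ≤ η) :
    2 * (∫ w, ind (η < ⟪v, w⟫) * K.P w) + (∫ w, ind (|⟪v, w⟫| < η) * K.P w) ≤ 1 := by
  have m1 : MeasurableSet {w : Euc (d+2) | η < ⟪v, w⟫} :=
    measurableSet_lt (by fun_prop) (by fun_prop)
  have m2 : MeasurableSet {w : Euc (d+2) | η < -⟪v, w⟫} :=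
    measurableSet_lt (by fun_prop) (by fun_prop)
  have m3 : MeasurableSet {w : Euc (d+2) | |⟪v, w⟫| < η} :=
    measurableSet_lt (by fun_prop) (by fun_prop)
  have h1 : ∫ w, ind (η < ⟪v, w⟫) * K.P w = ∫ w, ind (η < -⟪v, w⟫) * K.P w := by
    rw [← integral_neg_eq_self]
    congr 1; ext w
    rw [K_even, inner_neg_right]
  rw [two_mul]
  nth_rewrite 2 [h1]
  rw [← int_add3 (ind_P_int K m1) (ind_P_int K m2) (ind_P_int K m3), ← K.P_int]
  refine integral_mono (((ind_P_int K m1).add (ind_P_int K m2)).add (ind_P_int K m3)) (K_int K)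
    fun w => ?_
  simp only
  rw [← add_mul, ← add_mul]
  apply mul_le_of_le_one_left (K.P_pos _).le
  by_cases h1 : η < ⟪v, w⟫
  · have h2 : ¬ η < -⟪v, w⟫ := by linarith
    have h3 : ¬ |⟪v, w⟫| < η := by intro h; linarith [(abs_lt.1 h).2]
    rw [ind_true h1, ind_false h2, ind_false h3]; norm_num
  · by_cases h2 : η < -⟪v, w⟫
    · have h3 : ¬ |⟪v, w⟫| < η := by intro h; linarith [(abs_lt.1 h).1]
      rw [ind_false h1, ind_true h2, ind_false h3]; norm_num
    · rw [ind_false h1, ind_false h2]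
      linarith [ind_le_one (|⟪v, w⟫| < η)]

lemma core (hα : α ∈ Set.Ioo (1:ℝ) 2) (K : FracKernel (d+2) α) (Q : Euc (d+2) → ℝ)
    (hQc : Continuous Q) (C : ℝ) (hC : 0 < C)
    (hQ : ∀ w, |Q w| ≤ C * ‖w‖^2) (a ρ : ℝ) (hρ : 0 < ρ) (hρC : 8 * C * ρ ≤ 1)
    (hI : 0 < ∫ w, K.P (pad d w) * (a - Q (pad d w))) :
    ∃ δ : ℝ, 0 < δ ∧ ∀ l : ℝ, 0 < l → l < δ → ∀ v : Euc (d+2), v 0 = 1 →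
      ‖v - cw 1 0‖ < δ →
      ∫ w, ind (ρ / l < ‖w‖ ∨ l * (a - Q w) ≤ ⟪v, w⟫) * K.P w < 1 / 2 := by
  have hT : Tendsto (fun q : ℝ × Euc (d+1) => ρ⁻¹ * (∫ w, ind (ρ / q.1 < ‖w‖) * (‖w‖ * K.P w)) +
      ∫ p, coreG K Q a ρ q (coreW q p))
      (𝓝[>] (0:ℝ) ×ˢ 𝓝 (0 : Euc (d+1)))
      (𝓝 (ρ⁻¹ * 0 + -∫ w, K.P (pad d w) * (a - Q (pad d w)))) :=
    (((tail_tendsto hα K ρ hρ).comp tendsto_fst).const_mul _).add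
      (core_tendsto hα K Q hQc C hC hQ a ρ hρ hρC)
  have hlt := hT.eventually_lt_const (u := 0) (by rw [mul_zero, zero_add]; linarith)
  obtain ⟨pa, hpa, pb, hpb, hp⟩ := Filter.eventually_prod_iff.1 hlt
  obtain ⟨δ₁, hδ₁, h1⟩ := (nhdsGT_basis (0:ℝ)).eventually_iff.1 hpa
  obtain ⟨δ₂, hδ₂, h2⟩ := Metric.eventually_nhds_iff.1 hpb
  refine ⟨min 1 (min δ₁ δ₂), by positivity, fun l hl0 hl v hv0 hv => ?_⟩
  obtain ⟨b, hb⟩ := cw_surj v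
  rw [hv0] at hb
  have hnb : ‖b‖ ≤ ‖v - cw 1 0‖ := by
    have : v - cw 1 0 = cw 0 b := by
      rw [hb]; ext i; refine Fin.cases ?_ (fun j => ?_) i
      · simp [cw_zero]
      · simp [cw_succ]
    rw [this]; exact norm_le_norm_cw _ _
  have hneg := hp (h1 ⟨hl0, hl.trans_le ((min_le_right _ _).trans (min_le_left _ _))⟩)
    (h2 (y := b) (by rw [dist_zero_right]; exact hnb.trans_lt (hv.trans_le ((min_le_right _ _).trans (min_le_right _ _)))))
  simp only at hneg
  have hb1 : ‖b‖ ≤ 1 := hnb.trans (hv.le.trans (min_le_left _ _))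
  obtain ⟨D, hD, hPD⟩ := K_decay hα K
  have hcv := change_var (coreG K Q a ρ (l, b)) (coreG_int K Q hQc a ρ (l, b)) l hl0 b ?_
  swap
  · refine (bnd_int (d := d) hα D (2 * |a| + 6 * C) hD (by positivity)).mono'
      ((coreG_meas K Q hQc a ρ (l, b)).comp
      (coreW_cont.comp (by fun_prop : Continuous (fun p : ℝ × Euc (d+1) => ((l, b), p)))).measurable).aestronglyMeasurable (Eventually.of_forall fun p => ?_)
    exact coreG_bound K Q C hC hQ a ρ hρ hρC D _ (by have := hα.1; positivity) hD hPD (l, b) hl0 hb1 p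
  have hcv' : ∫ w, coreG K Q a ρ (l, b) w = l * ∫ p, coreG K Q a ρ (l, b) (coreW (l, b) p) := hcv
  have hhalf := half_slab K v 0 le_rfl
  have hz : 0 ≤ ∫ w, ind (|⟪v, w⟫| < 0) * K.P w :=
    integral_nonneg fun w => mul_nonneg (ind_nonneg _) (K.P_pos _).le
  have m1 : MeasurableSet {w : Euc (d+2) | 0 < ⟪v, w⟫} :=
    measurableSet_lt (by fun_prop) (by fun_prop)
  have m2 : MeasurableSet {w : Euc (d+2) | ρ / l < ‖w‖} :=
    measurableSet_lt (by fun_prop) (by fun_prop)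
  have m3 : MeasurableSet {w : Euc (d+2) | l * (a - Q w) ≤ ⟪v, w⟫} :=
    measurableSet_le (by fun_prop) (by fun_prop)
  have i2 : Integrable (fun w : Euc (d+2) => ind (ρ / l < ‖w‖) * (‖w‖ * K.P w)) := by
    refine (K_int_norm hα K).mono' ((meas_ind m2).mul (continuous_norm.mul K.P_cont).measurable).aestronglyMeasurable (Eventually.of_forall fun w => ?_)
    have : 0 ≤ ‖w‖ * K.P w := mul_nonneg (norm_nonneg _) (K.P_pos _).le
    rw [norm_mul, Real.norm_of_nonneg this]
    exact mul_le_of_le_one_left this (norm_ind_le _)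
  have hle : ∫ w, ind (ρ / l < ‖w‖ ∨ l * (a - Q w) ≤ ⟪v, w⟫) * K.P w ≤
      ∫ w, ((l * ρ⁻¹) * (ind (ρ / l < ‖w‖) * (‖w‖ * K.P w)) + coreG K Q a ρ (l, b) w
        + ind (0 < ⟪v, w⟫) * K.P w) := by
    refine integral_mono (ind_P_int K (m2.union m3))
      (((i2.const_mul _).add (coreG_int K Q hQc a ρ (l, b))).add (ind_P_int K m1)) fun w => ?_
    simp only [coreG, ← hb]
    have hP := K.P_pos w
    by_cases hw : ρ / l < ‖w‖
    · rw [ind_true (Or.inl hw), ind_true hw, ind_false (p := ‖w‖ ≤ ρ / l) (by linarith)]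
      have : 1 ≤ l * ρ⁻¹ * ‖w‖ := by
        rw [div_lt_iff₀ hl0] at hw
        rw [mul_assoc, mul_comm, mul_assoc, ← div_eq_inv_mul, le_div_iff₀ hρ]
        linarith
      have h6 : 0 ≤ ind (0 < ⟪v, w⟫) * K.P w := mul_nonneg (ind_nonneg _) hP.le
      nlinarith
    · rw [ind_false hw, ind_true (p := ‖w‖ ≤ ρ / l) (by linarith)]
      have : (ρ / l < ‖w‖ ∨ l * (a - Q w) ≤ ⟪v, w⟫) = (l * (a - Q w) ≤ ⟪v, w⟫) := by
        simp [hw]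
      rw [this]
      apply le_of_eq; ring
  rw [int_add3 (i2.const_mul _) (coreG_int K Q hQc a ρ (l, b)) (ind_P_int K m1),
    integral_const_mul, hcv'] at hle
  nlinarith
end core2

section rot
variable {d : ℕ} {α : ℝ}

lemma norm_e0 : ‖(cw 1 0 : Euc (d+2))‖ = 1 := by
  have := norm_cw_sq 1 (0 : Euc (d+1))
  rw [norm_zero] at this
  have h2 : ‖(cw 1 0 : Euc (d+2))‖^2 = 1^2 := by linarith
  exact (sq_eq_sq₀ (norm_nonneg _) zero_le_one).1 h2

lemma exists_rot (e : Euc (d+2)) (he : ‖e‖ = 1) :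
    ∃ L : Euc (d+2) ≃ₗᵢ[ℝ] Euc (d+2), L (cw 1 0) = e :=
  ⟨(ℝ ∙ (cw 1 0 - e))ᗮ.reflection, Submodule.reflection_sub (by rw [norm_e0, he])⟩

lemma rot_int (K : FracKernel (d+2) α) (L : Euc (d+2) ≃ₗᵢ[ℝ] Euc (d+2)) (Q : Euc (d+2) → ℝ)
    (r l a : ℝ) (v : Euc (d+2)) :
    ∫ w, ind (r < ‖w‖ ∨ l * (a - Q w) ≤ ⟪v, w⟫) * K.P w =
    ∫ w, ind (r < ‖w‖ ∨ l * (a - Q (L w)) ≤ ⟪L.symm v, w⟫) * K.P w := by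
  rw [← (L.measurePreserving).integral_comp L.toMeasurableEquiv.measurableEmbedding]
  congr 1; ext w
  have h1 : ⟪v, L w⟫ = ⟪L.symm v, w⟫ := by
    rw [← L.inner_map_map (L.symm v) w, L.apply_symm_apply]
  rw [L.norm_map, h1, K.P_radial (L w) w (L.norm_map w)]

lemma inner_e0 (v : Euc (d+2)) : ⟪v, cw 1 0⟫ = v 0 := by
  obtain ⟨b, hb⟩ := cw_surj v
  conv_lhs => rw [hb]
  rw [inner_cw]; simp

lemma core_rot (hα : α ∈ Set.Ioo (1:ℝ) 2) (K : FracKernel (d+2) α) (Q : Euc (d+2) → ℝ)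
    (hQc : Continuous Q) (C : ℝ) (hC : 0 < C)
    (hQ : ∀ w, |Q w| ≤ C * ‖w‖^2) (a ρ : ℝ) (hρ : 0 < ρ) (hρC : 8 * C * ρ ≤ 1)
    (e : Euc (d+2)) (L : Euc (d+2) ≃ₗᵢ[ℝ] Euc (d+2)) (hL : L (cw 1 0) = e)
    (hI : 0 < ∫ w, K.P (pad d w) * (a - Q (L (pad d w)))) :
    ∃ δ : ℝ, 0 < δ ∧ ∀ l : ℝ, 0 < l → l < δ → ∀ v : Euc (d+2), ⟪v, e⟫ = 1 →
      ‖v - e‖ < δ →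
      ∫ w, ind (ρ / l < ‖w‖ ∨ l * (a - Q w) ≤ ⟪v, w⟫) * K.P w < 1 / 2 := by
  obtain ⟨δ, hδ, h⟩ := core hα K (fun w => Q (L w)) (hQc.comp L.continuous) C hC
    (fun w => by have := hQ (L w); rwa [L.norm_map] at this) a ρ hρ hρC hI
  refine ⟨δ, hδ, fun l hl0 hl v hv hve => ?_⟩
  rw [rot_int K L]
  refine h l hl0 hl _ ?_ ?_
  · rw [← inner_e0, ← L.inner_map_map, L.apply_symm_apply, hL, hv]
  · rw [← L.norm_map, map_sub, L.apply_symm_apply, hL]; exact hve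

lemma core_deg (hα : α ∈ Set.Ioo (1:ℝ) 2) (K : FracKernel (d+2) α) (ε : ℝ) (hε : 0 < ε)
    (a ρ : ℝ) (hρ : 0 < ρ) (hρC : 8 * ε * ρ ≤ 1)
    (hI : 0 < ∫ w, K.P (pad d w) * (a - ε * ‖w‖^2)) :
    ∃ δ : ℝ, 0 < δ ∧ ∀ l : ℝ, 0 < l → l < δ → ∀ e : Euc (d+2), ‖e‖ = 1 →
      ∫ w, ind (ρ / l < ‖w‖ ∨ l * (a - ε * ‖w‖^2) ≤ ⟪e, w⟫) * K.P w < 1 / 2 := by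
  obtain ⟨δ, hδ, h⟩ := core hα K (fun w => ε * ‖w‖^2) (by fun_prop) ε hε
    (fun w => by rw [abs_of_nonneg (by positivity)]) a ρ hρ hρC (by simpa only [norm_pad] using hI)
  refine ⟨δ, hδ, fun l hl0 hl e he => ?_⟩
  obtain ⟨L, hL⟩ := exists_rot e he
  rw [rot_int K L (fun w => ε * ‖w‖^2)]
  simp only [L.norm_map]
  refine h l hl0 hl _ ?_ ?_
  · rw [← inner_e0, ← L.inner_map_map, L.apply_symm_apply, hL, real_inner_self_eq_norm_sq, he]; norm_num
  · rw [← hL, L.symm_apply_apply, sub_self, norm_zero]; exact hδ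

lemma slice_symm (K : FracKernel (d+2) α) (S : Euc (d+1) ≃ₗᵢ[ℝ] Euc (d+1)) (g : Euc (d+1) → ℝ) :
    ∫ w, g w * K.P (pad d w) = ∫ w, g (S w) * K.P (pad d w) := by
  rw [← (S.measurePreserving).integral_comp S.toMeasurableEquiv.measurableEmbedding]
  congr 1; ext w
  rw [K.P_radial (pad d (S w)) (pad d w) (by rw [norm_pad, norm_pad, S.norm_map])]

def flip1 (i : Fin (d+1)) : Euc (d+1) ≃ₗᵢ[ℝ] Euc (d+1) :=
  LinearIsometryEquiv.piLpCongrRight 2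
    (fun k => if k = i then LinearIsometryEquiv.neg ℝ else LinearIsometryEquiv.refl ℝ ℝ)

lemma moment_off (K : FracKernel (d+2) α) (i j : Fin (d+1)) (hij : i ≠ j) :
    ∫ w : Euc (d+1), (w i * w j) * K.P (pad d w) = 0 := by
  have h := slice_symm K (flip1 i) (fun w => w i * w j)
  have h1 : ∀ w : Euc (d+1), (flip1 i w) i = - w i := by
    intro w; simp [flip1]
  have h2 : ∀ w : Euc (d+1), (flip1 i w) j = w j := by
    intro w; simp [flip1, hij.symm]
  simp only [h1, h2] at h
  have h3 : ∫ w : Euc (d+1), (-w i * w j) * K.P (pad d w)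
      = - ∫ w : Euc (d+1), (w i * w j) * K.P (pad d w) := by
    rw [← integral_neg]; congr 1; ext w; ring
  rw [h3] at h
  linarith

lemma moment_diag (K : FracKernel (d+2) α) (i : Fin (d+1)) :
    ∫ w : Euc (d+1), (w i * w i) * K.P (pad d w) = ∫ w : Euc (d+1), (w 0)^2 * K.P (pad d w) := by
  have h := slice_symm K (LinearIsometryEquiv.piLpCongrLeft 2 ℝ ℝ (Equiv.swap 0 i))
    (fun w => w i * w i)
  rw [h]
  congr 1; ext w
  simp [LinearIsometryEquiv.piLpCongrLeft_apply, sq]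

lemma pad_sum (w : Euc (d+1)) :
    pad d w = ∑ i : Fin (d+1), w i • (EuclideanSpace.basisFun (Fin (d+2)) ℝ i.succ) := by
  rw [pad_eq]
  ext k
  refine Fin.cases ?_ (fun j => ?_) k
  · simp [cw_zero]
  · simp [cw_succ, Finset.sum_apply, Pi.single_apply]

lemma trace_int (hα : α ∈ Set.Ioo (1:ℝ) 2) (K : FracKernel (d+2) α)
    (A : Euc (d+2) →L[ℝ] Euc (d+2)) (e : Euc (d+2)) (L : Euc (d+2) ≃ₗᵢ[ℝ] Euc (d+2))
    (hL : L (cw 1 0) = e) :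
    ∫ w, ⟪A (L (pad d w)), L (pad d w)⟫ * K.P (pad d w) =
      (LinearMap.trace ℝ (Euc (d+2)) (A : Euc (d+2) →ₗ[ℝ] Euc (d+2)) - ⟪A e, e⟫) *
        ∫ w : Euc (d+1), (w 0)^2 * K.P (pad d w) := by
  set b := EuclideanSpace.basisFun (Fin (d+2)) ℝ with hb
  have hexp : ∀ w : Euc (d+1), ⟪A (L (pad d w)), L (pad d w)⟫ * K.P (pad d w) =
      ∑ i : Fin (d+1), ∑ j : Fin (d+1),
        ⟪A (L (b i.succ)), L (b j.succ)⟫ * ((w i * w j) * K.P (pad d w)) := by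
    intro w
    have : ⟪A (L (pad d w)), L (pad d w)⟫ = ∑ i : Fin (d+1), ∑ j : Fin (d+1),
        ⟪A (L (b i.succ)), L (b j.succ)⟫ * (w i * w j) := by
      rw [pad_sum]
      simp only [map_sum, sum_inner, inner_sum, map_smul, real_inner_smul_left,
        real_inner_smul_right]
      rw [Finset.sum_comm]
      refine Finset.sum_congr rfl fun i _ => Finset.sum_congr rfl fun j _ => ?_
      rw [← hb]; ring
    rw [this, Finset.sum_mul]
    refine Finset.sum_congr rfl fun i _ => ?_
    rw [Finset.sum_mul]
    refine Finset.sum_congr rfl fun j _ => ?_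
    ring
  have hint : ∀ i j : Fin (d+1), Integrable (fun w : Euc (d+1) => (w i * w j) * K.P (pad d w)) := by
    intro i j
    refine slice_int hα K (fun w => w i * w j) (by fun_prop) 1 fun w => ?_
    rw [abs_mul]
    have h1 : |w i| ≤ ‖w‖ := PiLp.norm_apply_le w i
    have h2 : |w j| ≤ ‖w‖ := PiLp.norm_apply_le w j
    have h3 := norm_nonneg w
    nlinarith [abs_nonneg (w i), abs_nonneg (w j), mul_le_mul h1 h2 (abs_nonneg _) h3]
  simp only [hexp]
  rw [integral_finsetSum _ (fun i _ => integrable_finsetSum _ fun j _ => (hint i j).const_mul _)]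
  have h1 : ∀ i : Fin (d+1), ∫ w : Euc (d+1), ∑ j : Fin (d+1),
        ⟪A (L (b i.succ)), L (b j.succ)⟫ * ((w i * w j) * K.P (pad d w)) =
        ⟪A (L (b i.succ)), L (b i.succ)⟫ * ∫ w : Euc (d+1), (w 0)^2 * K.P (pad d w) := by
    intro i
    rw [integral_finsetSum _ (fun j _ => (hint i j).const_mul _)]
    rw [Finset.sum_eq_single i]
    · rw [integral_const_mul, moment_diag]
    · intro j _ hj
      rw [integral_const_mul, moment_off K i j hj.symm, mul_zero]
    · simp
  simp only [h1]
  rw [← Finset.sum_mul]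
  congr 1
  rw [LinearMap.trace_eq_sum_inner _ (b.map L), Fin.sum_univ_succ (n := d+1)]
  have h0 : b 0 = cw 1 0 := by
    ext k
    refine Fin.cases ?_ (fun j => ?_) k
    · simp [cw_zero, hb]
    · simp [cw_succ, hb]
  simp only [OrthonormalBasis.map_apply, h0, hL]
  rw [real_inner_comm e]
  simp only [ContinuousLinearMap.coe_coe]
  rw [add_sub_cancel_left]
  exact Finset.sum_congr rfl fun i _ => real_inner_comm _ _
end rot

section taylor
variable {n : ℕ} {φ : Euc n → ℝ → ℝ}

def STdom (n : ℕ) : Set (Euc n × ℝ) := Set.univ ×ˢ Set.Ioi 0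

lemma STdom_open : IsOpen (STdom n) := isOpen_univ.prod isOpen_Ioi

lemma mem_STdom {y : Euc n} {s : ℝ} (hs : 0 < s) : (y, s) ∈ STdom n := ⟨trivial, hs⟩

def STfun (φ : Euc n → ℝ → ℝ) (q : Euc n × ℝ) : ℝ := φ q.1 q.2

def gradMap (φ : Euc n → ℝ → ℝ) (q : Euc n × ℝ) : Euc n :=
  (InnerProductSpace.toDual ℝ (Euc n)).symm
    ((fderiv ℝ (STfun φ) q).comp (ContinuousLinearMap.inl ℝ (Euc n) ℝ))

lemma hasFDeriv_ST (hφ : IsC2Test n φ) {q : Euc n × ℝ} (hq : q ∈ STdom n) :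
    HasFDerivAt (STfun φ) (fderiv ℝ (STfun φ) q) q := by
  have h : ContDiffAt ℝ 2 (STfun φ) q := ContDiffOn.contDiffAt hφ (STdom_open.mem_nhds hq)
  exact (h.differentiableAt (by norm_num)).hasFDerivAt

lemma hasFDeriv_space (hφ : IsC2Test n φ) (y : Euc n) {s : ℝ} (hs : 0 < s) :
    HasFDerivAt (fun y => φ y s) ((fderiv ℝ (STfun φ) (y, s)).comp
      (ContinuousLinearMap.inl ℝ (Euc n) ℝ)) y := by
  have h1 := hasFDeriv_ST hφ (mem_STdom (y := y) hs)
  have h0 : HasFDerivAt (fun e : Euc n => (e, s)) (ContinuousLinearMap.inl ℝ (Euc n) ℝ) y :=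
    hasFDerivAt_prodMk_left y s
  exact HasFDerivAt.comp (g := STfun φ) y h1 h0

lemma spaceGrad_eq (hφ : IsC2Test n φ) (y : Euc n) {s : ℝ} (hs : 0 < s) :
    spaceGrad n φ y s = gradMap φ (y, s) := by
  unfold spaceGrad gradient gradMap
  rw [(hasFDeriv_space hφ y hs).fderiv]

lemma hasFDeriv_space' (hφ : IsC2Test n φ) (y : Euc n) {s : ℝ} (hs : 0 < s) :
    HasFDerivAt (fun y => φ y s) (innerSL ℝ (spaceGrad n φ y s)) y := by
  have h := hasFDeriv_space hφ y hs
  have h2 : innerSL ℝ (spaceGrad n φ y s) = (fderiv ℝ (STfun φ) (y, s)).comp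
      (ContinuousLinearMap.inl ℝ (Euc n) ℝ) := by
    refine ContinuousLinearMap.ext fun z => ?_
    rw [spaceGrad_eq hφ y hs, gradMap, innerSL_apply_apply, InnerProductSpace.toDual_symm_apply]
  rw [h2]; exact h

lemma hasDeriv_time (hφ : IsC2Test n φ) (y : Euc n) {s : ℝ} (hs : 0 < s) :
    HasDerivAt (fun s => φ y s) (fderiv ℝ (STfun φ) (y, s) (0, 1)) s := by
  have h1 := hasFDeriv_ST hφ (mem_STdom (y := y) hs)
  have h0 : HasDerivAt (fun e : ℝ => (y, e)) ((0 : Euc n), (1:ℝ)) s :=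
    (hasDerivAt_const s y).prodMk (hasDerivAt_id s)
  exact HasFDerivAt.comp_hasDerivAt (l := STfun φ) s h1 h0

lemma timeDeriv_eq (hφ : IsC2Test n φ) (y : Euc n) {s : ℝ} (hs : 0 < s) :
    timeDeriv n φ y s = fderiv ℝ (STfun φ) (y, s) (0, 1) := (hasDeriv_time hφ y hs).deriv

lemma fderiv_C1 (hφ : IsC2Test n φ) : ContDiffOn ℝ 1 (fderiv ℝ (STfun φ)) (STdom n) :=
  ContDiffOn.fderiv_of_isOpen hφ STdom_open (by norm_num)

lemma gradMap_C1 (hφ : IsC2Test n φ) : ContDiffOn ℝ 1 (gradMap φ) (STdom n) := by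
  unfold gradMap
  refine (LinearIsometryEquiv.contDiff (InnerProductSpace.toDual ℝ (Euc n)).symm).comp_contDiffOn ?_
  exact (fderiv_C1 hφ).clm_comp contDiffOn_const

lemma hasFDeriv_grad (hφ : IsC2Test n φ) (y : Euc n) {s : ℝ} (hs : 0 < s) :
    HasFDerivAt (fun y => spaceGrad n φ y s) ((fderiv ℝ (gradMap φ) (y, s)).comp
      (ContinuousLinearMap.inl ℝ (Euc n) ℝ)) y := by
  have h : ContDiffAt ℝ 1 (gradMap φ) (y, s) :=
    (gradMap_C1 hφ).contDiffAt (STdom_open.mem_nhds (mem_STdom hs))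
  have h1 := (h.differentiableAt (by norm_num)).hasFDerivAt
  have h0 : HasFDerivAt (fun e : Euc n => (e, s)) (ContinuousLinearMap.inl ℝ (Euc n) ℝ) y :=
    hasFDerivAt_prodMk_left y s
  have h2 := HasFDerivAt.comp (g := gradMap φ) y h1 h0
  have h3 : (fun y => spaceGrad n φ y s) = gradMap φ ∘ fun y => (y, s) := by
    funext y; exact spaceGrad_eq hφ y hs
  rw [h3]; exact h2

lemma spaceHess_eq (hφ : IsC2Test n φ) (y : Euc n) {s : ℝ} (hs : 0 < s) :
    spaceHess n φ y s = (fderiv ℝ (gradMap φ) (y, s)).comp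
      (ContinuousLinearMap.inl ℝ (Euc n) ℝ) := (hasFDeriv_grad hφ y hs).fderiv

lemma grad_cont (hφ : IsC2Test n φ) (x : Euc n) {t : ℝ} (ht : 0 < t) :
    ContinuousAt (fun q : Euc n × ℝ => spaceGrad n φ q.1 q.2) (x, t) := by
  have h : ContinuousAt (gradMap φ) (x, t) :=
    (gradMap_C1 hφ).continuousOn.continuousAt (STdom_open.mem_nhds (mem_STdom ht))
  refine h.congr ?_
  filter_upwards [STdom_open.mem_nhds (mem_STdom (y := x) ht)] with q hq
  exact (spaceGrad_eq hφ q.1 hq.2).symm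

lemma hess_cont (hφ : IsC2Test n φ) (x : Euc n) {t : ℝ} (ht : 0 < t) :
    ContinuousAt (fun q : Euc n × ℝ => spaceHess n φ q.1 q.2) (x, t) := by
  have h : ContinuousAt (fun q => (fderiv ℝ (gradMap φ) q).comp
      (ContinuousLinearMap.inl ℝ (Euc n) ℝ)) (x, t) := by
    have h1 : ContinuousAt (fderiv ℝ (gradMap φ)) (x, t) :=
      (ContDiffOn.continuousOn_fderiv_of_isOpen (gradMap_C1 hφ) STdom_open (by norm_num)).continuousAt
        (STdom_open.mem_nhds (mem_STdom ht))
    exact h1.clm_comp continuousAt_const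
  refine h.congr ?_
  filter_upwards [STdom_open.mem_nhds (mem_STdom (y := x) ht)] with q hq
  exact (spaceHess_eq hφ q.1 hq.2).symm

lemma time_cont (hφ : IsC2Test n φ) (x : Euc n) {t : ℝ} (ht : 0 < t) :
    ContinuousAt (fun q : Euc n × ℝ => timeDeriv n φ q.1 q.2) (x, t) := by
  have h : ContinuousAt (fun q => fderiv ℝ (STfun φ) q (0, 1)) (x, t) := by
    have h1 : ContinuousAt (fderiv ℝ (STfun φ)) (x, t) :=
      (fderiv_C1 hφ).continuousOn.continuousAt (STdom_open.mem_nhds (mem_STdom ht))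
    exact h1.clm_apply continuousAt_const
  refine h.congr ?_
  filter_upwards [STdom_open.mem_nhds (mem_STdom (y := x) ht)] with q hq
  exact (timeDeriv_eq hφ q.1 hq.2).symm

lemma taylor (hφ : IsC2Test n φ) (x : Euc n) {t : ℝ} (ht : 0 < t) (ε : ℝ) (hε : 0 < ε) :
    ∃ r : ℝ, 0 < r ∧ ∀ (y z : Euc n) (s h : ℝ), ‖y - x‖ < r → ‖z‖ < r → |s - t| < r → 0 < h →
      h < r →
      φ (y + z) (s - h) ≤ φ y s + ⟪spaceGrad n φ y s, z⟫ + (1/2) * ⟪spaceHess n φ x t z, z⟫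
        + ε * ‖z‖^2 - (timeDeriv n φ x t - ε) * h := by
  have e1 := (hess_cont hφ x ht).eventually (Metric.ball_mem_nhds _ hε)
  have e2 := (time_cont hφ x ht).eventually (Metric.ball_mem_nhds _ hε)
  obtain ⟨R, hR, hb⟩ := Metric.eventually_nhds_iff.1 (e1.and e2)
  set A := spaceHess n φ x t with hA
  have hb1 : ∀ y s, ‖y - x‖ < R → |s - t| < R → ‖spaceHess n φ y s - A‖ ≤ ε ∧
      timeDeriv n φ x t - ε ≤ timeDeriv n φ y s := by
    intro y s h1 h2
    obtain ⟨h3, h4⟩ := hb (y := (y, s)) (by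
      rw [Prod.dist_eq, max_lt_iff]; exact ⟨by rwa [dist_eq_norm], by rwa [Real.dist_eq]⟩)
    rw [dist_eq_norm] at h3
    rw [Real.dist_eq] at h4
    exact ⟨h3.le, by linarith [(abs_lt.1 h4).1]⟩
  refine ⟨min (R/2) (t/2), by positivity, fun y z s h hy hz hs hh0 hh => ?_⟩
  have hy2 := hy.trans_le (min_le_left _ _)
  have hz2 := hz.trans_le (min_le_left _ _)
  have hs2 := hs.trans_le (min_le_left _ _)
  have hh2 := hh.trans_le (min_le_left _ _)
  have hs3 := hs.trans_le (min_le_right _ _)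
  have hh3 := hh.trans_le (min_le_right _ _)
  have hs4 := abs_lt.1 hs2
  have hs5 := abs_lt.1 hs3
  have hspos : 0 < s := by linarith
  -- time step
  have htime : φ (y + z) (s - h) ≤ φ (y + z) s - (timeDeriv n φ x t - ε) * h := by
    obtain ⟨c, hc, hc2⟩ := exists_hasDerivAt_eq_slope (fun σ => φ (y + z) σ)
      (fun σ => timeDeriv n φ (y + z) σ) (a := s - h) (b := s) (by linarith)
      (fun σ hσ => (hasDeriv_time hφ (y + z) (by linarith [hσ.1])).continuousAt.continuousWithinAt)
      (fun σ hσ => by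
        rw [timeDeriv_eq hφ _ (by linarith [hσ.1])]
        exact hasDeriv_time hφ (y + z) (by linarith [hσ.1]))
    have h1 := (hb1 (y + z) c (by
      have : y + z - x = (y - x) + z := by abel
      rw [this]; exact (norm_add_le _ _).trans_lt (by linarith))
      (abs_lt.2 ⟨by linarith [hc.1], by linarith [hc.2]⟩)).2
    rw [hc2, le_div_iff₀ (by linarith)] at h1
    have : s - (s - h) = h := by ring
    rw [this] at h1
    linarith
  -- space step
  have hspace : φ (y + z) s ≤ φ y s + ⟪spaceGrad n φ y s, z⟫ + (1/2) * ⟪A z, z⟫ + ε * ‖z‖^2 := by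
    have hder : ∀ τ : ℝ, HasDerivAt (fun τ : ℝ => φ (y + τ • z) s - (τ * ⟪spaceGrad n φ y s, z⟫
        + τ^2 * ((1/2) * ⟪A z, z⟫ + ε * ‖z‖^2)))
        (⟪spaceGrad n φ (y + τ • z) s, z⟫ - (⟪spaceGrad n φ y s, z⟫
          + 2 * τ * ((1/2) * ⟪A z, z⟫ + ε * ‖z‖^2))) τ := by
      intro τ
      have h1 : HasDerivAt (fun τ : ℝ => y + τ • z) z τ := by
        simpa using ((hasDerivAt_id τ).smul_const z).const_add y
      have h2 := (hasFDeriv_space' hφ (y + τ • z) hspos).comp_hasDerivAt τ h1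
      rw [innerSL_apply_apply] at h2
      refine h2.sub (HasDerivAt.add ?_ ?_)
      · simpa using (hasDerivAt_id τ).mul_const ⟪spaceGrad n φ y s, z⟫
      · have := (hasDerivAt_pow 2 τ).mul_const ((1/2) * ⟪A z, z⟫ + ε * ‖z‖^2)
        simpa using this
    obtain ⟨c, hc, hc2⟩ := exists_hasDerivAt_eq_slope _ _ (a := (0:ℝ)) (b := 1) one_pos
      (fun τ _ => (hder τ).continuousAt.continuousWithinAt) (fun τ _ => hder τ)
    have hcl : ‖spaceGrad n φ (y + c • z) s - spaceGrad n φ y s - A ((y + c • z) - y)‖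
        ≤ ε * ‖(y + c • z) - y‖ := by
      refine Convex.norm_image_sub_le_of_norm_hasFDerivWithin_le' (s := ball x R)
        (f := fun y => spaceGrad n φ y s) (f' := fun y => spaceHess n φ y s)
        (fun y' _ => ?_) (fun y' hy' => (hb1 y' s (by rwa [mem_ball, dist_eq_norm] at hy') (by linarith)).1)
        (convex_ball _ _) (by rw [mem_ball, dist_eq_norm]; linarith) ?_
      · have := hasFDeriv_grad hφ y' hspos
        rw [← spaceHess_eq hφ y' hspos] at this
        exact this.hasFDerivWithinAt
      · rw [mem_ball, dist_eq_norm]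
        have : y + c • z - x = (y - x) + c • z := by abel
        rw [this]
        refine (norm_add_le _ _).trans_lt ?_
        rw [norm_smul, Real.norm_of_nonneg hc.1.le]
        nlinarith [norm_nonneg z, hc.1, hc.2]
    rw [add_sub_cancel_left, norm_smul, Real.norm_of_nonneg hc.1.le] at hcl
    have hin := (real_inner_le_norm (spaceGrad n φ (y + c • z) s - spaceGrad n φ y s - A (c • z)) z).trans
      (mul_le_mul_of_nonneg_right hcl (norm_nonneg z))
    rw [inner_sub_left, inner_sub_left, map_smul, real_inner_smul_left] at hin
    simp only [one_smul, zero_smul, add_zero] at hc2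
    norm_num at hc2
    have hp : 0 ≤ c * (ε * ‖z‖^2) := mul_nonneg hc.1.le (by positivity)
    nlinarith
  linarith
end taylor

section thr
variable {d : ℕ} {α : ℝ}

structure Thr (K : FracKernel (d+2) α) (V : ℝ → ℕ → Euc (d+2) → ℝ) : Prop where
  pm : ∀ h, 0 < h → ∀ k x, V h (k+1) x = 1 ∨ V h (k+1) x = -1
  step : ∀ h, 0 < h → ∀ k x, V h (k+1) x = 1 → 0 ≤ ∫ w, K.P w * V h k (x + √h • w)
  meas : ∀ h, 0 < h → ∀ k, Measurable (V h k)
  bd : ∀ h, 0 < h → ∀ k x, |V h k x| ≤ 1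

lemma scale_int (hα : α ∈ Set.Ioo (1:ℝ) 2) (K : FracKernel (d+2) α) (h : ℝ) (hh : 0 < h)
    (f : Euc (d+2) → ℝ) (x : Euc (d+2)) :
    ∫ y, K.p (x - y) (h ^ (α/2)) * f y = ∫ w, K.P w * f (x + √h • w) := by
  have hα0 : α ≠ 0 := by have := hα.1; linarith
  have hs : 0 < √h := Real.sqrt_pos.2 hh
  have h1 : (h ^ (α/2)) ^ (-α⁻¹ : ℝ) = (√h)⁻¹ := by
    rw [← Real.rpow_mul hh.le, Real.sqrt_eq_rpow, ← Real.rpow_neg hh.le]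
    congr 1; field_simp
  have h2 : (h ^ (α/2)) ^ (-((d+2 : ℕ):ℝ)/α) = ((√h)^(d+2))⁻¹ := by
    rw [← Real.rpow_mul hh.le, Real.sqrt_eq_rpow, ← Real.rpow_natCast, ← Real.rpow_mul hh.le,
      ← Real.rpow_neg hh.le]
    congr 1; field_simp
  have h3 : ∀ w, K.p (x - (x + √h • w)) (h ^ (α/2)) = ((√h)^(d+2))⁻¹ * K.P w := by
    intro w
    unfold FracKernel.p
    rw [h1, h2]
    congr 1
    apply K.P_radial
    rw [sub_add_cancel_left, smul_neg, norm_neg, smul_smul, inv_mul_cancel₀ hs.ne', one_smul]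
  rw [← integral_add_left_eq_self (fun y => K.p (x - y) (h ^ (α/2)) * f y) x]
  have h4 := Measure.integral_comp_smul (volume : Measure (Euc (d+2)))
    (fun y => K.p (x - (x + y)) (h ^ (α/2)) * f (x + y)) (√h)
  have h5 : Module.finrank ℝ (Euc (d+2)) = d+2 := by simp
  rw [h5, abs_of_pos (by positivity)] at h4
  have h6 : ∀ w, K.p (x - (x + √h • w)) (h ^ (α/2)) * f (x + √h • w) =
      ((√h)^(d+2))⁻¹ * (K.P w * f (x + √h • w)) := by
    intro w; rw [h3]; ring
  simp only [h6] at h4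
  rw [integral_const_mul, smul_eq_mul] at h4
  exact (mul_left_cancel₀ (by positivity) h4).symm

lemma one_step {K : FracKernel (d+2) α} {V : ℝ → ℕ → Euc (d+2) → ℝ} (hV : Thr K V) {h : ℝ}
    (hh : 0 < h) {k : ℕ} {y : Euc (d+2)} (h1 : V h (k+2) y = 1) (E : Euc (d+2) → Prop)
    (hE : MeasurableSet {w | E w}) (hVE : ∀ w, V h (k+1) (y + √h • w) = 1 → E w) :
    1/2 ≤ ∫ w, ind (E w) * K.P w := by
  have h2 := hV.step h hh (k+1) y h1
  have i1 := ind_P_int K hE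
  have i2 : Integrable (fun w => K.P w * V h (k+1) (y + √h • w)) := by
    refine (K_int K).mono' ?_ (Eventually.of_forall fun w => ?_)
    · refine (K.P_cont.measurable.mul ((hV.meas h hh (k+1)).comp ?_)).aestronglyMeasurable
      fun_prop
    · rw [norm_mul, Real.norm_of_nonneg (K.P_pos w).le, Real.norm_eq_abs]
      exact mul_le_of_le_one_right (K.P_pos w).le (hV.bd h hh _ _)
  have h3 : ∫ w, K.P w * V h (k+1) (y + √h • w) ≤ ∫ w, (2 * (ind (E w) * K.P w) - K.P w) := by
    refine integral_mono i2 ((i1.const_mul 2).sub (K_int K)) fun w => ?_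
    have hp := K.P_pos w
    rcases hV.pm h hh k (y + √h • w) with h4 | h4
    · have := hVE w h4
      simp only [h4, ind_true this]; linarith
    · have := ind_nonneg (E w)
      simp only [h4]; nlinarith
  rw [integral_sub (i1.const_mul 2) (K_int K), integral_const_mul, K.P_int] at h3
  linarith
end thr

section acc
variable {d : ℕ} {α : ℝ}

lemma thr_of_dyn (hα : α ∈ Set.Ioo (1:ℝ) 2) (K : FracKernel (d+2) α)
    (σ : ℝ → ℝ) (hσ : ∀ h : ℝ, 0 < h → σ h = h ^ (α / 2))
    (Ω₀ : Set (Euc (d+2))) (hΩ₀ : IsOpen Ω₀) (U : ℝ → ℕ → Euc (d+2) → ℝ)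
    (hU : IsThresholdDynamics (d+2) K.p σ Ω₀ U) :
    Thr K U ∧ Thr K (fun h k x => - U h k x) := by
  have hs : ∀ h, 0 < h → ∀ k x, U h (k+1) x = thSign (∫ w, K.P w * U h k (x + √h • w)) := by
    intro h hh k x
    rw [(hU h hh).2, hσ h hh, scale_int hα K h hh]
  have hpm : ∀ h, 0 < h → ∀ k x, U h (k+1) x = 1 ∨ U h (k+1) x = -1 := by
    intro h hh k x; rw [hs h hh]; unfold thSign; split_ifs <;> simp
  have hst : Measurable thSign := by
    unfold thSign
    exact Measurable.ite measurableSet_Ioi measurable_const measurable_const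
  have hm : ∀ h, 0 < h → ∀ k, Measurable (U h k) := by
    intro h hh k
    induction k with
    | zero =>
      have : U h 0 = fun x => Ω₀.indicator (fun _ => (1:ℝ)) x
          - ((closure Ω₀)ᶜ).indicator (fun _ => (1:ℝ)) x := funext ((hU h hh).1)
      rw [this]
      exact (measurable_const.indicator hΩ₀.measurableSet).sub
        (measurable_const.indicator isClosed_closure.measurableSet.compl)
    | succ k ih =>
      have : U h (k+1) = fun x => thSign (∫ w, K.P w * U h k (x + √h • w)) := funext (hs h hh k)
      rw [this]
      refine hst.comp ?_
      have hf : Measurable (fun q : Euc (d+2) × Euc (d+2) => K.P q.2 * U h k (q.1 + √h • q.2)) := by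
        refine (K.P_cont.measurable.comp measurable_snd).mul (ih.comp ?_)
        fun_prop
      exact (hf.stronglyMeasurable.integral_prod_right (ν := volume)).measurable
  have hb : ∀ h, 0 < h → ∀ k x, |U h k x| ≤ 1 := by
    intro h hh k x
    cases k with
    | zero =>
      rw [(hU h hh).1 x]
      unfold Set.indicator
      split_ifs <;> simp
    | succ k => rcases hpm h hh k x with h1 | h1 <;> rw [h1] <;> simp
  refine ⟨⟨hpm, ?_, hm, hb⟩, ⟨?_, ?_, fun h hh k => (hm h hh k).neg, ?_⟩⟩
  · intro h hh k x h1
    rw [hs h hh] at h1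
    unfold thSign at h1
    split_ifs at h1 with h2
    · exact h2.le
    · norm_num at h1
  · intro h hh k x
    rcases hpm h hh k x with h1 | h1 <;> simp [h1]
  · intro h hh k x h1
    rw [hs h hh] at h1
    unfold thSign at h1
    split_ifs at h1 with h2
    · norm_num at h1
    · simp only [mul_neg]; rw [integral_neg]; linarith
  · intro h hh k x; simpa using hb h hh k x

def AccSet (V : ℝ → ℕ → Euc (d+2) → ℝ) (x : Euc (d+2)) (t : ℝ) : Prop :=
  ∀ ε : ℝ, 0 < ε → ∃ (h : ℝ) (k : ℕ) (y : Euc (d+2)), 0 < h ∧ h < ε ∧ dist y x < ε ∧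
    |(k:ℝ) * h - t| < ε ∧ V h k y = 1

variable {K : FracKernel (d+2) α} {V : ℝ → ℕ → Euc (d+2) → ℝ}

def LSet (V : ℝ → ℕ → Euc (d+2) → ℝ) (x : Euc (d+2)) (t ε : ℝ) : Set ℝ :=
  {v : ℝ | ∃ (h : ℝ) (k : ℕ) (y : Euc (d+2)),
    0 < h ∧ h < ε ∧ dist y x < ε ∧ |(k : ℝ) * h - t| < ε ∧ v = V h k y}

lemma limsupStar_eq (V : ℝ → ℕ → Euc (d+2) → ℝ) (x : Euc (d+2)) (t : ℝ) :
    limsupStar (d+2) V x t = sInf {S : ℝ | ∃ ε : ℝ, 0 < ε ∧ S = sSup (LSet V x t ε)} := rfl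

lemma LSet_bd (hV : Thr K V) {x : Euc (d+2)} {t ε v : ℝ} (hv : v ∈ LSet V x t ε) :
    -1 ≤ v ∧ v ≤ 1 := by
  obtain ⟨h, k, y, h1, -, -, -, rfl⟩ := hv
  exact abs_le.1 (hV.bd h h1 k y)

lemma sSup_LSet_bd (hV : Thr K V) (x : Euc (d+2)) (t ε : ℝ) :
    -1 ≤ sSup (LSet V x t ε) ∧ sSup (LSet V x t ε) ≤ 1 := by
  constructor
  · rcases (LSet V x t ε).eq_empty_or_nonempty with h | ⟨v, hv⟩
    · rw [h, Real.sSup_empty]; norm_num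
    · exact (LSet_bd hV hv).1.trans (le_csSup ⟨1, fun w hw => (LSet_bd hV hw).2⟩ hv)
  · exact Real.sSup_le (fun w hw => (LSet_bd hV hw).2) zero_le_one

lemma limsup_bd (hV : Thr K V) (x : Euc (d+2)) (t : ℝ) :
    -1 ≤ limsupStar (d+2) V x t ∧ limsupStar (d+2) V x t ≤ 1 := by
  rw [limsupStar_eq]
  constructor
  · refine le_csInf ⟨_, 1, one_pos, rfl⟩ ?_
    rintro _ ⟨ε, -, rfl⟩; exact (sSup_LSet_bd hV x t ε).1
  · have hm : sSup (LSet V x t 1) ∈ {S : ℝ | ∃ ε : ℝ, 0 < ε ∧ S = sSup (LSet V x t ε)} :=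
      ⟨1, one_pos, rfl⟩
    refine (csInf_le ⟨-1, ?_⟩ hm).trans (sSup_LSet_bd hV x t 1).2
    rintro _ ⟨ε, -, rfl⟩; exact (sSup_LSet_bd hV x t ε).1

lemma limsup_acc (hV : Thr K V) {x : Euc (d+2)} {t : ℝ} (ha : AccSet V x t) :
    limsupStar (d+2) V x t = 1 := by
  refine le_antisymm (limsup_bd hV x t).2 ?_
  rw [limsupStar_eq]
  refine le_csInf ⟨_, 1, one_pos, rfl⟩ ?_
  rintro _ ⟨ε, hε, rfl⟩
  obtain ⟨h, k, y, h1, h2, h3, h4, h5⟩ := ha ε hε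
  exact le_csSup ⟨1, fun w hw => (LSet_bd hV hw).2⟩ ⟨h, k, y, h1, h2, h3, h4, h5.symm⟩

lemma limsup_nacc (hV : Thr K V) {x : Euc (d+2)} {t : ℝ} (ht : 0 < t) (ha : ¬ AccSet V x t) :
    limsupStar (d+2) V x t = -1 := by
  refine le_antisymm ?_ (limsup_bd hV x t).1
  unfold AccSet at ha
  push Not at ha
  obtain ⟨ε, hε, hn⟩ := ha
  rw [limsupStar_eq]
  have hmm : sSup (LSet V x t (min ε t)) ∈ {S : ℝ | ∃ ε : ℝ, 0 < ε ∧ S = sSup (LSet V x t ε)} :=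
    ⟨min ε t, lt_min hε ht, rfl⟩
  refine (csInf_le ⟨-1, ?_⟩ hmm).trans ?_
  · rintro _ ⟨ε, -, rfl⟩; exact (sSup_LSet_bd hV x t ε).1
  obtain ⟨m, hm⟩ := exists_nat_gt (t / min ε t)
  have hmin : 0 < min ε t := lt_min hε ht
  have hm0 : (0:ℝ) < m := lt_trans (by positivity) hm
  refine csSup_le ⟨_, t / m, m, x, by positivity, ?_, by simpa using hmin, ?_, rfl⟩ ?_
  · rw [div_lt_iff₀ hmin] at hm
    rw [div_lt_iff₀ hm0]; linarith
  · rw [mul_div_cancel₀ _ hm0.ne']; simpa using hmin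
  · rintro v ⟨h, k, y, h1, h2, h3, h4, rfl⟩
    have h5 := hn h k y h1 (h2.trans_le (min_le_left _ _)) (h3.trans_le (min_le_left _ _))
      (h4.trans_le (min_le_left _ _))
    cases k with
    | zero =>
      have := h4.trans_le (min_le_right _ _)
      simp [abs_of_pos ht] at this
    | succ k =>
      rcases hV.pm h h1 k y with h6 | h6
      · exact absurd h6 h5
      · exact h6.le

lemma limsup_usc (hV : Thr K V) : UpperSemicontinuousOn
    (fun q : Euc (d+2) × ℝ => limsupStar (d+2) V q.1 q.2) (Set.univ ×ˢ Set.Ioi 0) := by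
  rintro ⟨x, t⟩ ⟨-, ht⟩ c hc
  have ht : 0 < t := ht
  by_cases ha : AccSet V x t
  · simp only [limsup_acc hV ha] at hc
    exact Eventually.of_forall fun q => (limsup_bd hV q.1 q.2).2.trans_lt hc
  · simp only [limsup_nacc hV ht ha] at hc
    unfold AccSet at ha
    push Not at ha
    obtain ⟨ε, hε, hn⟩ := ha
    have h1 : ∀ᶠ q : Euc (d+2) × ℝ in 𝓝[Set.univ ×ˢ Set.Ioi 0] (x, t), q ∈ ball (x, t) (ε/2) :=
      mem_nhdsWithin_of_mem_nhds (ball_mem_nhds _ (by linarith))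
    filter_upwards [h1, self_mem_nhdsWithin] with q hq hq2
    have hq3 : ¬ AccSet V q.1 q.2 := by
      intro h
      rw [mem_ball, Prod.dist_eq, max_lt_iff] at hq
      obtain ⟨hd1, hd2⟩ := hq
      obtain ⟨h, k, y, a1, a2, a3, a4, a5⟩ := h (ε/2) (by linarith)
      refine hn h k y a1 (by linarith) ?_ ?_ a5
      · have := dist_triangle y q.1 x
        simp only at hd1
        linarith
      · rw [Real.dist_eq] at hd2
        have := abs_sub_le ((k:ℝ) * h) q.2 t
        simp only at hd2
        linarith
    rw [limsup_nacc hV hq2.2 hq3]; exact hc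

lemma limsup_locb (hV : Thr K V) : LocBounded (d+2) (fun x t => limsupStar (d+2) V x t) :=
  fun _ _ => ⟨1, fun q _ => abs_le.2 (limsup_bd hV q.1 q.2)⟩

lemma liminf_eq (V : ℝ → ℕ → Euc (d+2) → ℝ) (x : Euc (d+2)) (t : ℝ) :
    liminfStar (d+2) V x t = - limsupStar (d+2) (fun h k x => - V h k x) x t := by
  have h1 : ∀ ε, LSet (fun h k x => - V h k x) x t ε = - LSet V x t ε := by
    intro ε; ext v
    simp only [LSet, Set.mem_neg, Set.mem_ofPred_eq, neg_eq_iff_eq_neg]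
  have h2 : ∀ S : Set ℝ, sSup (-S) = - sInf S := by
    intro S; rw [Real.sInf_def, neg_neg]
  rw [limsupStar_eq, Real.sInf_def, neg_neg]
  simp only [h1, h2]
  change sSup {S : ℝ | ∃ ε : ℝ, 0 < ε ∧ S = sInf (LSet V x t ε)} = _
  have h3 : {S : ℝ | ∃ ε : ℝ, 0 < ε ∧ S = sInf (LSet V x t ε)} =
      -{S : ℝ | ∃ ε : ℝ, 0 < ε ∧ S = -sInf (LSet V x t ε)} := by
    ext v
    simp only [Set.mem_neg, Set.mem_ofPred_eq, neg_inj]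
  rw [h3, h2]

end acc

section sel
variable {d : ℕ} {V : ℝ → ℕ → Euc (d+2) → ℝ}

lemma sel_compact {ψ : Euc (d+2) → ℝ → ℝ}
    (S : Set (Euc (d+2) × ℝ)) (hS : IsCompact S)
    (hc : ∀ q ∈ S, ContinuousAt (fun q : Euc (d+2) × ℝ => ψ q.1 q.2) q)
    (hpos : ∀ q ∈ S, AccSet V q.1 q.2 → 0 < ψ q.1 q.2) :
    ∃ m η : ℝ, 0 < m ∧ 0 < η ∧ ∀ (h : ℝ) (k : ℕ) (y : Euc (d+2)), 0 < h → h < η →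
      (y, (k:ℝ) * h) ∈ S → V h k y = 1 → m ≤ ψ y ((k:ℝ) * h) := by
  refine IsCompact.induction_on (p := fun S => ∃ m η : ℝ, 0 < m ∧ 0 < η ∧
    ∀ (h : ℝ) (k : ℕ) (y : Euc (d+2)), 0 < h → h < η →
      (y, (k:ℝ) * h) ∈ S → V h k y = 1 → m ≤ ψ y ((k:ℝ) * h)) hS ?_ ?_ ?_ ?_
  · exact ⟨1, 1, one_pos, one_pos, fun h k y _ _ hy => absurd hy (Set.notMem_empty _)⟩
  · rintro s t hst ⟨m, η, hm, hη, H⟩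
    exact ⟨m, η, hm, hη, fun h k y h1 h2 h3 => H h k y h1 h2 (hst h3)⟩
  · rintro s t ⟨m, η, hm, hη, H⟩ ⟨m', η', hm', hη', H'⟩
    refine ⟨min m m', min η η', lt_min hm hm', lt_min hη hη', fun h k y h1 h2 h3 h4 => ?_⟩
    rcases h3 with h3 | h3
    · exact (min_le_left _ _).trans (H h k y h1 (h2.trans_le (min_le_left _ _)) h3 h4)
    · exact (min_le_right _ _).trans (H' h k y h1 (h2.trans_le (min_le_right _ _)) h3 h4)
  · intro q hq
    by_cases ha : AccSet V q.1 q.2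
    · have h0 := hpos q hq ha
      have h1 := (hc q hq).eventually (lt_mem_nhds (half_lt_self h0))
      exact ⟨_, mem_nhdsWithin_of_mem_nhds h1, ψ q.1 q.2 / 2, 1, by linarith, one_pos,
        fun h k y _ _ h3 _ => le_of_lt h3⟩
    · unfold AccSet at ha
      push Not at ha
      obtain ⟨ε, hε, hn⟩ := ha
      refine ⟨ball q ε, mem_nhdsWithin_of_mem_nhds (ball_mem_nhds _ hε), 1, ε, one_pos, hε, ?_⟩
      intro h k y h1 h2 h3 h4
      rw [mem_ball, Prod.dist_eq, max_lt_iff] at h3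
      exact absurd h4 (hn h k y h1 h2 h3.1 (by rw [← Real.dist_eq]; exact h3.2))

lemma select {ψ : Euc (d+2) → ℝ → ℝ} {x : Euc (d+2)} {t : ℝ} (ht : 0 < t)
    (hc : ∀ q : Euc (d+2) × ℝ, 0 < q.2 → ContinuousAt (fun q : Euc (d+2) × ℝ => ψ q.1 q.2) q)
    (h0 : ψ x t = 0)
    (hpos : ∀ y s, 0 < s → (y, s) ≠ (x, t) → AccSet V y s → 0 < ψ y s)
    (ha : AccSet V x t) {R : ℝ} (hR : 0 < R) (hRt : R < t) (r : ℝ) (hr : 0 < r) :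
    ∃ (h : ℝ) (k : ℕ) (y : Euc (d+2)), 0 < h ∧ h < r ∧ ‖y - x‖ < r ∧
      |((k+2 : ℕ) : ℝ) * h - t| < r ∧ V h (k+2) y = 1 ∧
      ∀ z : Euc (d+2), ‖z‖ < R/2 → V h (k+1) (y + z) = 1 →
        ψ y (((k+2 : ℕ) : ℝ) * h) - h^2 ≤ ψ (y + z) (((k+2 : ℕ) : ℝ) * h - h) := by
  wlog hrR : r ≤ R/2 generalizing r with H
  · obtain ⟨h, k, y, a1, a2, a3, a4, a5⟩ := H (R/2) (by linarith) le_rfl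
    push Not at hrR
    exact ⟨h, k, y, a1, by linarith, by linarith, by linarith, a5⟩
  set Q : Set (Euc (d+2) × ℝ) := closedBall x R ×ˢ Icc (t - R) (t + R) with hQ
  have hQc : IsCompact Q := (isCompact_closedBall x R).prod isCompact_Icc
  have hQp : ∀ q ∈ Q, 0 < q.2 := fun q hq => by have := hq.2.1; linarith
  set S := Q \ (ball x r ×ˢ Ioo (t - r) (t + r)) with hS
  have hSc : IsCompact S := hQc.diff (isOpen_ball.prod isOpen_Ioo)
  obtain ⟨m, η, hm, hη, H⟩ := sel_compact (V := V) (ψ := ψ) S hSc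
    (fun q hq => hc q (hQp q hq.1)) (fun q hq hacc => hpos q.1 q.2 (hQp q hq.1) (by
      rintro heq
      have h1 : q = (x, t) := heq
      refine hq.2 ?_
      rw [h1]
      exact ⟨mem_ball_self hr, by constructor <;> linarith⟩) hacc)
  have hcx := (hc (x, t) ht).eventually (gt_mem_nhds (show ψ x t < m/2 by rw [h0]; linarith))
  obtain ⟨ε, hε, hεb⟩ := Metric.eventually_nhds_iff.1 hcx
  set ε' := min (min ε r) (min (min η 1) (min (m/2) (t/4))) with hε'
  have hε'0 : 0 < ε' := by positivity
  obtain ⟨h, k₀, y₀, b1, b2, b3, b4, b5⟩ := ha ε' hε'0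
  have c1 : ε' ≤ ε := (min_le_left _ _).trans (min_le_left _ _)
  have c2 : ε' ≤ r := (min_le_left _ _).trans (min_le_right _ _)
  have c3 : ε' ≤ η := (min_le_right _ _).trans ((min_le_left _ _).trans (min_le_left _ _))
  have c4 : ε' ≤ 1 := (min_le_right _ _).trans ((min_le_left _ _).trans (min_le_right _ _))
  have c5 : ε' ≤ m/2 := (min_le_right _ _).trans ((min_le_right _ _).trans (min_le_left _ _))
  have c6 : ε' ≤ t/4 := (min_le_right _ _).trans ((min_le_right _ _).trans (min_le_right _ _))
  have hh2 : h^2 < m/2 := by nlinarith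
  set T : Set ℝ := {v | ∃ (k : ℕ) (y : Euc (d+2)), (y, (k:ℝ) * h) ∈ Q ∧ V h k y = 1 ∧
    v = ψ y ((k:ℝ) * h)} with hT
  have hTb : BddBelow T := by
    have : BddBelow ((fun q : Euc (d+2) × ℝ => ψ q.1 q.2) '' Q) :=
      hQc.bddBelow_image (fun q hq => (hc q (hQp q hq)).continuousWithinAt)
    obtain ⟨B, hB⟩ := this
    refine ⟨B, ?_⟩
    rintro v ⟨k, y, h1, -, rfl⟩
    exact hB ⟨_, h1, rfl⟩
  have hT0 : ψ y₀ ((k₀:ℝ) * h) ∈ T := by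
    refine ⟨k₀, y₀, ⟨?_, ?_⟩, b5, rfl⟩
    · rw [mem_closedBall]; simp only; linarith
    · have := abs_lt.1 b4
      constructor <;> simp only <;> linarith
  have hinf : sInf T < m/2 := by
    refine (csInf_le hTb hT0).trans_lt ?_
    refine hεb (y := (y₀, (k₀:ℝ) * h)) ?_
    rw [Prod.dist_eq, max_lt_iff]
    exact ⟨by simp only; linarith, by simp only [Real.dist_eq]; linarith⟩
  obtain ⟨v, ⟨k, y, d1, d2, rfl⟩, d3⟩ := exists_lt_of_csInf_lt ⟨_, hT0⟩
    (show sInf T < sInf T + h^2 by nlinarith)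
  have hN : (y, (k:ℝ) * h) ∈ ball x r ×ˢ Ioo (t - r) (t + r) := by
    by_contra hcon
    have := H h k y b1 (by linarith) ⟨d1, hcon⟩ d2
    linarith
  have n1 : ‖y - x‖ < r := by rw [← dist_eq_norm]; exact hN.1
  have n2 : t - r < (k:ℝ) * h := hN.2.1
  have n3 : (k:ℝ) * h < t + r := hN.2.2
  have hk2 : 2 ≤ k := by
    by_contra hcon
    have : (k:ℝ) ≤ 1 := by exact_mod_cast (by omega : k ≤ 1)
    nlinarith
  obtain ⟨k, rfl⟩ := Nat.exists_eq_add_of_le' hk2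
  refine ⟨h, k, y, b1, by linarith, n1, abs_lt.2 ⟨by linarith, by linarith⟩, d2, ?_⟩
  intro z hz hVz
  have e1 : (((k+2 : ℕ) : ℝ) * h - h) = ((k+1 : ℕ) : ℝ) * h := by push_cast; ring
  rw [e1]
  have e2 : ψ (y + z) (((k+1 : ℕ) : ℝ) * h) ∈ T := by
    refine ⟨k+1, y + z, ⟨?_, ?_⟩, hVz, rfl⟩
    · rw [mem_closedBall, dist_eq_norm]
      have : y + z - x = (y - x) + z := by abel
      simp only [this]
      have := norm_add_le (y - x) z
      linarith
    · rw [← e1]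
      constructor <;> simp only <;> linarith
  have := csInf_le hTb e2
  linarith
end sel

section key
variable {d : ℕ} {V : ℝ → ℕ → Euc (d+2) → ℝ}

lemma quartic (u z : Euc (d+2)) (ρ : ℝ) (hu : ‖u‖ ≤ ρ) (hz : ‖z‖ ≤ ρ) :
    ‖u + z‖^4 ≤ ‖u‖^4 + 4 * ‖u‖^2 * ⟪u, z⟫ + 11 * ρ^2 * ‖z‖^2 := by
  have h1 := norm_add_sq_real u z
  have h2 : ‖u + z‖^4 = (‖u‖^2 + 2 * ⟪u, z⟫ + ‖z‖^2)^2 := by rw [← h1]; ring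
  rw [h2]
  have h3 := abs_real_inner_le_norm u z
  have hu0 := norm_nonneg u
  have hz0 := norm_nonneg z
  have hu2 : ‖u‖^2 ≤ ρ^2 := pow_le_pow_left₀ hu0 hu 2
  have hz2 : ‖z‖^2 ≤ ρ^2 := pow_le_pow_left₀ hz0 hz 2
  have h4 : ⟪u, z⟫^2 ≤ ρ^2 * ‖z‖^2 := by
    rw [← sq_abs]
    calc |⟪u, z⟫|^2 ≤ (‖u‖ * ‖z‖)^2 := pow_le_pow_left₀ (abs_nonneg _) h3 2
      _ = ‖u‖^2 * ‖z‖^2 := by ring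
      _ ≤ _ := mul_le_mul_of_nonneg_right hu2 (by positivity)
  have h5 : ⟪u, z⟫ ≤ ρ^2 := by
    refine (le_abs_self _).trans (h3.trans ?_)
    nlinarith
  have h6 : ⟪u, z⟫ * ‖z‖^2 ≤ ρ^2 * ‖z‖^2 := mul_le_mul_of_nonneg_right h5 (by positivity)
  have h7 : ‖u‖^2 * ‖z‖^2 ≤ ρ^2 * ‖z‖^2 := mul_le_mul_of_nonneg_right hu2 (by positivity)
  have h8 : ‖z‖^2 * ‖z‖^2 ≤ ρ^2 * ‖z‖^2 := mul_le_mul_of_nonneg_right hz2 (by positivity)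
  nlinarith

set_option maxHeartbeats 800000 in
lemma key {φ : Euc (d+2) → ℝ → ℝ} (hφ : IsC2Test (d+2) φ) (x : Euc (d+2)) {t : ℝ} (ht : 0 < t)
    (ha : AccSet V x t) (hmin : ∀ y s, 0 < s → AccSet V y s → φ x t ≤ φ y s) (ε : ℝ) (hε : 0 < ε) :
    ∃ r0 : ℝ, 0 < r0 ∧ ∀ κ : ℝ, 0 < κ → ∃ (h : ℝ) (k : ℕ) (y q : Euc (d+2)), 0 < h ∧ h < κ ∧
      V h (k+2) y = 1 ∧ ‖q - spaceGrad (d+2) φ x t‖ < κ ∧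
      ∀ w, √h * ‖w‖ < r0 → V h (k+1) (y + √h • w) = 1 →
        √h * (timeDeriv (d+2) φ x t - ε - ((1/2) * ⟪spaceHess (d+2) φ x t w, w⟫ + ε * ‖w‖^2))
          ≤ ⟪q, w⟫ := by
  obtain ⟨r1, hr1, htay⟩ := taylor hφ x ht (ε/2) (by linarith)
  set r0 := min (min r1 (t/4)) (min 1 (ε/22)) with hr0
  have hr0p : 0 < r0 := by positivity
  have a1 : r0 ≤ r1 := (min_le_left _ _).trans (min_le_left _ _)
  have a2 : r0 ≤ t/4 := (min_le_left _ _).trans (min_le_right _ _)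
  have a3 : r0 ≤ 1 := (min_le_right _ _).trans (min_le_left _ _)
  have a4 : r0 ≤ ε/22 := (min_le_right _ _).trans (min_le_right _ _)
  refine ⟨r0, hr0p, fun κ hκ => ?_⟩
  have hg := (grad_cont hφ x ht).eventually (Metric.ball_mem_nhds _ (half_pos hκ))
  obtain ⟨r2, hr2, hgb⟩ := Metric.eventually_nhds_iff.1 hg
  set r := min (min r0 r2) (min (κ/8) (ε/8)) with hr
  have hrp : 0 < r := by positivity
  have b1 : r ≤ r0 := (min_le_left _ _).trans (min_le_left _ _)
  have b2 : r ≤ r2 := (min_le_left _ _).trans (min_le_right _ _)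
  have b3 : r ≤ κ/8 := (min_le_right _ _).trans (min_le_left _ _)
  have b4 : r ≤ ε/8 := (min_le_right _ _).trans (min_le_right _ _)
  set ψ : Euc (d+2) → ℝ → ℝ := fun y s => φ y s - φ x t + ‖y - x‖^4 + (s - t)^2 with hψ
  have hψc : ∀ q : Euc (d+2) × ℝ, 0 < q.2 →
      ContinuousAt (fun q : Euc (d+2) × ℝ => ψ q.1 q.2) q := by
    rintro ⟨y, s⟩ hq
    have h1 : ContinuousAt (STfun φ) (y, s) := (hasFDeriv_ST hφ (mem_STdom hq)).continuousAt
    have h2 : ContinuousAt (fun q : Euc (d+2) × ℝ => ‖q.1 - x‖^4) (y, s) := by fun_prop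
    have h3 : ContinuousAt (fun q : Euc (d+2) × ℝ => (q.2 - t)^2) (y, s) := by fun_prop
    exact ((h1.sub continuousAt_const).add h2).add h3
  obtain ⟨h, k, y, c1, c2, c3, c4, c5, c6⟩ := select (V := V) (ψ := ψ) (x := x) (t := t) ht hψc
    (by simp [hψ]) (fun y s hs hne hacc => by
      have h1 := hmin y s hs hacc
      have h2 : 0 < ‖y - x‖^4 + (s - t)^2 := by
        by_contra hcon
        have p1 : 0 ≤ ‖y - x‖^4 := by positivity
        have p2 : 0 ≤ (s - t)^2 := by positivity
        have p3 : ‖y - x‖^4 = 0 := by linarith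
        have p4 : (s - t)^2 = 0 := by linarith
        have p5 : y = x := by
          have := pow_eq_zero_iff (n := 4) (by norm_num) |>.1 p3
          rwa [norm_sub_eq_zero_iff] at this
        have p6 : s = t := by
          have := pow_eq_zero_iff (n := 2) (by norm_num) |>.1 p4
          linarith
        exact hne (by rw [p5, p6])
      simp only [hψ]; linarith) ha (R := t/2) (by linarith) (by linarith) r hrp
  set s := ((k+2 : ℕ) : ℝ) * h with hs
  set u := y - x with hu
  set q := spaceGrad (d+2) φ y s + (4 * ‖u‖^2) • u with hq
  refine ⟨h, k, y, q, c1, by linarith, c5, ?_, ?_⟩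
  · have h1 := hgb (y := (y, s)) (by
      rw [Prod.dist_eq, max_lt_iff]
      exact ⟨by rw [dist_eq_norm]; exact c3.trans_le b2, by rw [Real.dist_eq]; exact c4.trans_le b2⟩)
    rw [dist_eq_norm] at h1
    have h2 : q - spaceGrad (d+2) φ x t = (spaceGrad (d+2) φ y s - spaceGrad (d+2) φ x t)
      + (4 * ‖u‖^2) • u := by rw [hq]; abel
    rw [h2]
    refine (norm_add_le _ _).trans_lt ?_
    rw [norm_smul, Real.norm_of_nonneg (by positivity)]
    have h3 : ‖u‖ ≤ 1 := by linarith
    have h4 := norm_nonneg u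
    have h5 : ‖u‖^2 ≤ 1 := by nlinarith
    have h6 : 4 * ‖u‖^2 * ‖u‖ ≤ 4 * ‖u‖ := by nlinarith
    simp only at h1
    linarith
  · intro w hw hVw
    have hsq : 0 < √h := Real.sqrt_pos.2 c1
    have hss : √h * √h = h := Real.mul_self_sqrt c1.le
    set z := √h • w with hz
    have hzn : ‖z‖ = √h * ‖w‖ := by rw [hz, norm_smul, Real.norm_of_nonneg hsq.le]
    have hzr : ‖z‖ < r0 := by rw [hzn]; exact hw
    have e1 := c6 z (by linarith) hVw
    have e2 := htay y z s h (by linarith) (by linarith) (by linarith) c1 (by linarith)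
    have e3 := quartic u z r0 (by linarith) hzr.le
    have e4 : 11 * r0^2 * ‖z‖^2 ≤ ε/2 * ‖z‖^2 := by
      refine mul_le_mul_of_nonneg_right ?_ (by positivity)
      have := mul_le_of_le_one_right hr0p.le a3
      rw [sq]; linarith
    have e5 : y + z - x = u + z := by rw [hu]; abel
    simp only [hψ, e5] at e1
    have e6 : (s - h - t)^2 ≤ (s - t)^2 + 2 * r * h + h^2 := by
      have h1 := (abs_lt.1 c4).1
      have h2 : 0 ≤ (r + (s - t)) * h := mul_nonneg (by linarith) c1.le
      have h3 : (s - h - t)^2 = (s - t)^2 + 2 * r * h + h^2 - 2 * ((r + (s - t)) * h) := by ring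
      linarith
    have e7 : h^2 ≤ r * h := by
      rw [sq]; exact mul_le_mul_of_nonneg_right c2.le c1.le
    have e8 : r * h ≤ ε/8 * h := mul_le_mul_of_nonneg_right b4 c1.le
    have e9 : ⟪q, z⟫ = ⟪spaceGrad (d+2) φ y s, z⟫ + 4 * ‖u‖^2 * ⟪u, z⟫ := by
      rw [hq, inner_add_left, real_inner_smul_left]
    have e10 : 0 ≤ ⟪q, z⟫ + (1/2) * ⟪spaceHess (d+2) φ x t z, z⟫ + ε * ‖z‖^2
        - (timeDeriv (d+2) φ x t - ε) * h := by
      rw [e9]; linarith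
    rw [hzn, hz, map_smul, real_inner_smul_left, real_inner_smul_right,
      real_inner_smul_right] at e10
    have e12 : (timeDeriv (d+2) φ x t - ε) * h = √h * (√h * (timeDeriv (d+2) φ x t - ε)) := by
      rw [← mul_assoc, hss, mul_comm]
    rw [e12] at e10
    have e11 : √h * (√h * (timeDeriv (d+2) φ x t - ε -
        ((1/2) * ⟪spaceHess (d+2) φ x t w, w⟫ + ε * ‖w‖^2))) ≤ √h * ⟪q, w⟫ := by
      linarith
    exact le_of_mul_le_mul_left e11 hsq
end key

section nondeg
variable {d : ℕ} {α : ℝ} {V : ℝ → ℕ → Euc (d+2) → ℝ}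

lemma slice_int0 (hα : α ∈ Set.Ioo (1:ℝ) 2) (K : FracKernel (d+2) α) :
    Integrable (fun w : Euc (d+1) => K.P (pad d w)) := by
  have := slice_int hα K (fun _ => 1) (by fun_prop) 1 (fun w => by
    have := norm_nonneg w
    rw [abs_one]; nlinarith)
  simpa using this

lemma slice_int2 (hα : α ∈ Set.Ioo (1:ℝ) 2) (K : FracKernel (d+2) α) :
    Integrable (fun w : Euc (d+1) => ‖w‖^2 * K.P (pad d w)) :=
  slice_int hα K (fun w => ‖w‖^2) (by fun_prop) 1 (fun w => by
    have := norm_nonneg w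
    rw [abs_of_nonneg (by positivity)]; nlinarith)

lemma slice_pos (hα : α ∈ Set.Ioo (1:ℝ) 2) (K : FracKernel (d+2) α) :
    0 < ∫ w : Euc (d+1), K.P (pad d w) := by
  rw [integral_pos_iff_support_of_nonneg (fun w => (K.P_pos _).le) (slice_int0 hα K)]
  have : Function.support (fun w : Euc (d+1) => K.P (pad d w)) = Set.univ := by
    ext w; simp [(K.P_pos (pad d w)).ne']
  rw [this]
  simp

set_option maxHeartbeats 800000 in
lemma nondeg (hα : α ∈ Set.Ioo (1:ℝ) 2) {K : FracKernel (d+2) α} (hV : Thr K V)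
    {φ : Euc (d+2) → ℝ → ℝ} (hφ : IsC2Test (d+2) φ) (x : Euc (d+2)) {t : ℝ} (ht : 0 < t)
    (ha : AccSet V x t) (hmin : ∀ y s, 0 < s → AccSet V y s → φ x t ≤ φ y s)
    (hg : spaceGrad (d+2) φ x t ≠ 0) :
    timeDeriv (d+2) φ x t ≤ mcfRHS (d+2) (mcfC d α K) φ x t := by
  by_contra hcon
  push Not at hcon
  set g := spaceGrad (d+2) φ x t with hgdef
  set A := spaceHess (d+2) φ x t with hA
  set b := timeDeriv (d+2) φ x t with hb
  set e := ‖g‖⁻¹ • g with he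
  have hg0 : 0 < ‖g‖ := norm_pos_iff.2 hg
  have he1 : ‖e‖ = 1 := by
    rw [he, norm_smul, norm_inv, norm_norm, inv_mul_cancel₀ hg0.ne']
  have hge : g = ‖g‖ • e := by rw [he, smul_smul, mul_inv_cancel₀ hg0.ne', one_smul]
  obtain ⟨L, hL⟩ := exists_rot e he1
  set m0 := ∫ w : Euc (d+1), K.P (pad d w) with hm0
  set m2 := ∫ w : Euc (d+1), (w 0)^2 * K.P (pad d w) with hm2
  set mn := ∫ w : Euc (d+1), ‖w‖^2 * K.P (pad d w) with hmn
  have hm0p : 0 < m0 := slice_pos hα K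
  have hmnp : 0 ≤ mn := integral_nonneg fun w => mul_nonneg (by positivity) (K.P_pos _).le
  set T := LinearMap.trace ℝ (Euc (d+2)) (A : Euc (d+2) →ₗ[ℝ] Euc (d+2)) - ⟪A e, e⟫ with hT
  have hrhs : mcfRHS (d+2) (mcfC d α K) φ x t = m2 * (2 * m0)⁻¹ * T := rfl
  rw [hrhs] at hcon
  have hD : 0 < b * m0 - 1/2 * (T * m2) := by
    have h1 : m2 * (2 * m0)⁻¹ * T * m0 < b * m0 := mul_lt_mul_of_pos_right hcon hm0p
    have h2 : m2 * (2 * m0)⁻¹ * T * m0 = 1/2 * (T * m2) := by field_simp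
    linarith
  set D := b * m0 - 1/2 * (T * m2) with hDdef
  set ε := D / (2 * (m0 + mn)) with hεdef
  have hε : 0 < ε := by positivity
  have hεm : ε * (m0 + mn) = D / 2 := by rw [hεdef]; field_simp
  have iA : Integrable (fun w : Euc (d+1) => ⟪A (L (pad d w)), L (pad d w)⟫ * K.P (pad d w)) := by
    refine slice_int hα K (fun w => ⟪A (L (pad d w)), L (pad d w)⟫) ?_ ‖A‖ fun w => ?_
    · have := pad_cont (d := d)
      fun_prop
    · refine (abs_real_inner_le_norm _ _).trans ?_
      have h1 := A.le_opNorm (L (pad d w))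
      rw [L.norm_map, norm_pad] at h1 ⊢
      have h2 := norm_nonneg w
      have h3 := norm_nonneg A
      have h4 := mul_le_mul_of_nonneg_right h1 h2
      have h5 : 0 ≤ ‖A‖ * (1 + 2 * ‖w‖) := by positivity
      have h6 : ‖A‖ * (1 + ‖w‖)^2 = ‖A‖ * ‖w‖ * ‖w‖ + ‖A‖ * (1 + 2 * ‖w‖) := by ring
      linarith
  have hI : 0 < ∫ w, K.P (pad d w) * ((b - ε) -
      ((1/2) * ⟪A (L (pad d w)), L (pad d w)⟫ + ε * ‖L (pad d w)‖^2)) := by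
    have h1 : ∀ w : Euc (d+1), K.P (pad d w) * ((b - ε) -
      ((1/2) * ⟪A (L (pad d w)), L (pad d w)⟫ + ε * ‖L (pad d w)‖^2)) =
      (b - ε) * K.P (pad d w) - ((1/2) * (⟪A (L (pad d w)), L (pad d w)⟫ * K.P (pad d w))
        + ε * (‖w‖^2 * K.P (pad d w))) := by
      intro w; rw [L.norm_map, norm_pad]; ring
    simp only [h1]
    have i1 := (slice_int0 hα K).const_mul (b - ε)
    have i2 := iA.const_mul (1/2)
    have i3 := (slice_int2 hα K).const_mul ε
    have i4 : Integrable (fun w : Euc (d+1) => (1/2) * (⟪A (L (pad d w)), L (pad d w)⟫ *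
        K.P (pad d w)) + ε * (‖w‖^2 * K.P (pad d w))) := i2.add i3
    rw [integral_sub i1 i4, integral_add i2 i3, integral_const_mul, integral_const_mul,
      integral_const_mul, trace_int hα K A e L hL]
    change 0 < (b - ε) * m0 - (1/2 * (T * m2) + ε * mn)
    have : (b - ε) * m0 - (1/2 * (T * m2) + ε * mn) = D - ε * (m0 + mn) := by rw [hDdef]; ring
    rw [this, hεm]; linarith
  set C := 1/2 * ‖A‖ + ε with hC
  have hCp : 0 < C := by positivity
  obtain ⟨r0, hr0, hkey⟩ := key hφ x ht ha hmin ε hε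
  set ρ := min (1 / (8 * C)) (r0 / (4 * ‖g‖)) with hρdef
  have hρ : 0 < ρ := by positivity
  have hρC : 8 * C * ρ ≤ 1 := by
    have h1 : ρ ≤ 1 / (8 * C) := min_le_left _ _
    rw [le_div_iff₀ (by positivity)] at h1; linarith
  have hρg : ρ * (4 * ‖g‖) ≤ r0 := by
    have h1 : ρ ≤ r0 / (4 * ‖g‖) := min_le_right _ _
    rwa [le_div_iff₀ (by positivity)] at h1
  have hQc : Continuous (fun w : Euc (d+2) => (1/2) * ⟪A w, w⟫ + ε * ‖w‖^2) := by fun_prop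
  obtain ⟨δ, hδ, hcore⟩ := core_rot hα K (fun w => (1/2) * ⟪A w, w⟫ + ε * ‖w‖^2)
    hQc C hCp (fun w => by
      have h1 := (abs_real_inner_le_norm (A w) w).trans
        (mul_le_mul_of_nonneg_right (A.le_opNorm w) (norm_nonneg w))
      have h2 := abs_le.1 h1
      have h3 : 0 ≤ ε * ‖w‖^2 := by positivity
      rw [hC, abs_le]
      have h4 : ‖A‖ * ‖w‖ * ‖w‖ = ‖A‖ * ‖w‖^2 := by ring
      rw [h4] at h2
      have h5 : (1/2 * ‖A‖ + ε) * ‖w‖^2 = 1/2 * (‖A‖ * ‖w‖^2) + ε * ‖w‖^2 := by ring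
      rw [h5]
      constructor <;> linarith [h2.1, h2.2]) (b - ε) ρ hρ hρC e L hL hI
  set κ := min (min (‖g‖/2) (δ * ‖g‖ / 8)) ((δ * ‖g‖ / 2)^2) with hκdef
  have hκ : 0 < κ := by positivity
  have k1 : κ ≤ ‖g‖/2 := (min_le_left _ _).trans (min_le_left _ _)
  have k2 : κ ≤ δ * ‖g‖ / 8 := (min_le_left _ _).trans (min_le_right _ _)
  have k3 : κ ≤ (δ * ‖g‖ / 2)^2 := min_le_right _ _
  obtain ⟨h, k, y, q, a1, a2, a3, a4, a5⟩ := hkey κ hκ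
  have hsq : 0 < √h := Real.sqrt_pos.2 a1
  set c := ⟪q, e⟫ with hc
  have hcg : |c - ‖g‖| ≤ ‖q - g‖ := by
    have h1 : c - ‖g‖ = ⟪q - g, e⟫ := by
      rw [inner_sub_left, hc]
      congr 1
      conv_rhs => rw [hge]
      rw [real_inner_smul_left, real_inner_self_eq_norm_sq, he1]; ring
    rw [h1]
    have := abs_real_inner_le_norm (q - g) e
    rwa [he1, mul_one] at this
  have hcg2 := abs_le.1 hcg
  have hclow : ‖g‖/2 ≤ c := by linarith
  have hcup : c ≤ 2 * ‖g‖ := by linarith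
  have hcp : 0 < c := by linarith
  have hl : √h / c < δ := by
    rw [div_lt_iff₀ hcp]
    have h1 : √h < δ * ‖g‖ / 2 := by
      rw [Real.sqrt_lt' (by positivity)]; linarith
    have h2 : δ * (‖g‖/2) ≤ δ * c := mul_le_mul_of_nonneg_left hclow hδ.le
    linarith
  have hve : ⟪c⁻¹ • q, e⟫ = 1 := by
    rw [real_inner_smul_left, ← hc, inv_mul_cancel₀ hcp.ne']
  have hvd : ‖c⁻¹ • q - e‖ < δ := by
    have h1 : c⁻¹ • q - e = c⁻¹ • ((q - g) + (‖g‖ - c) • e) := by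
      have h2 : (q - g) + (‖g‖ - c) • e = q - c • e := by
        rw [sub_smul, ← hge]; abel
      rw [h2, smul_sub, smul_smul, inv_mul_cancel₀ hcp.ne', one_smul]
    rw [h1, norm_smul, norm_inv, Real.norm_of_nonneg hcp.le, inv_mul_lt_iff₀ hcp]
    refine (norm_add_le _ _).trans_lt ?_
    rw [norm_smul, he1, mul_one, Real.norm_eq_abs, abs_sub_comm]
    have h3 : δ * (‖g‖/2) ≤ δ * c := mul_le_mul_of_nonneg_left hclow hδ.le
    have h4 : 0 < δ * ‖g‖ := by positivity
    linarith
  have hlt := hcore (√h / c) (by positivity) hl (c⁻¹ • q) hve hvd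
  have hge := one_step hV a1 a3 (fun w => ρ / (√h / c) < ‖w‖ ∨
    √h / c * (b - ε - ((1/2) * ⟪A w, w⟫ + ε * ‖w‖^2)) ≤ ⟪c⁻¹ • q, w⟫) ?_ ?_
  · exact absurd hlt (not_lt.2 hge)
  · have s1 : MeasurableSet {w : Euc (d+2) | ρ / (√h / c) < ‖w‖} :=
      measurableSet_lt measurable_const measurable_norm
    have s2 : MeasurableSet {w : Euc (d+2) |
        √h / c * (b - ε - ((1/2) * ⟪A w, w⟫ + ε * ‖w‖^2)) ≤ ⟪c⁻¹ • q, w⟫} :=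
      measurableSet_le ((continuous_const.sub hQc).measurable.const_mul _)
        (Continuous.inner continuous_const continuous_id).measurable
    exact s1.union s2
  · intro w hw
    by_cases hwn : ρ / (√h / c) < ‖w‖
    · exact Or.inl hwn
    · right
      push Not at hwn
      rw [div_div_eq_mul_div, le_div_iff₀ hsq] at hwn
      have h1 : ρ * c ≤ ρ * (2 * ‖g‖) := mul_le_mul_of_nonneg_left hcup hρ.le
      have h2 := a5 w (by linarith) hw
      rw [real_inner_smul_left, div_mul_eq_mul_div, inv_mul_eq_div]
      exact div_le_div_of_nonneg_right h2 hcp.le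
end nondeg

section deg
variable {d : ℕ} {α : ℝ} {V : ℝ → ℕ → Euc (d+2) → ℝ}

lemma meas_far (M : ℝ) : MeasurableSet {w : Euc (d+2) | M < ‖w‖} :=
  measurableSet_lt measurable_const measurable_norm

lemma ball_mass (K : FracKernel (d+2) α) (η : ℝ) (hη : 0 < η) :
    0 < ∫ w : Euc (d+2), ind (‖w‖ < η) * K.P w := by
  have hm : MeasurableSet {w : Euc (d+2) | ‖w‖ < η} :=
    measurableSet_lt measurable_norm measurable_const
  rw [integral_pos_iff_support_of_nonneg (fun w => mul_nonneg (ind_nonneg _) (K.P_pos _).le)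
    (ind_P_int K hm)]
  refine lt_of_lt_of_le (Metric.measure_ball_pos volume (0 : Euc (d+2)) hη) (measure_mono ?_)
  intro w hw
  rw [mem_ball_zero_iff] at hw
  simp [ind_true hw, (K.P_pos w).ne']

lemma small_tail (hα : α ∈ Set.Ioo (1:ℝ) 2) (K : FracKernel (d+2) α) (β : ℝ) (hβ : 0 < β) :
    ∃ M : ℝ, 0 < M ∧ ∫ w : Euc (d+2), ind (M < ‖w‖) * K.P w < β := by
  have h1 := (tail_tendsto hα K 1 one_pos).eventually (gt_mem_nhds hβ)
  have h2 : ∀ᶠ l : ℝ in 𝓝[>] 0, l ∈ Ioo (0:ℝ) 1 := Ioo_mem_nhdsGT one_pos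
  obtain ⟨l, hl1, hl0, hl2⟩ := (h1.and h2).exists
  refine ⟨1/l, by positivity, lt_of_le_of_lt ?_ hl1⟩
  have hi : Integrable (fun w : Euc (d+2) => ind (1/l < ‖w‖) * (‖w‖ * K.P w)) := by
    refine (K_int_norm hα K).mono' ((meas_ind (meas_far _)).mul
      (measurable_norm.mul K.P_cont.measurable)).aestronglyMeasurable
      (Eventually.of_forall fun w => ?_)
    have h0 : 0 ≤ ‖w‖ * K.P w := mul_nonneg (norm_nonneg _) (K.P_pos w).le
    rw [norm_mul, Real.norm_of_nonneg h0]
    exact mul_le_of_le_one_left h0 (norm_ind_le _)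
  refine integral_mono (ind_P_int K (meas_far _)) hi fun w => ?_
  by_cases h : 1/l < ‖w‖
  · simp only [ind_true h, one_mul]
    have h3 : 1 ≤ ‖w‖ := by
      refine le_trans ?_ h.le
      rw [le_div_iff₀ hl0]; linarith
    exact le_mul_of_one_le_left (K.P_pos w).le h3
  · simp only [ind_false h, zero_mul]; exact le_rfl

lemma slab_bound (K : FracKernel (d+2) α) (v : Euc (d+2)) (δ b M : ℝ) (hδ : 0 < δ) (hb : 0 < b)
    (hv : ‖v‖ * δ ≤ 1)
    (hM : ∫ w : Euc (d+2), ind (M < ‖w‖) * K.P w <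
      (∫ w : Euc (d+2), ind (‖w‖ < δ * b) * K.P w) / 2) :
    ∫ w : Euc (d+2), ind (M < ‖w‖ ∨ b < ⟪v, w⟫) * K.P w < 1/2 := by
  have hs := half_slab K v b hb.le
  have m1 : MeasurableSet {w : Euc (d+2) | ‖w‖ < δ * b} :=
    measurableSet_lt measurable_norm measurable_const
  have m2 : MeasurableSet {w : Euc (d+2) | |⟪v, w⟫| < b} :=
    measurableSet_lt (by fun_prop) (by fun_prop)
  have m3 : MeasurableSet {w : Euc (d+2) | b < ⟪v, w⟫} :=
    measurableSet_lt (by fun_prop) (by fun_prop)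
  have m4 : MeasurableSet {w : Euc (d+2) | M < ‖w‖ ∨ b < ⟪v, w⟫} := (meas_far M).union m3
  have h1 : ∫ w : Euc (d+2), ind (‖w‖ < δ * b) * K.P w ≤ ∫ w, ind (|⟪v, w⟫| < b) * K.P w := by
    refine integral_mono (ind_P_int K m1) (ind_P_int K m2) fun w => ?_
    refine mul_le_mul_of_nonneg_right ?_ (K.P_pos w).le
    by_cases h : ‖w‖ < δ * b
    · have h2 : |⟪v, w⟫| < b := by
        refine (abs_real_inner_le_norm v w).trans_lt ?_
        rcases (norm_nonneg v).eq_or_lt with h3 | h3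
        · rw [← h3, zero_mul]; exact hb
        · calc ‖v‖ * ‖w‖ < ‖v‖ * (δ * b) := mul_lt_mul_of_pos_left h h3
            _ = (‖v‖ * δ) * b := by ring
            _ ≤ 1 * b := mul_le_mul_of_nonneg_right hv hb.le
            _ = b := one_mul b
      rw [ind_true h2]; exact ind_le_one _
    · rw [ind_false h]; exact ind_nonneg _
  have h2 : ∫ w : Euc (d+2), ind (M < ‖w‖ ∨ b < ⟪v, w⟫) * K.P w ≤
      ∫ w : Euc (d+2), (ind (M < ‖w‖) * K.P w + ind (b < ⟪v, w⟫) * K.P w) := by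
    refine integral_mono (ind_P_int K m4) ((ind_P_int K (meas_far M)).add (ind_P_int K m3))
      fun w => ?_
    have h3 := ind_nonneg (M < ‖w‖)
    have h4 := ind_nonneg (b < ⟪v, w⟫)
    have h5 : ind (M < ‖w‖ ∨ b < ⟪v, w⟫) ≤ ind (M < ‖w‖) + ind (b < ⟪v, w⟫) := by
      by_cases h : M < ‖w‖ ∨ b < ⟪v, w⟫
      · rw [ind_true h]
        rcases h with h | h
        · rw [ind_true h]; linarith
        · rw [ind_true h]; linarith
      · rw [ind_false h]; linarith
    have := mul_le_mul_of_nonneg_right h5 (K.P_pos w).le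
    simp only
    linarith
  rw [integral_add (ind_P_int K (meas_far M)) (ind_P_int K m3)] at h2
  linarith

set_option maxHeartbeats 800000 in
lemma deg (hα : α ∈ Set.Ioo (1:ℝ) 2) {K : FracKernel (d+2) α} (hV : Thr K V)
    {φ : Euc (d+2) → ℝ → ℝ} (hφ : IsC2Test (d+2) φ) (x : Euc (d+2)) {t : ℝ} (ht : 0 < t)
    (ha : AccSet V x t) (hmin : ∀ y s, 0 < s → AccSet V y s → φ x t ≤ φ y s)
    (hg : spaceGrad (d+2) φ x t = 0) (hH : spaceHess (d+2) φ x t = 0) :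
    timeDeriv (d+2) φ x t ≤ 0 := by
  by_contra hcon
  push Not at hcon
  set b := timeDeriv (d+2) φ x t with hb
  set m0 := ∫ w : Euc (d+1), K.P (pad d w) with hm0
  set mn := ∫ w : Euc (d+1), ‖w‖^2 * K.P (pad d w) with hmn
  have hm0p : 0 < m0 := slice_pos hα K
  have hmnp : 0 ≤ mn := integral_nonneg fun w => mul_nonneg (by positivity) (K.P_pos _).le
  set ε := b * m0 / (2 * (m0 + mn)) with hεdef
  have hε : 0 < ε := by positivity
  have hεm : ε * (m0 + mn) = b * m0 / 2 := by rw [hεdef]; field_simp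
  have hI : 0 < ∫ w, K.P (pad d w) * ((b - ε) - ε * ‖w‖^2) := by
    have h1 : ∀ w : Euc (d+1), K.P (pad d w) * ((b - ε) - ε * ‖w‖^2) =
      (b - ε) * K.P (pad d w) - ε * (‖w‖^2 * K.P (pad d w)) := by
      intro w; ring
    simp only [h1]
    rw [integral_sub ((slice_int0 hα K).const_mul (b - ε)) ((slice_int2 hα K).const_mul ε),
      integral_const_mul, integral_const_mul]
    change 0 < (b - ε) * m0 - ε * mn
    have h2 : (b - ε) * m0 - ε * mn = b * m0 - ε * (m0 + mn) := by ring
    have h3 : 0 < b * m0 := by positivity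
    rw [h2, hεm]; linarith
  set ρ := 1 / (8 * ε) with hρdef
  have hρ : 0 < ρ := by positivity
  obtain ⟨δ, hδ, hcore⟩ := core_deg hα K ε hε (b - ε) ρ hρ
    (by rw [hρdef]; field_simp; exact le_rfl) hI
  have hβ := ball_mass K (δ * (b/4)) (by positivity)
  obtain ⟨M, hM, hMt⟩ := small_tail hα K _ (half_pos hβ)
  set ε' := min ε (b / (2 * (1 + M^2))) with hε'def
  have hε' : 0 < ε' := by positivity
  have hε'1 : ε' ≤ ε := min_le_left _ _
  have hε'2 : ε' * (2 * (1 + M^2)) ≤ b := by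
    have h1 : ε' ≤ b / (2 * (1 + M^2)) := min_le_right _ _
    rwa [le_div_iff₀ (by positivity)] at h1
  obtain ⟨r0, hr0, hkey⟩ := key hφ x ht ha hmin ε' hε'
  set κ := min (r0 / ρ) ((r0 / M)^2) with hκdef
  have hκ : 0 < κ := by positivity
  obtain ⟨h, k, y, q, a1, a2, a3, a4, a5⟩ := hkey κ hκ
  rw [hg, sub_zero] at a4
  rw [hH] at a5
  have hsq : 0 < √h := Real.sqrt_pos.2 a1
  have k1 : ‖q‖ * ρ < r0 := by
    have := a4.trans_le (min_le_left _ _)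
    rwa [lt_div_iff₀ hρ] at this
  have k2 : √h * M < r0 := by
    have h1 : √h < r0 / M := by
      rw [Real.sqrt_lt' (by positivity)]; exact a2.trans_le (min_le_right _ _)
    rwa [lt_div_iff₀ hM] at h1
  have a6 : ∀ w, √h * ‖w‖ < r0 → V h (k+1) (y + √h • w) = 1 →
      √h * (b - ε' - ε' * ‖w‖^2) ≤ ⟪q, w⟫ := by
    intro w h1 h2
    have h3 := a5 w h1 h2
    simpa using h3
  by_cases hreg : ‖q‖ * δ ≤ √h
  · have hlt := slab_bound K ((√h)⁻¹ • q) δ (b/4) M hδ (by positivity) (by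
      rw [norm_smul, norm_inv, Real.norm_of_nonneg hsq.le, mul_assoc, inv_mul_le_iff₀ hsq, mul_one]
      exact hreg) hMt
    have m3 : MeasurableSet {w : Euc (d+2) | b/4 < ⟪(√h)⁻¹ • q, w⟫} :=
      measurableSet_lt (by fun_prop) (by fun_prop)
    have hge := one_step hV a1 a3 (fun w => M < ‖w‖ ∨ b/4 < ⟪(√h)⁻¹ • q, w⟫)
      ((meas_far M).union m3) ?_
    · exact absurd hlt (not_lt.2 hge)
    · intro w hw
      by_cases hwn : M < ‖w‖
      · exact Or.inl hwn
      · right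
        push Not at hwn
        have h1 : √h * ‖w‖ ≤ √h * M := mul_le_mul_of_nonneg_left hwn hsq.le
        have h2 := a6 w (by linarith) hw
        have h3 : ‖w‖^2 ≤ M^2 := pow_le_pow_left₀ (norm_nonneg w) hwn 2
        have h4 : ε' * ‖w‖^2 ≤ ε' * M^2 := mul_le_mul_of_nonneg_left h3 hε'.le
        have h5 : b/4 < b - ε' - ε' * ‖w‖^2 := by linarith
        rw [real_inner_smul_left, lt_inv_mul_iff₀ hsq]
        exact (mul_lt_mul_of_pos_left h5 hsq).trans_le h2
  · push Not at hreg
    have hq : 0 < ‖q‖ := by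
      rcases (norm_nonneg q).eq_or_lt with h3 | h3
      · rw [← h3, zero_mul] at hreg; linarith
      · exact h3
    have hlt := hcore (√h / ‖q‖) (by positivity) (by rw [div_lt_iff₀ hq]; linarith)
      (‖q‖⁻¹ • q) (by rw [norm_smul, norm_inv, norm_norm, inv_mul_cancel₀ hq.ne'])
    have m3 : MeasurableSet {w : Euc (d+2) |
        √h / ‖q‖ * (b - ε - ε * ‖w‖^2) ≤ ⟪‖q‖⁻¹ • q, w⟫} :=
      measurableSet_le (by fun_prop) (by fun_prop)
    have hge := one_step hV a1 a3 (fun w => ρ / (√h / ‖q‖) < ‖w‖ ∨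
      √h / ‖q‖ * (b - ε - ε * ‖w‖^2) ≤ ⟪‖q‖⁻¹ • q, w⟫) ((meas_far _).union m3) ?_
    · exact absurd hlt (not_lt.2 hge)
    · intro w hw
      by_cases hwn : ρ / (√h / ‖q‖) < ‖w‖
      · exact Or.inl hwn
      · right
        push Not at hwn
        rw [div_div_eq_mul_div, le_div_iff₀ hsq] at hwn
        have h2 := a6 w (by linarith) hw
        have h4 : ε' * ‖w‖^2 ≤ ε * ‖w‖^2 := mul_le_mul_of_nonneg_right hε'1 (by positivity)
        have h5 : √h * (b - ε - ε * ‖w‖^2) ≤ ⟪q, w⟫ :=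
          (mul_le_mul_of_nonneg_left (by linarith) hsq.le).trans h2
        rw [real_inner_smul_left, div_mul_eq_mul_div, inv_mul_eq_div]
        exact div_le_div_of_nonneg_right h5 hq.le
end deg

section fin
variable {d : ℕ} {α : ℝ} {V : ℝ → ℕ → Euc (d+2) → ℝ}

lemma sub_of_thr (hα : α ∈ Set.Ioo (1:ℝ) 2) {K : FracKernel (d+2) α} (hV : Thr K V) :
    IsMCFSubsolution (d+2) (mcfC d α K) (fun x t => limsupStar (d+2) V x t) := by
  refine ⟨limsup_usc hV, limsup_locb hV, fun φ hφ x t ht hmax => ?_⟩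
  by_cases ha : AccSet V x t
  · have hmin : ∀ y s, 0 < s → AccSet V y s → φ x t ≤ φ y s := by
      intro y s hs hys
      have := hmax y s hs
      simp only [limsup_acc hV ha, limsup_acc hV hys] at this
      linarith
    exact ⟨nondeg hα hV hφ x ht ha hmin, deg hα hV hφ x ht ha hmin⟩
  · have hmin : ∀ y s, 0 < s → φ x t ≤ φ y s := by
      intro y s hs
      have h1 := hmax y s hs
      simp only [limsup_nacc hV ht ha] at h1
      have := (limsup_bd hV y s).1
      linarith
    have hg : spaceGrad (d+2) φ x t = 0 := by
      have h1 : IsLocalMin (fun y => φ y t) x := Eventually.of_forall fun y => hmin y t ht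
      have h2 := h1.hasFDerivAt_eq_zero (hasFDeriv_space' hφ x ht)
      have h3 := congrArg (fun T => T (spaceGrad (d+2) φ x t)) h2
      simpa [innerSL_apply_apply] using h3
    have ht0 : timeDeriv (d+2) φ x t = 0 := by
      have h1 : IsLocalMin (fun s => φ x s) t := by
        filter_upwards [lt_mem_nhds ht] with s hs
        exact hmin x s hs
      exact h1.deriv_eq_zero
    exact ⟨fun h => absurd hg h, fun _ _ => ht0.le⟩

lemma spaceGrad_neg (n : ℕ) (φ : Euc n → ℝ → ℝ) (x : Euc n) (t : ℝ) :
    spaceGrad n (fun y s => - φ y s) x t = - spaceGrad n φ x t := by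
  unfold spaceGrad gradient
  rw [fderiv_fun_neg, map_neg]

lemma spaceHess_neg (n : ℕ) (φ : Euc n → ℝ → ℝ) (x : Euc n) (t : ℝ) :
    spaceHess n (fun y s => - φ y s) x t = - spaceHess n φ x t := by
  unfold spaceHess
  simp only [spaceGrad_neg]
  rw [fderiv_fun_neg]

lemma timeDeriv_neg (n : ℕ) (φ : Euc n → ℝ → ℝ) (x : Euc n) (t : ℝ) :
    timeDeriv n (fun y s => - φ y s) x t = - timeDeriv n φ x t := by
  unfold timeDeriv
  exact deriv.fun_neg

lemma mcfRHS_neg (n : ℕ) (C : ℝ) (φ : Euc n → ℝ → ℝ) (x : Euc n) (t : ℝ) :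
    mcfRHS n C (fun y s => - φ y s) x t = - mcfRHS n C φ x t := by
  unfold mcfRHS
  rw [spaceGrad_neg, spaceHess_neg, norm_neg, smul_neg, map_neg, inner_neg_right,
    ContinuousLinearMap.neg_apply, inner_neg_left, neg_neg, inner_neg_left, ContinuousLinearMap.toLinearMap_neg, map_neg]
  ring

lemma super_of_sub {C : ℝ} {n : ℕ} {W : Euc n → ℝ → ℝ} (h : IsMCFSubsolution n C W) :
    IsMCFSupersolution n C (fun x t => - W x t) := by
  obtain ⟨h1, h2, h3⟩ := h
  refine ⟨?_, ?_, ?_⟩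
  · intro q hq c hc
    have hc2 : W q.1 q.2 < -c := by simp only at hc; linarith
    filter_upwards [h1 q hq (-c) hc2] with q' hq'
    linarith
  · intro S hS
    obtain ⟨M, hM⟩ := h2 S hS
    exact ⟨M, fun q hq => by simpa using hM q hq⟩
  · intro φ hφ x t ht hmin
    have hφn : IsC2Test n (fun y s => - φ y s) := ContDiffOn.neg hφ
    have h4 := h3 (fun y s => - φ y s) hφn x t ht (fun y s hs => by
      have := hmin y s hs
      linarith)
    rw [spaceGrad_neg, spaceHess_neg, timeDeriv_neg, mcfRHS_neg, neg_eq_zero, neg_eq_zero,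
      Ne, neg_eq_zero] at h4
    exact ⟨fun h => by linarith [h4.1 h], fun h h' => by linarith [h4.2 h h']⟩
end fin

/-- The half-relaxed limits of the threshold dynamics iterates are viscosity
sub/supersolutions of the weighted mean curvature equation (`α ∈ (1,2)`). -/
theorem half_relaxed_limits_mcf_sub_super
    (d : ℕ) (α : ℝ) (hα : α ∈ Set.Ioo (1:ℝ) 2)
    (K : FracKernel (d+2) α)
    (σ : ℝ → ℝ) (hσ : ∀ h : ℝ, 0 < h → σ h = h ^ (α / 2))
    (Ω₀ : Set (Euc (d+2))) (hΩ₀ : IsOpen Ω₀)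
    (hfront : frontier Ω₀ = frontier ((closure Ω₀)ᶜ))
    (U : ℝ → ℕ → Euc (d+2) → ℝ)
    (hU : IsThresholdDynamics (d+2) K.p σ Ω₀ U)
    :
    IsMCFSubsolution (d+2) (mcfC d α K) (fun x t => limsupStar (d+2) U x t) ∧
    IsMCFSupersolution (d+2) (mcfC d α K) (fun x t => liminfStar (d+2) U x t) := by
  obtain ⟨h1, h2⟩ := thr_of_dyn hα K σ hσ Ω₀ hΩ₀ U hU
  refine ⟨sub_of_thr hα h1, ?_⟩
  simp only [liminf_eq]
  exact super_of_sub (sub_of_thr hα h2)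

end
end

section
/- Let N ≥ 2 and α ∈ (0,1). Let P : ℝ^N → [0,∞) be continuous with P(x) ≤ C₀(1+|x|^{N+α})^{-1} for some C₀ > 0 and all x. Let A be a real symmetric N×N matrix and a ∈ ℝ. Then lim_{σ→0⁺} σ^{-1} ∫_{ℝ^N} [1^+(y₁ + σ^{1/α} ⟨Ay, y⟩ − a σ) − 1^+(y₁ + σ^{1/α} ⟨Ay, y⟩)] P(y) dy = −a ∫_{ℝ^{N-1}} P(0, y') dy', where y = (y₁, y') ∈ ℝ × ℝ^{N-1} and 1^+ is the indicator of [0,∞). -/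
open MeasureTheory Filter Metric Set
open scoped Topology RealInnerProductSpace ENNReal NNReal

noncomputable section

/-- difference of thresholds -/
def tsD (a s : ℝ) : ℝ := indPlus (s - a) - indPlus s

lemma ts_indPlus_meas : Measurable indPlus := by
  unfold indPlus
  exact Measurable.ite measurableSet_Ici measurable_const measurable_const

lemma tsD_meas (a : ℝ) : Measurable (tsD a) := by
  unfold tsD
  exact (ts_indPlus_meas.comp (measurable_id.sub_const a)).sub ts_indPlus_meas

lemma tsD_abs_le (a s : ℝ) : |tsD a s| ≤ 1 := by
  unfold tsD indPlus
  split_ifs <;> norm_num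

lemma tsD_ne (a s : ℝ) (h : tsD a s ≠ 0) : |s| ≤ |a| ∧ |s - a| ≤ |a| := by
  unfold tsD indPlus at h
  split_ifs at h with h1 h2 h2
  · simp at h
  · have : a ≤ s := by linarith
    rw [abs_of_neg (by linarith : s < 0), abs_of_neg (by linarith : a < 0), abs_of_nonneg h1]
    constructor <;> linarith
  · push Not at h1
    rw [abs_of_nonneg h2, abs_of_pos (by linarith : 0 < a), abs_of_neg h1]
    constructor <;> linarith
  · simp at h

lemma ts_indPlus_mul (c s : ℝ) (hc : 0 < c) : indPlus (c * s) = indPlus s := by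
  unfold indPlus
  simp only [mul_nonneg_iff_of_pos_left hc]

lemma tsD_mul (a c s : ℝ) (hc : 0 < c) : tsD (c * a) (c * s) = tsD a s := by
  unfold tsD
  rw [← mul_sub, ts_indPlus_mul _ _ hc, ts_indPlus_mul _ _ hc]

lemma ts_indPlus_cont (s : ℝ) (h : s ≠ 0) : ContinuousAt indPlus s := by
  rcases lt_or_gt_of_ne h with h | h
  · have : indPlus =ᶠ[𝓝 s] fun _ => 0 := by
      filter_upwards [Iio_mem_nhds h] with x hx
      simp only [indPlus, if_neg (not_le.2 (mem_Iio.1 hx))]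
    exact continuousAt_const.congr this.symm
  · have : indPlus =ᶠ[𝓝 s] fun _ => 1 := by
      filter_upwards [Ioi_mem_nhds h] with x hx
      simp only [indPlus, if_pos (le_of_lt (mem_Ioi.1 hx))]
    exact continuousAt_const.congr this.symm

lemma tsD_integral (a : ℝ) : ∫ t, tsD a t = -a := by
  rcases le_total 0 a with h | h
  · have : tsD a = (Ico 0 a).indicator (fun _ => (-1:ℝ)) := by
      ext s
      simp only [tsD, indPlus, indicator, mem_Ico]
      split_ifs <;> grind
    rw [this, integral_indicator measurableSet_Ico]
    simp [h]
  · have : tsD a = (Ico a 0).indicator (fun _ => (1:ℝ)) := by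
      ext s
      simp only [tsD, indPlus, indicator, mem_Ico]
      split_ifs <;> grind
    rw [this, integral_indicator measurableSet_Ico]
    simp [h]

/-- the embedding -/
def tsT (d : ℕ) (p : ℝ × Euc (d+1)) : Euc (d+2) := WithLp.toLp 2 (Fin.cons p.1 p.2.ofLp)

lemma tsT_zero (d : ℕ) (p : ℝ × Euc (d+1)) : tsT d p 0 = p.1 := rfl

lemma tsT_norm (d : ℕ) (p : ℝ × Euc (d+1)) : ‖tsT d p‖^2 = p.1^2 + ‖p.2‖^2 := by
  rw [EuclideanSpace.norm_sq_eq, EuclideanSpace.norm_sq_eq, Fin.sum_univ_succ]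
  simp [tsT]

lemma tsT_sub (d : ℕ) (s t : ℝ) (y : Euc (d+1)) : tsT d (s, y) - tsT d (t, y) = tsT d (s - t, 0) := by
  ext i
  refine Fin.cases ?_ (fun j => ?_) i <;> simp [tsT]

lemma tsT_pad (d : ℕ) (y : Euc (d+1)) : tsT d (0, y) = pad d y := rfl

lemma tsT_cont (d : ℕ) : Continuous (tsT d) := by
  unfold tsT
  refine (PiLp.continuous_toLp 2 _).comp ?_
  refine continuous_pi fun i => ?_
  refine Fin.cases ?_ (fun j => ?_) i
  · simpa using! continuous_fst
  · simp only [Fin.cons_succ]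
    fun_prop

lemma tsT_mp (d : ℕ) : MeasurePreserving (tsT d) (volume.prod volume) volume := by
  have h1 := (volume_preserving_piFinSuccAbove (fun _ : Fin (d+2) => ℝ) 0).symm
  have h2 := PiLp.volume_preserving_toLp (Fin (d+2))
  have h3 : MeasurePreserving (Prod.map (id : ℝ → ℝ) (fun y : Euc (d+1) => y.ofLp))
     (volume.prod volume) (volume.prod volume) :=
    (MeasurePreserving.id _).prod (PiLp.volume_preserving_ofLp (Fin (d+1)))
  have h4 := h2.comp (h1.comp h3)
  have h5 : tsT d = (WithLp.toLp 2 ∘ (MeasurableEquiv.piFinSuccAbove (fun _ : Fin (d+2) => ℝ) 0).symm ∘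
      Prod.map (id : ℝ → ℝ) (fun y : Euc (d+1) => y.ofLp)) := by
    funext p
    ext i
    refine Fin.cases ?_ (fun j => ?_) i <;> simp [tsT, MeasurableEquiv.piFinSuccAbove]
  rw [h5]
  exact h4

lemma tsT_emb (d : ℕ) : MeasurableEmbedding (tsT d) := by
  refine (tsT_cont d).measurableEmbedding ?_
  intro p q h
  have h0 : ∀ i, tsT d p i = tsT d q i := fun i => by rw [h]
  refine Prod.ext (h0 0) ?_
  ext j
  simpa [tsT] using h0 j.succ

lemma ts_null (d : ℕ) (A : Euc (d+2) →L[ℝ] Euc (d+2)) :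
    ∀ᵐ z : Euc (d+2), z 0 + @inner ℝ _ _ (A z) z ≠ 0 := by
  have h0 : ∀ᵐ z : Euc (d+2), z 0 ≠ 0 := by
    rw [← (tsT_mp d).map_eq, (tsT_emb d).ae_map_iff]
    simp only [tsT_zero]
    rw [Measure.ae_prod_iff_ae_ae]
    · have : ∀ᵐ x : ℝ, x ≠ 0 := by simp [ae_iff]
      filter_upwards [this] with x hx
      exact ae_of_all _ fun _ => hx
    · exact measurable_fst (measurableSet_singleton (0:ℝ)).compl
  set g : Euc (d+2) → ℝ := fun z => @inner ℝ _ _ (A z) z / z 0 with hg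
  have gm : Measurable g := by
    refine Measurable.div ?_ ?_
    · exact Continuous.measurable (by fun_prop)
    · exact Continuous.measurable (by fun_prop)
  have hs : ∀ (c : ℝ), c ≠ 0 → ∀ z, g (c • z) = c * g z := by
    intro c hc z
    simp only [hg, map_smul, inner_smul_left, inner_smul_right, PiLp.smul_apply, smul_eq_mul,
      conj_trivial]
    rcases eq_or_ne (z 0) 0 with h | h
    · simp [h]
    · field_simp
  have hc := Measure.countable_meas_level_set_pos (μ := (volume : Measure (Euc (d+2)))) gm
  have key : (volume : Measure (Euc (d+2))) {z | g z = -1} = 0 := by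
    by_contra hne
    have : Set.Iio (0:ℝ) ⊆ {t | 0 < (volume : Measure (Euc (d+2))) {z | g z = t}} := by
      intro t ht
      have ht : t < 0 := ht
      have h2 := Measure.addHaar_preimage_smul (volume : Measure (Euc (d+2)))
        (r := -t) (by linarith) {z | g z = t}
      have h3 : (fun x : Euc (d+2) => (-t) • x) ⁻¹' {z | g z = t} = {z | g z = -1} := by
        ext z
        simp only [mem_preimage, mem_ofPred_eq]
        rw [hs _ (by linarith)]
        constructor
        · intro h
          have : t * (g z + 1) = 0 := by linarith
          rcases mul_eq_zero.1 this with h | h <;> linarith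
        · intro h; rw [h]; ring
      rw [h3] at h2
      rw [mem_ofPred_eq, pos_iff_ne_zero]
      intro h4
      rw [h4, mul_zero] at h2
      exact hne h2
    have := hc.mono this
    exact absurd this (by
      intro h
      have := h.measure_zero volume
      simp at this)
  have key' : ∀ᵐ z : Euc (d+2), g z ≠ -1 := by
    rw [ae_iff]; simpa using key
  filter_upwards [h0, key'] with z hz1 hz2 h
  apply hz2
  simp only [hg]
  rw [div_eq_iff hz1]; linarith

lemma ts_decay (x p : ℝ) (hx : 0 ≤ x) (hp : 0 ≤ p) :
    (1 + x ^ p)⁻¹ ≤ 2 ^ p * (1 + x) ^ (-p) := by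
  rw [Real.rpow_neg (by linarith), ← div_eq_mul_inv, inv_eq_one_div,
    div_le_div_iff₀ (by positivity) (by positivity), one_mul]
  rcases le_total x 1 with h | h
  · calc (1 + x) ^ p ≤ 2 ^ p := Real.rpow_le_rpow (by linarith) (by linarith) hp
      _ ≤ 2 ^ p * (1 + x ^ p) := by
        have := Real.rpow_nonneg hx p
        have : (0:ℝ) ≤ 2 ^ p := by positivity
        nlinarith
  · calc (1 + x) ^ p ≤ (2 * x) ^ p := Real.rpow_le_rpow (by linarith) (by linarith) hp
      _ = 2 ^ p * x ^ p := Real.mul_rpow (by norm_num) hx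
      _ ≤ 2 ^ p * (1 + x ^ p) := by
        have : (0:ℝ) ≤ 2 ^ p := by positivity
        nlinarith

lemma ts_lip (d : ℕ) (A : Euc (d+2) →L[ℝ] Euc (d+2)) (σ ε s t : ℝ) (hσ : 0 < σ) (hε : 0 < ε)
    (y : Euc (d+1))
    (hs : ‖tsT d (σ * s, y)‖ < (4 * (‖A‖ + 1))⁻¹ / ε)
    (ht : ‖tsT d (σ * t, y)‖ < (4 * (‖A‖ + 1))⁻¹ / ε) :
    |s - t| ≤ 2 * |(s + ε / σ * @inner ℝ _ _ (A (tsT d (σ * s, y))) (tsT d (σ * s, y)))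
      - (t + ε / σ * @inner ℝ _ _ (A (tsT d (σ * t, y))) (tsT d (σ * t, y)))| := by
  have hn : ‖tsT d (σ * s, y) - tsT d (σ * t, y)‖ = σ * |s - t| := by
    rw [tsT_sub]
    have := tsT_norm d (σ * s - σ * t, 0)
    simp only [norm_zero] at this
    rw [← sq_eq_sq₀ (norm_nonneg _) (by positivity), this, mul_pow, sq_abs]
    ring
  set x := tsT d (σ * s, y)
  set z := tsT d (σ * t, y)
  have hA := norm_nonneg A
  have h1 : |@inner ℝ _ _ (A x) x - @inner ℝ _ _ (A z) z| ≤ ‖A‖ * ‖x - z‖ * (‖x‖ + ‖z‖) := by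
    have e : @inner ℝ _ _ (A x) x - @inner ℝ _ _ (A z) z =
        @inner ℝ _ _ (A (x - z)) x + @inner ℝ _ _ (A z) (x - z) := by
      rw [map_sub, inner_sub_left, inner_sub_right]; ring
    rw [e]
    calc _ ≤ |@inner ℝ _ _ (A (x - z)) x| + |@inner ℝ _ _ (A z) (x - z)| := abs_add_le _ _
      _ ≤ ‖A (x - z)‖ * ‖x‖ + ‖A z‖ * ‖x - z‖ :=
        add_le_add (abs_real_inner_le_norm _ _) (abs_real_inner_le_norm _ _)
      _ ≤ (‖A‖ * ‖x - z‖) * ‖x‖ + (‖A‖ * ‖z‖) * ‖x - z‖ := by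
        gcongr <;> exact A.le_opNorm _
      _ = _ := by ring
  have h2 : |ε / σ * (@inner ℝ _ _ (A x) x - @inner ℝ _ _ (A z) z)| ≤ |s - t| / 2 := by
    rw [abs_mul, abs_of_pos (by positivity)]
    calc _ ≤ ε / σ * (‖A‖ * (σ * |s - t|) * ((4 * (‖A‖ + 1))⁻¹ / ε + (4 * (‖A‖ + 1))⁻¹ / ε)) := by
          refine mul_le_mul_of_nonneg_left (h1.trans ?_) (by positivity)
          rw [hn]
          refine mul_le_mul_of_nonneg_left (by linarith) (by positivity)
      _ = (‖A‖ / (‖A‖ + 1)) * (|s - t| / 2) := by field_simp; ring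
      _ ≤ 1 * (|s - t| / 2) := by
          refine mul_le_mul_of_nonneg_right ?_ (by positivity)
          rw [div_le_one (by positivity)]; linarith
      _ = _ := one_mul _
  have e2 : s - t = ((s + ε / σ * @inner ℝ _ _ (A x) x) - (t + ε / σ * @inner ℝ _ _ (A z) z))
     - ε / σ * (@inner ℝ _ _ (A x) x - @inner ℝ _ _ (A z) z) := by ring
  have h3 : |s - t| ≤ |(s + ε / σ * @inner ℝ _ _ (A x) x) - (t + ε / σ * @inner ℝ _ _ (A z) z)|
     + |ε / σ * (@inner ℝ _ _ (A x) x - @inner ℝ _ _ (A z) z)| := by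
    conv_lhs => rw [e2]
    exact abs_sub _ _
  linarith

lemma ts_eps (α : ℝ) (hα : α ∈ Set.Ioo (0:ℝ) 1) :
    Tendsto (fun σ : ℝ => σ ^ (α⁻¹ : ℝ)) (𝓝[>] 0) (𝓝[>] 0) ∧
    Tendsto (fun σ : ℝ => σ ^ (α⁻¹ : ℝ) / σ) (𝓝[>] 0) (𝓝 0) := by
  have key : ∀ b : ℝ, 0 < b → Tendsto (fun σ : ℝ => σ ^ b) (𝓝[>] 0) (𝓝 0) := by
    intro b hb
    have := (Real.continuous_rpow_const hb.le).tendsto 0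
    rw [Real.zero_rpow hb.ne'] at this
    exact this.mono_left nhdsWithin_le_nhds
  have hb : 1 < α⁻¹ := (one_lt_inv₀ hα.1).2 hα.2
  constructor
  · refine tendsto_nhdsWithin_iff.2 ⟨key _ (by linarith), ?_⟩
    filter_upwards [self_mem_nhdsWithin] with σ hσ
    exact Real.rpow_pos_of_pos hσ _
  · refine (key (α⁻¹ - 1) (by linarith)).congr' ?_
    filter_upwards [self_mem_nhdsWithin] with σ hσ
    rw [Real.rpow_sub_one (ne_of_gt hσ)]

/-- the inner integrand -/
def tsF (d : ℕ) (α a : ℝ) (P : Euc (d+2) → ℝ) (A : Euc (d+2) →L[ℝ] Euc (d+2)) (σ : ℝ)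
    (p : ℝ × Euc (d+1)) : ℝ :=
  if ‖tsT d (σ * p.1, p.2)‖ < (4 * (‖A‖ + 1))⁻¹ / σ ^ (α⁻¹ : ℝ) then
    tsD a (p.1 + σ ^ (α⁻¹ : ℝ) / σ *
      @inner ℝ _ _ (A (tsT d (σ * p.1, p.2))) (tsT d (σ * p.1, p.2))) * P (tsT d (σ * p.1, p.2))
  else 0

lemma tsF_meas (d : ℕ) (α a : ℝ) (P : Euc (d+2) → ℝ) (hP : Continuous P)
    (A : Euc (d+2) →L[ℝ] Euc (d+2)) (σ : ℝ) : Measurable (tsF d α a P A σ) := by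
  have c : Continuous (fun p : ℝ × Euc (d+1) => tsT d (σ * p.1, p.2)) :=
    (tsT_cont d).comp (by fun_prop)
  unfold tsF
  refine Measurable.ite ?_ (Measurable.mul ?_ ?_) measurable_const
  · exact (isOpen_lt c.norm continuous_const).measurableSet
  · refine (tsD_meas a).comp (Continuous.measurable ?_)
    fun_prop
  · exact (hP.comp c).measurable

lemma tsF_le (d : ℕ) (α a : ℝ) (P : Euc (d+2) → ℝ) (hP0 : ∀ x, 0 ≤ P x)
    (A : Euc (d+2) →L[ℝ] Euc (d+2)) (σ M t : ℝ) (y : Euc (d+1))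
    (hM : ∀ s, P (tsT d (s, y)) ≤ M) : |tsF d α a P A σ (t, y)| ≤ M := by
  unfold tsF
  have h0 := (hP0 _).trans (hM 0)
  split_ifs
  · rw [abs_mul, abs_of_nonneg (hP0 _)]
    calc _ ≤ 1 * M := mul_le_mul (tsD_abs_le _ _) (hM _) (hP0 _) zero_le_one
      _ = M := one_mul _
  · simpa using h0

lemma tsF_supp (d : ℕ) (α a : ℝ) (P : Euc (d+2) → ℝ)
    (A : Euc (d+2) →L[ℝ] Euc (d+2)) (σ t : ℝ) (y : Euc (d+1))
    (h : tsF d α a P A σ (t, y) ≠ 0) :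
    ‖tsT d (σ * t, y)‖ < (4 * (‖A‖ + 1))⁻¹ / σ ^ (α⁻¹ : ℝ) ∧
    |t + σ ^ (α⁻¹ : ℝ) / σ *
      @inner ℝ _ _ (A (tsT d (σ * t, y))) (tsT d (σ * t, y))| ≤ |a| := by
  unfold tsF at h
  split_ifs at h with h1
  · exact ⟨h1, (tsD_ne _ _ (left_ne_zero_of_mul h)).1⟩
  · simp at h

lemma tsF_int_le (d : ℕ) (α a : ℝ) (P : Euc (d+2) → ℝ) (hP0 : ∀ x, 0 ≤ P x)
    (A : Euc (d+2) →L[ℝ] Euc (d+2)) (σ M : ℝ) (hσ : 0 < σ) (y : Euc (d+1))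
    (hM : ∀ s, P (tsT d (s, y)) ≤ M) : ‖∫ t, tsF d α a P A σ (t, y)‖ ≤ 8 * |a| * M := by
  have h0 := (hP0 _).trans (hM 0)
  by_cases hex : ∃ s, tsF d α a P A σ (s, y) ≠ 0
  · obtain ⟨s, hs⟩ := hex
    have hs := tsF_supp _ _ _ _ _ _ _ _ hs
    have b : ∀ t, ‖tsF d α a P A σ (t, y)‖ ≤
        (Icc (s - 4 * |a|) (s + 4 * |a|)).indicator (fun _ => M) t := by
      intro t
      by_cases ht : tsF d α a P A σ (t, y) = 0
      · rw [ht, norm_zero]; exact indicator_nonneg (fun _ _ => h0) _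
      · have ht := tsF_supp _ _ _ _ _ _ _ _ ht
        have := ts_lip d A σ _ t s hσ (Real.rpow_pos_of_pos hσ _) y ht.1 hs.1
        have h5 := abs_sub (t + σ ^ (α⁻¹ : ℝ) / σ *
          @inner ℝ _ _ (A (tsT d (σ * t, y))) (tsT d (σ * t, y))) (s + σ ^ (α⁻¹ : ℝ) / σ *
          @inner ℝ _ _ (A (tsT d (σ * s, y))) (tsT d (σ * s, y)))
        have h6 : |t - s| ≤ 4 * |a| := by linarith [ht.2, hs.2]
        rw [abs_le] at h6
        rw [indicator_of_mem (by constructor <;> linarith)]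
        exact tsF_le d α a P hP0 A σ M t y hM
    refine (norm_integral_le_of_norm_le ?_ (ae_of_all _ b)).trans ?_
    · exact (integrable_indicator_iff measurableSet_Icc).2 (by simp)
    · rw [integral_indicator measurableSet_Icc]
      simp only [integral_const, smul_eq_mul]
      have ha := abs_nonneg a
      simp [Measure.real]
      linarith
  · push Not at hex
    simp only [hex, integral_zero, norm_zero]
    positivity

lemma tsF_lim (d : ℕ) (α : ℝ) (hα : α ∈ Set.Ioo (0:ℝ) 1) (a : ℝ) (P : Euc (d+2) → ℝ)
    (hP : Continuous P) (hP0 : ∀ x, 0 ≤ P x)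
    (A : Euc (d+2) →L[ℝ] Euc (d+2)) (M : ℝ) (y : Euc (d+1))
    (hM : ∀ s, P (tsT d (s, y)) ≤ M) :
    Tendsto (fun σ => ∫ t, tsF d α a P A σ (t, y)) (𝓝[>] 0) (𝓝 (-a * P (pad d y))) := by
  have h0 := (hP0 _).trans (hM 0)
  obtain ⟨e1, e2⟩ := ts_eps α hα
  have e3 : Tendsto (fun σ : ℝ => (4 * (‖A‖ + 1))⁻¹ / σ ^ (α⁻¹ : ℝ)) (𝓝[>] 0) atTop := by
    have := (tendsto_inv_nhdsGT_zero.comp e1).const_mul_atTop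
      (show 0 < (4 * (‖A‖ + 1))⁻¹ by have := norm_nonneg A; positivity)
    exact this
  rw [← tsD_integral, ← integral_mul_const]
  refine tendsto_integral_filter_of_dominated_convergence
    ((Icc (-(2 * (|a| + 1))) (2 * (|a| + 1))).indicator (fun _ => M)) ?_ ?_ ?_ ?_
  · exact Eventually.of_forall fun σ =>
      ((tsF_meas d α a P hP A σ).comp (by fun_prop : Measurable fun t : ℝ => (t, y))).aestronglyMeasurable
  · have l1 : Tendsto (fun σ : ℝ => |σ ^ (α⁻¹ : ℝ) / σ *
      @inner ℝ _ _ (A (tsT d (0, y))) (tsT d (0, y))|) (𝓝[>] 0) (𝓝 0) := by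
      simpa using (e2.mul_const (@inner ℝ _ _ (A (tsT d (0, y))) (tsT d (0, y)))).abs
    filter_upwards [l1.eventually_lt_const zero_lt_one, e3.eventually_gt_atTop (‖tsT d (0, y)‖),
      self_mem_nhdsWithin] with σ h1 h2 hσ
    refine ae_of_all _ fun t => ?_
    by_cases ht : tsF d α a P A σ (t, y) = 0
    · rw [ht, norm_zero]; exact indicator_nonneg (fun _ _ => h0) _
    · have ht := tsF_supp _ _ _ _ _ _ _ _ ht
      have := ts_lip d A σ _ t 0 hσ (Real.rpow_pos_of_pos hσ _) y ht.1 (by rw [mul_zero]; exact h2)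
      rw [mul_zero] at this
      have h5 := abs_sub (t + σ ^ (α⁻¹ : ℝ) / σ *
          @inner ℝ _ _ (A (tsT d (σ * t, y))) (tsT d (σ * t, y))) (0 + σ ^ (α⁻¹ : ℝ) / σ *
          @inner ℝ _ _ (A (tsT d (0, y))) (tsT d (0, y)))
      rw [zero_add] at h5 this
      have h6 : |t| ≤ 2 * (|a| + 1) := by rw [sub_zero] at this; linarith [ht.2]
      rw [abs_le] at h6
      rw [indicator_of_mem (by constructor <;> linarith)]
      exact tsF_le d α a P hP0 A σ M t y hM
  · exact (integrable_indicator_iff measurableSet_Icc).2 (by simp)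
  · have n0 : ∀ᵐ x : ℝ, x ≠ 0 := by simp [ae_iff]
    have na : ∀ᵐ x : ℝ, x ≠ a := by simp [ae_iff]
    filter_upwards [n0, na] with t ht0 hta
    have lT : Tendsto (fun σ : ℝ => tsT d (σ * t, y)) (𝓝[>] 0) (𝓝 (tsT d (0, y))) := by
      have : Continuous (fun σ : ℝ => tsT d (σ * t, y)) := (tsT_cont d).comp (by fun_prop)
      have := this.tendsto 0
      rw [zero_mul] at this
      exact this.mono_left nhdsWithin_le_nhds
    have cq : Continuous (fun z : Euc (d+2) => @inner ℝ _ _ (A z) z) := by fun_prop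
    have lq := (cq.tendsto _).comp lT
    have lh : Tendsto (fun σ : ℝ => t + σ ^ (α⁻¹ : ℝ) / σ *
      @inner ℝ _ _ (A (tsT d (σ * t, y))) (tsT d (σ * t, y))) (𝓝[>] 0) (𝓝 t) := by
      simpa using (e2.mul lq).const_add t
    have cD : ContinuousAt (tsD a) t := by
      unfold tsD
      refine ContinuousAt.sub ?_ (ts_indPlus_cont t ht0)
      exact ContinuousAt.comp (f := fun s => s - a) (g := indPlus)
        (ts_indPlus_cont (t - a) (sub_ne_zero.2 hta)) (by fun_prop)
    have lim := (cD.tendsto.comp lh).mul ((hP.tendsto _).comp lT)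
    rw [tsT_pad] at lim
    refine lim.congr' ?_
    filter_upwards [lT.norm.eventually_lt_const (lt_add_one _),
      e3.eventually_gt_atTop (‖tsT d (0, y)‖ + 1)] with σ h1 h2
    simp only [tsF, Function.comp]
    rw [if_pos (h1.trans h2)]

lemma ts_P_int (d : ℕ) (α : ℝ) (hα : α ∈ Set.Ioo (0:ℝ) 1) (P : Euc (d+2) → ℝ)
    (hP : Continuous P) (hP0 : ∀ x, 0 ≤ P x) (K : ℝ)
    (hPd : ∀ x, P x ≤ K * (1 + ‖x‖) ^ (-(((d : ℝ) + 2) + α))) : Integrable P := by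
  have hi : Integrable (fun x : Euc (d+2) => K * (1 + ‖x‖) ^ (-(((d : ℝ) + 2) + α))) := by
    refine (integrable_one_add_norm ?_).const_mul K
    rw [finrank_euclideanSpace_fin]
    push_cast
    linarith [hα.1]
  refine hi.mono' hP.aestronglyMeasurable (ae_of_all _ fun x => ?_)
  rw [Real.norm_of_nonneg (hP0 x)]
  exact hPd x

/-- the full integrand -/
def tsG (d : ℕ) (α : ℝ) (P : Euc (d+2) → ℝ) (A : Euc (d+2) →L[ℝ] Euc (d+2)) (a σ : ℝ)
    (y : Euc (d+2)) : ℝ :=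
  tsD (a * σ) (y 0 + σ ^ (α⁻¹ : ℝ) * @inner ℝ _ _ (A y) y) * P y

lemma tsG_int (d : ℕ) (α : ℝ) (P : Euc (d+2) → ℝ) (hPi : Integrable P)
    (A : Euc (d+2) →L[ℝ] Euc (d+2)) (a σ : ℝ) : Integrable (tsG d α P A a σ) := by
  unfold tsG
  refine hPi.bdd_mul (c := 1) ?_ (ae_of_all _ fun x => tsD_abs_le _ _)
  refine ((tsD_meas _).comp (Continuous.measurable ?_)).aestronglyMeasurable
  fun_prop

lemma ts_inner (d : ℕ) (α : ℝ) (hα : α ∈ Set.Ioo (0:ℝ) 1) (P : Euc (d+2) → ℝ)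
    (hP : Continuous P) (hP0 : ∀ x, 0 ≤ P x) (K : ℝ)
    (hPd : ∀ x, P x ≤ K * (1 + ‖x‖) ^ (-(((d : ℝ) + 2) + α)))
    (A : Euc (d+2) →L[ℝ] Euc (d+2)) (a : ℝ) :
    Tendsto (fun σ : ℝ => σ⁻¹ * ∫ y in {y : Euc (d+2) | ‖y‖ < (4 * (‖A‖ + 1))⁻¹ / σ ^ (α⁻¹ : ℝ)},
      tsG d α P A a σ y) (𝓝[>] 0) (𝓝 (-a * ∫ y' : Euc (d+1), P (pad d y'))) := by
  have hK0 : 0 ≤ K := by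
    have := (hP0 0).trans (hPd 0)
    simpa using this
  have hM : ∀ (y : Euc (d+1)) (s : ℝ), P (tsT d (s, y)) ≤ K * (1 + ‖y‖) ^ (-(((d : ℝ) + 2) + α)) := by
    intro y s
    refine (hPd _).trans (mul_le_mul_of_nonneg_left ?_ hK0)
    refine Real.rpow_le_rpow_of_nonpos (by positivity) ?_ (by linarith [hα.1, (Nat.cast_nonneg d : (0:ℝ) ≤ d)])
    have := tsT_norm d (s, y)
    have : ‖y‖ ≤ ‖tsT d (s, y)‖ := by
      rw [← sq_le_sq₀ (norm_nonneg _) (norm_nonneg _), this]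
      simp only
      nlinarith [sq_nonneg s]
    linarith
  have main : Tendsto (fun σ : ℝ => ∫ y, ∫ t, tsF d α a P A σ (t, y)) (𝓝[>] 0)
      (𝓝 (∫ y' : Euc (d+1), -a * P (pad d y'))) := by
    refine tendsto_integral_filter_of_dominated_convergence
      (fun y : Euc (d+1) => 8 * |a| * (K * (1 + ‖y‖) ^ (-(((d : ℝ) + 2) + α)))) ?_ ?_ ?_ ?_
    · exact Eventually.of_forall fun σ =>
        ((tsF_meas d α a P hP A σ).stronglyMeasurable.integral_prod_left').aestronglyMeasurable
    · filter_upwards [self_mem_nhdsWithin] with σ hσ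
      exact ae_of_all _ fun y => tsF_int_le d α a P hP0 A σ _ hσ y (hM y)
    · refine ((integrable_one_add_norm ?_).const_mul K).const_mul _
      rw [finrank_euclideanSpace_fin]
      push_cast
      linarith [hα.1]
    · exact ae_of_all _ fun y => tsF_lim d α hα a P hP hP0 A _ y (hM y)
  rw [integral_const_mul] at main
  refine main.congr' ?_
  filter_upwards [self_mem_nhdsWithin] with σ hσ
  have hσ : 0 < σ := hσ
  have mB : MeasurableSet {y : Euc (d+2) | ‖y‖ < (4 * (‖A‖ + 1))⁻¹ / σ ^ (α⁻¹ : ℝ)} :=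
    (isOpen_lt continuous_norm continuous_const).measurableSet
  rw [← integral_indicator mB, ← (tsT_mp d).integral_comp (tsT_emb d), integral_prod_symm,
    ← integral_const_mul]
  · refine integral_congr_ae (ae_of_all _ fun y => ?_)
    simp only
    have := Measure.integral_comp_mul_left (fun x => ({y : Euc (d+2) | ‖y‖ < (4 * (‖A‖ + 1))⁻¹ / σ ^ (α⁻¹ : ℝ)}).indicator
      (tsG d α P A a σ) (tsT d (x, y))) σ
    rw [abs_of_pos (inv_pos.2 hσ), smul_eq_mul] at this
    rw [← this]
    refine integral_congr_ae (ae_of_all _ fun t => ?_)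
    simp only [tsF, indicator, mem_ofPred_eq, tsG, tsT_zero]
    split_ifs
    · rw [← tsD_mul a σ _ hσ, mul_comm σ a]
      congr 2
      field_simp
    · rfl
  · exact ((tsT_mp d).integrable_comp_emb (tsT_emb d)).2
      ((tsG_int d α P (ts_P_int d α hα P hP hP0 K hPd) A a σ).indicator mB)

lemma ts_outer (d : ℕ) (α : ℝ) (hα : α ∈ Set.Ioo (0:ℝ) 1) (P : Euc (d+2) → ℝ)
    (hP : Continuous P) (hP0 : ∀ x, 0 ≤ P x) (K : ℝ) (hK0 : 0 < K)
    (hPd : ∀ x, P x ≤ K * (1 + ‖x‖) ^ (-(((d : ℝ) + 2) + α)))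
    (A : Euc (d+2) →L[ℝ] Euc (d+2)) (a : ℝ) :
    Tendsto (fun σ : ℝ => σ⁻¹ * ∫ y in {y : Euc (d+2) | ‖y‖ < (4 * (‖A‖ + 1))⁻¹ / σ ^ (α⁻¹ : ℝ)}ᶜ,
      tsG d α P A a σ y) (𝓝[>] 0) (𝓝 0) := by
  have hr : 0 < (4 * (‖A‖ + 1))⁻¹ := by have := norm_nonneg A; positivity
  set r := (4 * (‖A‖ + 1))⁻¹
  set p : ℝ := ((d : ℝ) + 2) + α with hp
  have hp0 : 0 < p := by have := hα.1; positivity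
  obtain ⟨e1, -⟩ := ts_eps α hα
  have e1' := e1.mono_right nhdsWithin_le_nhds
  set H : ℝ → Euc (d+2) → ℝ := fun σ z => {z : Euc (d+2) | r ≤ ‖z‖}.indicator (fun z =>
    tsD (a * σ * σ ^ (α⁻¹ : ℝ)) (z 0 + @inner ℝ _ _ (A z) z) *
      (σ⁻¹ * ((σ ^ (α⁻¹ : ℝ)) ^ (d + 2))⁻¹ * P ((σ ^ (α⁻¹ : ℝ))⁻¹ • z))) z with hH
  have mB : MeasurableSet {z : Euc (d+2) | r ≤ ‖z‖} :=
    (isClosed_le continuous_const continuous_norm).measurableSet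
  have main : Tendsto (fun σ : ℝ => ∫ z, H σ z) (𝓝[>] 0) (𝓝 (∫ z : Euc (d+2), (0:ℝ))) := by
    refine tendsto_integral_filter_of_dominated_convergence
      (fun z : Euc (d+2) => K * ((r / (1 + r)) ^ (-p) * (1 + ‖z‖) ^ (-p))) ?_ ?_ ?_ ?_
    · refine Eventually.of_forall fun σ => Measurable.aestronglyMeasurable ?_
      refine Measurable.indicator (Measurable.mul ?_ ?_) mB
      · refine (tsD_meas _).comp (Continuous.measurable ?_)
        fun_prop
      · exact Continuous.measurable (by fun_prop)
    · filter_upwards [self_mem_nhdsWithin] with σ hσ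
      have hσ : 0 < σ := hσ
      have hε : 0 < σ ^ (α⁻¹ : ℝ) := Real.rpow_pos_of_pos hσ _
      have hεp : (σ ^ (α⁻¹ : ℝ)) ^ p = (σ ^ (α⁻¹ : ℝ)) ^ (d + 2) * σ := by
        rw [hp, Real.rpow_add hε, ← Real.rpow_mul hσ.le α⁻¹ α, inv_mul_cancel₀ hα.1.ne', Real.rpow_one,
          ← Real.rpow_natCast _ (d + 2)]
        push_cast
        rfl
      set ε := σ ^ (α⁻¹ : ℝ)
      refine ae_of_all _ fun z => ?_
      simp only [hH]
      by_cases hz : r ≤ ‖z‖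
      · have hz0 : 0 < ‖z‖ := hr.trans_le hz
        rw [indicator_of_mem (by exact hz), norm_mul]
        have hb : σ⁻¹ * (ε ^ (d + 2))⁻¹ * P (ε⁻¹ • z) ≤
            K * ((r / (1 + r)) ^ (-p) * (1 + ‖z‖) ^ (-p)) := by
          calc σ⁻¹ * (ε ^ (d + 2))⁻¹ * P (ε⁻¹ • z)
              ≤ σ⁻¹ * (ε ^ (d + 2))⁻¹ * (K * (ε⁻¹ * ‖z‖) ^ (-p)) := by
                refine mul_le_mul_of_nonneg_left ((hPd _).trans ?_) (by positivity)
                refine mul_le_mul_of_nonneg_left ?_ hK0.le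
                refine Real.rpow_le_rpow_of_nonpos (by positivity) ?_ (by linarith)
                rw [norm_smul, Real.norm_of_nonneg (by positivity)]
                linarith
            _ = K * ‖z‖ ^ (-p) := by
                rw [Real.mul_rpow (by positivity) (by positivity), Real.inv_rpow hε.le,
                  Real.rpow_neg hε.le, inv_inv, hεp]
                field_simp
            _ ≤ K * ((r / (1 + r)) * (1 + ‖z‖)) ^ (-p) := by
                refine mul_le_mul_of_nonneg_left ?_ hK0.le
                refine Real.rpow_le_rpow_of_nonpos (by positivity) ?_ (by linarith)
                rw [div_mul_eq_mul_div, div_le_iff₀ (by positivity)]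
                nlinarith
            _ = _ := by rw [Real.mul_rpow (by positivity) (by positivity)]
        rw [Real.norm_of_nonneg (mul_nonneg (by positivity) (hP0 _))]
        calc _ ≤ 1 * (K * ((r / (1 + r)) ^ (-p) * (1 + ‖z‖) ^ (-p))) :=
              mul_le_mul (tsD_abs_le _ _) hb (mul_nonneg (by positivity) (hP0 _)) zero_le_one
          _ = _ := one_mul _
      · rw [indicator_of_notMem (by exact hz), norm_zero]
        positivity
    · refine ((integrable_one_add_norm ?_).const_mul _).const_mul _
      rw [finrank_euclideanSpace_fin]
      push_cast
      linarith [hα.1]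
    · filter_upwards [ts_null d A] with z hz
      have l0 : Tendsto (fun σ : ℝ => |a * σ * σ ^ (α⁻¹ : ℝ)|) (𝓝[>] 0) (𝓝 0) := by
        have i : Tendsto (fun σ : ℝ => σ) (𝓝[>] 0) (𝓝 0) := nhdsWithin_le_nhds
        simpa using ((i.const_mul a).mul e1').abs
      refine tendsto_const_nhds.congr' ?_
      filter_upwards [l0.eventually_lt_const (abs_pos.2 hz)] with σ h
      have : tsD (a * σ * σ ^ (α⁻¹ : ℝ)) (z 0 + @inner ℝ _ _ (A z) z) = 0 := by
        by_contra hne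
        exact absurd (tsD_ne _ _ hne).1 (not_le.2 h)
      simp [hH, indicator, this]
  rw [integral_zero] at main
  refine main.congr' ?_
  filter_upwards [self_mem_nhdsWithin] with σ hσ
  have hσ : 0 < σ := hσ
  have hε : 0 < σ ^ (α⁻¹ : ℝ) := Real.rpow_pos_of_pos hσ _
  have mC : MeasurableSet {y : Euc (d+2) | ‖y‖ < r / σ ^ (α⁻¹ : ℝ)} :=
    (isOpen_lt continuous_norm continuous_const).measurableSet
  rw [← integral_indicator mC.compl]
  have sc := Measure.integral_comp_inv_smul_of_nonneg (volume : Measure (Euc (d+2)))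
    ({y : Euc (d+2) | ‖y‖ < r / σ ^ (α⁻¹ : ℝ)}ᶜ.indicator (tsG d α P A a σ)) hε.le
  rw [finrank_euclideanSpace_fin, smul_eq_mul] at sc
  have sc2 : σ⁻¹ * ∫ x, {y : Euc (d+2) | ‖y‖ < r / σ ^ (α⁻¹ : ℝ)}ᶜ.indicator (tsG d α P A a σ) x =
    (σ⁻¹ * ((σ ^ (α⁻¹ : ℝ)) ^ (d + 2))⁻¹) * ∫ x, {y : Euc (d+2) | ‖y‖ < r / σ ^ (α⁻¹ : ℝ)}ᶜ.indicator
      (tsG d α P A a σ) ((σ ^ (α⁻¹ : ℝ))⁻¹ • x) := by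
    rw [sc, mul_assoc, inv_mul_cancel_left₀ (pow_pos hε _).ne']
  rw [sc2, ← integral_const_mul]
  refine integral_congr_ae (ae_of_all _ fun z => ?_)
  simp only [hH]
  set ε := σ ^ (α⁻¹ : ℝ) with hεd
  have hiff : (ε⁻¹ • z ∈ {y : Euc (d+2) | ‖y‖ < r / ε}ᶜ) ↔ z ∈ {z : Euc (d+2) | r ≤ ‖z‖} := by
    simp only [mem_compl_iff, mem_ofPred_eq, not_lt]
    rw [norm_smul, Real.norm_of_nonneg (by positivity), div_eq_inv_mul]
    exact mul_le_mul_iff_right₀ (by positivity)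
  by_cases hz : z ∈ {z : Euc (d+2) | r ≤ ‖z‖}
  · rw [indicator_of_mem hz, indicator_of_mem (hiff.2 hz)]
    simp only [tsG, ← hεd]
    have : tsD (a * σ) ((ε⁻¹ • z) 0 + ε * @inner ℝ _ _ (A (ε⁻¹ • z)) (ε⁻¹ • z)) =
        tsD (a * σ * ε) (z 0 + @inner ℝ _ _ (A z) z) := by
      rw [← tsD_mul (a * σ) ε _ hε]
      simp only [map_smul, inner_smul_left, inner_smul_right, PiLp.smul_apply, smul_eq_mul,
        conj_trivial]
      congr 1
      · ring
      · field_simp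
    rw [this]
    ring
  · rw [indicator_of_notMem hz, indicator_of_notMem (fun h => hz (hiff.1 h)), mul_zero]

/-- The derivative computation `ψ'(0)` in the proof of Proposition 3.1: the time-shift
`aσ` in the thresholded quadratic perturbation of the hyperplane `{y₁ = 0}` contributes
`-a ∫_{ℝ^{N-1}} P(0,y') dy'` to first order in `σ`. -/
theorem threshold_shift_derivative
    (d : ℕ) (α : ℝ) (hα : α ∈ Set.Ioo (0:ℝ) 1)
    (P : Euc (d+2) → ℝ) (hP_cont : Continuous P) (hP_nonneg : ∀ x, 0 ≤ P x)
    (C₀ : ℝ) (hC₀ : 0 < C₀)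
    (hdecay : ∀ x : Euc (d+2), P x ≤ C₀ * (1 + ‖x‖ ^ (((d : ℝ) + 2) + α))⁻¹)
    (A : Euc (d+2) →L[ℝ] Euc (d+2))
    (hA : ∀ x y : Euc (d+2), @inner ℝ _ _ (A x) y = @inner ℝ _ _ x (A y))
    (a : ℝ) :
    Tendsto (fun σ : ℝ => σ⁻¹ * ∫ y : Euc (d+2),
        (indPlus (y 0 + σ ^ (α⁻¹ : ℝ) * @inner ℝ _ _ (A y) y - a * σ) -
          indPlus (y 0 + σ ^ (α⁻¹ : ℝ) * @inner ℝ _ _ (A y) y)) * P y)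
      (nhdsWithin 0 (Set.Ioi 0))
      (nhds (-a * ∫ y' : Euc (d+1), P (pad d y'))) := by
  set p : ℝ := ((d : ℝ) + 2) + α with hp
  have hp0 : 0 < p := by have := hα.1; positivity
  set K : ℝ := C₀ * 2 ^ p with hK
  have hK0 : 0 < K := by positivity
  have hPd : ∀ x, P x ≤ K * (1 + ‖x‖) ^ (-p) := by
    intro x
    refine (hdecay x).trans ?_
    rw [hK, mul_assoc]
    exact mul_le_mul_of_nonneg_left (ts_decay _ _ (norm_nonneg _) hp0.le) hC₀.le
  have hPi : Integrable P := ts_P_int d α hα P hP_cont hP_nonneg K hPd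
  have hin := ts_inner d α hα P hP_cont hP_nonneg K hPd A a
  have hout := ts_outer d α hα P hP_cont hP_nonneg K hK0 hPd A a
  have hsum := hin.add hout
  rw [add_zero] at hsum
  refine hsum.congr fun σ => ?_
  rw [← mul_add, integral_add_compl]
  · rfl
  · exact (isOpen_lt continuous_norm continuous_const).measurableSet
  · exact tsG_int d α P hPi A a σ

end
end
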